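/- Let f : ℝ² → ℝ² be an orientation-preserving homeomorphism and U ⊊ ℝ² an open f-invariant simply connected set. Assume that f is ∂-nonwandering in U, that some extension F of f|_U to c_E(U,ℝ²) has no fixed point in b_E(U,ℝ²) (i.e. ρ(f,U) ≠ 0), and that U is unbounded. Then f has no fixed point in ℝ²∖U; that is, every fixed point of f lies in U. -/

import Mathlib

open Set Topology Filter

noncomputable section

universe u

variable {X : Type u} [TopologicalSpace X]

/-- A homeomorphism is *orientation preserving* if it is isotopic to the identity. -/
def IsOrientationPreserving (f : X ≃ₜ X) : Prop :=
  ∃ H : unitInterval × X → X,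
    Continuous H ∧ (∀ x, H (0, x) = x) ∧ (∀ x, H (1, x) = f x) ∧
      ∀ t : unitInterval, IsHomeomorph fun x => H (t, x)

/-- `D` is a connected component of `A`. -/
def IsCompOf (A D : Set X) : Prop := ∃ x ∈ A, D = connectedComponentIn A x

/-- `A` has exactly two connected components, the distinct sets `D₁` and `D₂`. -/
def HasTwoComps (A D₁ D₂ : Set X) : Prop :=
  IsCompOf A D₁ ∧ IsCompOf A D₂ ∧ D₁ ≠ D₂ ∧
    ∀ x ∈ A, connectedComponentIn A x = D₁ ∨ connectedComponentIn A x = D₂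

/-- A *cross-cut* of the open set `U`: the image of an arc `g` on `(0,1)`, where `g` is
continuous and injective on `[0,1]`'s interior, runs inside `U`, has endpoints on `∂U`, and
separates `U` into exactly two components, each with a boundary point on `∂U` away from the
closed arc. -/
def IsCrossCut (U γ : Set X) : Prop :=
  ∃ g : ℝ → X,
    ContinuousOn g (Icc 0 1) ∧ InjOn g (Ioo 0 1) ∧ (∀ t ∈ Ioo (0:ℝ) 1, g t ∈ U) ∧
      g 0 ∈ frontier U ∧ g 1 ∈ frontier U ∧ γ = g '' Ioo 0 1 ∧
      ∃ D₁ D₂ : Set X, HasTwoComps (U \ γ) D₁ D₂ ∧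
        (frontier D₁ ∩ (frontier U \ g '' Icc 0 1)).Nonempty ∧
        (frontier D₂ ∩ (frontier U \ g '' Icc 0 1)).Nonempty

/-- A *cross-section* of `U`: a connected component of `U ∖ γ` for a cross-cut `γ`. -/
def IsCrossSection (U D : Set X) : Prop := ∃ γ : Set X, IsCrossCut U γ ∧ IsCompOf (U \ γ) D

/-- The image of a set under the `k`-th integer iterate of a homeomorphism. -/
def iterZ (f : X ≃ₜ X) (k : ℤ) (A : Set X) : Set X := ⇑(f.toEquiv ^ k) '' A

/-- A cross-section of `U` which is wandering for `f^n`. -/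
def IsWanderingSection (f : X ≃ₜ X) (U : Set X) (n : ℕ) (D : Set X) : Prop :=
  IsCrossSection U D ∧ ∀ k : ℤ, k ≠ 0 → iterZ f ((n : ℤ) * k) D ∩ D = ∅

/-- `f` is ∂-nonwandering in `U`. -/
def BdNonwandering (f : X ≃ₜ X) (U : Set X) : Prop :=
  ∀ n : ℕ, 1 ≤ n → ∃ K : Set X, IsCompact K ∧ K ⊆ U ∧
    ∀ D : Set X, IsWanderingSection f U n D →
      (∃ k : ℤ, 0 < k ∧ (iterZ f ((n : ℤ) * k) D ∩ K).Nonempty) ∧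
      (∃ k : ℤ, k < 0 ∧ (iterZ f ((n : ℤ) * k) D ∩ K).Nonempty)

/-- The boundary of `D` inside `U` (for `D` open in `U`). -/
def bdIn (U D : Set X) : Set X := (closure D \ D) ∩ U

/-- A chain of cross-sections of `U`. -/
def IsPEChain (U : Set X) (D : ℕ → Set X) : Prop :=
  (∀ i, IsCrossSection U (D i)) ∧ (∀ i j : ℕ, j ≤ i → D i ⊆ D j) ∧
    ∀ i j : ℕ, i ≠ j → closure (bdIn U (D i)) ∩ closure (bdIn U (D j)) = ∅

/-- The chain `D` divides the cross-section `E`. -/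
def ChainDividesSection (D : ℕ → Set X) (E : Set X) : Prop := ∃ N : ℕ, ∀ i, N ≤ i → D i ⊆ E

/-- The chain `D` divides the chain `D'`. -/
def ChainDivides (D D' : ℕ → Set X) : Prop := ∀ n : ℕ, ∃ m : ℕ, D m ⊆ D' n

/-- A prime chain: a chain dividing every chain that divides it. -/
def IsPrimeChain (U : Set X) (D : ℕ → Set X) : Prop :=
  IsPEChain U D ∧ ∀ D' : ℕ → Set X, IsPEChain U D' → ChainDivides D' D → ChainDivides D D'

/-- The type of prime chains of `U`. -/
def PrimeChain (U : Set X) : Type u := {D : ℕ → Set X // IsPrimeChain U D}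

/-- A prime end of `U`: an equivalence class of prime chains. -/
def PrimeEnd (U : Set X) : Type u :=
  Quot fun C C' : PrimeChain U => ChainDivides C.1 C'.1 ∧ ChainDivides C'.1 C.1

/-- The prime end `p` divides the cross-section `E`. -/
def PrimeEndDivides {U : Set X} (p : PrimeEnd U) (E : Set X) : Prop :=
  ∃ C : PrimeChain U, Quot.mk _ C = p ∧ ChainDividesSection C.1 E

/-- The prime ends compactification of `U` (as a set: `U ⊔ (prime ends)`). -/
def PrimeEndComp (U : Set X) : Type u := ↥U ⊕ PrimeEnd U

/-- A point of `U`, as an element of the prime ends compactification. -/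
def pePt (U : Set X) (x : ↥U) : PrimeEndComp U := Sum.inl x

/-- A prime end, as an element of the prime ends compactification. -/
def peEnd (U : Set X) (p : PrimeEnd U) : PrimeEndComp U := Sum.inr p

/-- The copy of a subset `V ⊆ U` inside the prime ends compactification. -/
def peOpen (U V : Set X) : Set (PrimeEndComp U) := {z | ∃ x : ↥U, z = pePt U x ∧ (x : X) ∈ V}

/-- The basic set `E ∪ i_E(E)` of the prime ends compactification, for a cross-section `E`. -/
def peSection (U E : Set X) : Set (PrimeEndComp U) :=
  peOpen U E ∪ {z | ∃ p : PrimeEnd U, z = peEnd U p ∧ PrimeEndDivides p E}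

/-- The topology of the prime ends compactification. -/
instance primeEndCompTopology (U : Set X) : TopologicalSpace (PrimeEndComp U) :=
  TopologicalSpace.generateFrom
    ({s | ∃ V : Set X, IsOpen V ∧ V ⊆ U ∧ s = peOpen U V} ∪
      {s | ∃ E : Set X, IsCrossSection U E ∧ s = peSection U E})

/-- The circle of prime ends, as a subset of the prime ends compactification. -/
def PrimeEndCircle (U : Set X) : Set (PrimeEndComp U) := Set.range (peEnd U)

/-- `F` is an extension of `f|_U` to the prime ends compactification of `U`. -/
def IsPEExtension (f : X ≃ₜ X) (U : Set X) (F : PrimeEndComp U ≃ₜ PrimeEndComp U) : Prop :=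
  ∀ (x : X) (hx : x ∈ U) (hfx : f x ∈ U), F (pePt U ⟨x, hx⟩) = pePt U ⟨f x, hfx⟩

/-- An end-cut of `U`: an injective arc in `U` defined on `[0,1)` converging in the ambient
space as `t → 1⁻`. -/
def IsEndCut (U : Set X) (γ : ℝ → X) : Prop :=
  ContinuousOn γ (Ico 0 1) ∧ InjOn γ (Ico 0 1) ∧ (∀ t ∈ Ico (0:ℝ) 1, γ t ∈ U) ∧
    ∃ z : X, Tendsto γ (𝓝[<] (1:ℝ)) (𝓝 z)

/-- `z` is an accessible point of `∂U`. -/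
def IsAccessiblePoint (U : Set X) (z : X) : Prop :=
  ∃ γ : ℝ → X, IsEndCut U γ ∧ Tendsto γ (𝓝[<] (1:ℝ)) (𝓝 z)

/-- `p` is an accessible prime end of `U`. -/
def IsAccessiblePrimeEnd (U : Set X) (p : PrimeEnd U) : Prop :=
  ∃ (γ : ℝ → X) (hγ : ∀ t ∈ Ico (0:ℝ) 1, γ t ∈ U), IsEndCut U γ ∧
    Tendsto (fun t : ↥(Ico (0:ℝ) 1) => pePt U ⟨γ ↑t, hγ ↑t t.2⟩)
      (comap Subtype.val (𝓝[<] (1:ℝ))) (𝓝 (peEnd U p))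

/-- A translation arc for `f` based at `x`: a simple arc from `x` to `f x` meeting its image
only as allowed. -/
def IsTranslationArc (f : X ≃ₜ X) (γ : Set X) (x : X) : Prop :=
  f x ≠ x ∧
    ∃ g : ℝ → X, ContinuousOn g (Icc 0 1) ∧ InjOn g (Icc 0 1) ∧
      g 0 = x ∧ g 1 = f x ∧ γ = g '' Icc 0 1 ∧
      ((⇑f '' γ) ∩ γ = {f x} ∨ ((⇑f '' γ) ∩ γ = {x, f x} ∧ f (f x) = x))

/-- An `N`-translation arc for `f` based at `x` (for `N = 1` this is just a translation arc). -/
def IsNTranslationArc (f : X ≃ₜ X) (N : ℕ) (γ : Set X) (x : X) : Prop :=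
  IsTranslationArc f γ x ∧
    (2 ≤ N →
      (∀ k : ℕ, 2 ≤ k → k ≤ N - 1 → (⇑f)^[k] '' γ ∩ γ = ∅) ∧
        ((⇑f)^[N] '' γ ∩ γ = ∅ ∨ ((⇑f)^[N] '' γ ∩ γ = {x} ∧ (⇑f)^[N + 1] x = x)))

/-- An ∞-translation arc: an `N`-translation arc for every `N ≥ 1`. -/
def IsInfTranslationArc (f : X ≃ₜ X) (γ : Set X) (x : X) : Prop :=
  ∀ N : ℕ, 1 ≤ N → IsNTranslationArc f N γ x

/-- A nonwandering homeomorphism. -/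
def IsNonwanderingMap (f : X → X) : Prop :=
  ∀ V : Set X, IsOpen V → V.Nonempty → ∃ n : ℕ, 1 ≤ n ∧ (f^[n] '' V ∩ V).Nonempty

/-- A loop contained in `A` which is not null-homotopic in `V`. -/
def IsEssentialLoopIn (V A : Set X) : Prop :=
  ∃ (z : ↥V) (δ : Path z z), (∀ t : unitInterval, (↑(δ t) : X) ∈ A) ∧
    ¬ δ.Homotopic (Path.refl z)

/-- An annular continuum: a continuum with an open annular neighborhood `V` such that `V ∖ K`
has exactly two components, each essential in `V`. -/
def IsAnnularContinuum (K : Set X) : Prop :=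
  IsCompact K ∧ IsConnected K ∧ K.Nontrivial ∧
    ∃ V : Set X, IsOpen V ∧ K ⊆ V ∧
      Nonempty (↥V ≃ₜ AddCircle (1 : ℝ) × ↥(Ioo (0 : ℝ) 1)) ∧
      ∃ D₁ D₂ : Set X, HasTwoComps (V \ K) D₁ D₂ ∧
        IsEssentialLoopIn V D₁ ∧ IsEssentialLoopIn V D₂

/-- A set contractible in the ambient surface: it has an open neighborhood homeomorphic to the
plane. -/
def ContractibleInSurface (K : Set X) : Prop :=
  ∃ W : Set X, IsOpen W ∧ K ⊆ W ∧ Nonempty (↥W ≃ₜ (ℝ × ℝ))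

/-- `α ∈ ℝ/ℤ` is rational. -/
def IsRationalAC (α : AddCircle (1 : ℝ)) : Prop := ∃ r : ℚ, α = ((r : ℝ) : AddCircle (1 : ℝ))

/-- The constant `q(α,g)`: the smallest positive integer `q` with `‖qα‖ = 0` if `α` is
rational, and `(2g+1)‖qα‖ < ‖α‖` if `α` is irrational. -/
def qConst (α : AddCircle (1 : ℝ)) (g : ℕ) : ℕ :=
  sInf {q : ℕ | 0 < q ∧
    ((IsRationalAC α ∧ ‖q • α‖ = 0) ∨
      (¬IsRationalAC α ∧ ((2 * g + 1 : ℕ) : ℝ) * ‖q • α‖ < ‖α‖))}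

/-- Hurwitz: a locally uniform limit of nonvanishing holomorphic functions which has a zero
vanishes near that zero. -/
theorem eventually_eq_zero_of_tendstoLocallyUniformlyOn {ι : Type*} {l : Filter ι} [l.NeBot]
    {F : ι → ℂ → ℂ} {f : ℂ → ℂ} {U : Set ℂ} (hU : IsOpen U)
    (hF : ∀ i, DifferentiableOn ℂ (F i) U) (hF0 : ∀ i, ∀ z ∈ U, F i z ≠ 0)
    (hlim : TendstoLocallyUniformlyOn F f l U) {b : ℂ} (hb : b ∈ U) (hfb : f b = 0) :
    ∀ᶠ z in 𝓝 b, f z = 0 := by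
  have hfd : DifferentiableOn ℂ f U := hlim.differentiableOn (Eventually.of_forall hF) hU
  have han : AnalyticAt ℂ f b := hfd.analyticAt (hU.mem_nhds hb)
  rcases han.eventually_eq_zero_or_eventually_ne_zero with h | h
  · exact h
  exfalso
  obtain ⟨r, hr, hrU⟩ : ∃ r > 0, Metric.closedBall b r ⊆ U ∩ {z | z ≠ b → f z ≠ 0} := by
    refine Metric.nhds_basis_closedBall.mem_iff.1 (inter_mem (hU.mem_nhds hb) ?_)
    exact eventually_nhdsWithin_iff.1 h
  have hsub : Metric.closedBall b r ⊆ U := fun z hz => (hrU hz).1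
  have hcomp : IsCompact (Metric.sphere b r) := isCompact_sphere b r
  have hne : (Metric.sphere b r).Nonempty := NormedSpace.sphere_nonempty.2 hr.le
  have hss : Metric.sphere b r ⊆ U := Metric.sphere_subset_closedBall.trans hsub
  obtain ⟨z0, hz0, hmin⟩ := hcomp.exists_isMinOn hne
    ((hfd.continuousOn.mono hss).norm)
  have hδ : 0 < ‖f z0‖ := by
    refine norm_pos_iff.2 ((hrU (Metric.sphere_subset_closedBall hz0)).2 ?_)
    exact Metric.ne_of_mem_sphere hz0 hr.ne'
  set δ := ‖f z0‖
  have hunif := (tendstoLocallyUniformlyOn_iff_forall_isCompact hU).1 hlim _ hsub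
    (isCompact_closedBall b r)
  rw [Metric.tendstoUniformlyOn_iff] at hunif
  obtain ⟨i, hi⟩ := (hunif (δ / 3) (by positivity)).exists
  have hsph : ∀ z ∈ Metric.sphere b r, 2 * δ / 3 ≤ ‖F i z‖ := by
    intro z hz
    have h1 := hi z (Metric.sphere_subset_closedBall hz)
    have h2 : δ ≤ ‖f z‖ := hmin hz
    rw [dist_eq_norm] at h1
    have := norm_sub_norm_le (f z) (F i z)
    linarith
  have hbb : ‖F i b‖ < δ / 3 := by
    have h1 := hi b (Metric.mem_closedBall_self hr.le)
    rwa [hfb, dist_zero_left] at h1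
  have hinv : DiffContOnCl ℂ (fun z => (F i z)⁻¹) (Metric.ball b r) := by
    refine DifferentiableOn.diffContOnCl ?_
    rw [closure_ball b hr.ne']
    exact ((hF i).mono hsub).inv fun z hz => hF0 i z (hsub hz)
  have hle : ‖(F i b)⁻¹‖ ≤ (2 * δ / 3)⁻¹ := by
    refine Complex.norm_le_of_forall_mem_frontier_norm_le Metric.isBounded_ball hinv ?_
      (subset_closure (Metric.mem_ball_self hr))
    intro z hz
    rw [frontier_ball b hr.ne'] at hz
    rw [norm_inv]
    exact inv_anti₀ (by positivity) (hsph z hz)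
  rw [norm_inv] at hle
  have hpos : 0 < ‖F i b‖ := norm_pos_iff.2 (hF0 i b hb)
  have := (inv_le_inv₀ hpos (by positivity)).1 hle
  linarith

/-- Montel, along an ultrafilter. -/
theorem exists_tendstoLocallyUniformlyOn_of_mapsTo_ball {ι : Type*} (l : Ultrafilter ι)
    {F : ι → ℂ → ℂ} {U : Set ℂ} (hU : IsOpen U)
    (hF : ∀ i, DifferentiableOn ℂ (F i) U) (hFb : ∀ i, MapsTo (F i) U (Metric.ball 0 1)) :
    ∃ f : ℂ → ℂ, TendstoLocallyUniformlyOn F f l U := by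
  have hpt : ∀ z ∈ U, ∃ w, Tendsto (fun i => F i z) l (𝓝 w) := by
    intro z hz
    have hc : IsCompact (Metric.closedBall (0:ℂ) 1) := isCompact_closedBall 0 1
    obtain ⟨w, -, hw⟩ := hc.ultrafilter_le_nhds (l.map fun i => F i z) (by
      rw [le_principal_iff]
      exact mem_map.2 (Eventually.of_forall fun i => Metric.ball_subset_closedBall (hFb i hz)))
    exact ⟨w, hw⟩
  choose! f hf using hpt
  refine ⟨f, ?_⟩
  rw [Metric.tendstoLocallyUniformlyOn_iff]
  intro ε hε x hx
  obtain ⟨R, hR, hRU⟩ := Metric.isOpen_iff.1 hU x hx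
  have hlip : ∀ i, ∀ z ∈ Metric.ball x R, dist (F i z) (F i x) ≤ 2 / R * dist z x := by
    intro i z hz
    refine Complex.dist_le_div_mul_dist_of_mapsTo_ball ((hF i).mono hRU) ?_ hz
    intro w hw
    have h1 := hFb i (hRU hw)
    have h2 := hFb i hx
    rw [mem_ball_zero_iff] at h1 h2
    rw [Metric.mem_closedBall, dist_eq_norm]
    exact (norm_sub_le _ _).trans (by linarith)
  have hlipf : ∀ z ∈ Metric.ball x R, dist (f z) (f x) ≤ 2 / R * dist z x := by
    intro z hz
    exact le_of_tendsto' ((hf z (hRU hz)).dist (hf x hx)) fun i => hlip i z hz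
  refine ⟨Metric.ball x (min R (R * ε / 6)),
    mem_nhdsWithin_of_mem_nhds (Metric.ball_mem_nhds x (by positivity)), ?_⟩
  filter_upwards [Metric.tendsto_nhds.1 (hf x hx) (ε / 3) (by positivity)] with i hi y hy
  have hyR : y ∈ Metric.ball x R := Metric.ball_subset_ball (min_le_left _ _) hy
  have hyd : dist y x < R * ε / 6 := lt_of_lt_of_le hy (min_le_right _ _)
  have h1 := hlip i y hyR
  have h2 := hlipf y hyR
  have h3 : 2 / R * dist y x < ε / 3 := by
    calc 2 / R * dist y x < 2 / R * (R * ε / 6) := by gcongr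
      _ = ε / 3 := by field_simp; norm_num
  calc dist (f y) (F i y) ≤ dist (f y) (f x) + dist (f x) (F i x) + dist (F i x) (F i y) :=
        dist_triangle4 _ _ _ _
    _ < ε := by rw [dist_comm (f x), dist_comm (F i x) (F i y)]; linarith

/-- The disc automorphism sending `c` to `0`. -/
def discMob (c z : ℂ) : ℂ := (z - c) / (1 - (starRingEnd ℂ) c * z)

theorem discMob_den_ne {c z : ℂ} (hc : ‖c‖ < 1) (hz : ‖z‖ < 1) :
    1 - (starRingEnd ℂ) c * z ≠ 0 := by
  intro h
  have : ‖(starRingEnd ℂ) c * z‖ = 1 := by rw [← sub_eq_zero.1 h]; simp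
  rw [norm_mul, RCLike.norm_conj] at this
  nlinarith [norm_nonneg c, norm_nonneg z]

theorem norm_discMob_lt {c z : ℂ} (hc : ‖c‖ < 1) (hz : ‖z‖ < 1) : ‖discMob c z‖ < 1 := by
  have hne := discMob_den_ne hc hz
  rw [discMob, norm_div, div_lt_one (norm_pos_iff.2 hne)]
  refine lt_of_pow_lt_pow_left₀ 2 (norm_nonneg _) ?_
  rw [← Complex.normSq_eq_norm_sq, ← Complex.normSq_eq_norm_sq]
  have h1 : Complex.normSq c < 1 := by
    rw [Complex.normSq_eq_norm_sq]; nlinarith [norm_nonneg c]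
  have h2 : Complex.normSq z < 1 := by
    rw [Complex.normSq_eq_norm_sq]; nlinarith [norm_nonneg z]
  simp only [Complex.normSq_apply, Complex.sub_re, Complex.sub_im, Complex.one_re,
    Complex.one_im, Complex.mul_re, Complex.mul_im, Complex.conj_re, Complex.conj_im] at *
  nlinarith [mul_pos (sub_pos.2 h1) (sub_pos.2 h2)]

theorem discMob_inj {c z w : ℂ} (hc : ‖c‖ < 1) (hz : ‖z‖ < 1) (hw : ‖w‖ < 1)
    (h : discMob c z = discMob c w) : z = w := by
  have h1 := discMob_den_ne hc hz
  have h2 := discMob_den_ne hc hw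
  have h3 := discMob_den_ne hc hc
  rw [discMob, discMob, div_eq_div_iff h1 h2] at h
  have : (z - w) * (1 - (starRingEnd ℂ) c * c) = 0 := by linear_combination h
  rcases mul_eq_zero.1 this with h | h
  · exact sub_eq_zero.1 h
  · exact absurd h h3

theorem hasDerivAt_discMob {c z : ℂ} (hc : ‖c‖ < 1) (hz : ‖z‖ < 1) :
    HasDerivAt (discMob c)
      ((1 - (starRingEnd ℂ) c * c) / (1 - (starRingEnd ℂ) c * z) ^ 2) z := by
  have h1 := discMob_den_ne hc hz
  have := ((hasDerivAt_id z).sub_const c).div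
    (((hasDerivAt_id z).const_mul ((starRingEnd ℂ) c)).const_sub 1) h1
  refine this.congr_deriv ?_
  simp only [id]
  congr 1
  ring

open Function Filter Metric Set Complex in
open scoped Pointwise Topology in
/-- If `U` is an open simply connected subset of `ℂ` that is not the whole `ℂ`,
then there exists a function `f : ℂ → ℂ` such that

- `f` is injective;
- the image `f '' U` isn't dense in `ℂ`;
- `f` is complex differentiable on `U` with nonzero derivative.

E.g., one can choose `a ∉ U`, then take `f z` to be the square root of `z - a`.
-/
theorem exists_injective_not_dense_image {U : Set ℂ} (hUo : IsOpen U)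
    (hUc : IsSimplyConnected U) (hU : U ≠ univ) :
    ∃ f : ℂ → ℂ, Injective f ∧ ¬Dense (f '' U) ∧ ∀ z ∈ U, deriv f z ≠ 0 := by
  -- WLOG, `0 ∉ U`, otherwise we choose `a ∉ U` and replace `U` with `-a +ᵥ U`
  wlog hU₀ : 0 ∉ U
  · rw [ne_univ_iff_exists_notMem] at hU
    rcases hU with ⟨a, ha⟩
    specialize this (hUo.vadd (-a)) (by simpa) (by simp [hU])
      (by simpa [mem_vadd_set_iff_neg_vadd_mem])
    rcases this with ⟨f, hf_inj, hf_dense, hdf⟩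
    refine ⟨f ∘ (-a + ·), hf_inj.comp (add_right_injective (-a)), ?_, fun z hz ↦ ?_⟩
    · simpa only [← image_vadd, Set.image_image] using! hf_dense
    · simpa [Function.comp_def, deriv_comp_const_add] using hdf (-a + z) (mapsTo_image _ _ hz)
  -- Choose a continuous branch of `√z` on `U`.
  -- This is the function we're looking for.
  rcases exists_continuousOn_pow_eq hUc hUo continuousOn_id (by rwa [image_id]) two_ne_zero
    with ⟨f, hfc, hf_inv⟩
  replace hf_inv : LeftInverse (· ^ 2) f := hf_inv
  -- Then `0 ∉ f '' U`
  have hf₀ : ∀ z ∈ U, f z ≠ 0 := by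
    intro z hz hfz
    simpa [hfz, (ne_of_mem_of_not_mem hz hU₀).symm] using hf_inv z
  -- Note that `f` is strictly differentiable at every point of `U`
  -- with derivative `1 / (2 * f z)`.
  have hdf : ∀ z ∈ U, HasStrictDerivAt f (2 * f z)⁻¹ z := by
    intro z hz
    apply HasStrictDerivAt.of_local_left_inverse
    · exact hfc.continuousAt <| hUo.mem_nhds hz
    · simpa using hasStrictDerivAt_pow 2 (f z)
    · simpa using hf₀ z hz
    · exact .of_forall hf_inv
  refine ⟨f, hf_inv.injective, ?_, fun z hz ↦ ?_⟩
  · -- Take a point `x ∈ U`.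
    simp only [Dense, not_forall, mem_closure_iff_frequently, not_frequently]
    rcases hUc.nonempty with ⟨x, hx⟩
    -- Show that `-f x` has a neighborhood disjoint with `f '' U`.
    use -f x
    -- Since `f` is strictly differentiable at `x` with nonzero derivative,
    -- `f '' U` is a neighborhood of `f x`.
    have : f '' U ∈ 𝓝 (f x) := by
      rw [← (hdf x hx).map_nhds_eq (by simpa using hf₀ x hx)]
      exact Filter.image_mem_map <| hUo.mem_nhds hx
    -- Then `-f '' U` is a neighborhood of `-f x`.
    rw [nhds_neg, eventually_neg]
    -- This neighborhood has to be disjoint with `f '' U`,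
    -- because `f a = - f b` implies `a = (f a) ^ 2 = (- f b) ^ 2 = b`, hence `f a = f b = 0`,
    -- which is impossible.
    filter_upwards [this]
    rintro _ ⟨a, ha, rfl⟩ ⟨b, hb, hab⟩
    obtain rfl : a = b := by
      rw [← hf_inv b, hab]
      simp [hf_inv a]
    refine hf₀ a ha ?_
    linear_combination hab / 2
  · simpa [(hdf z hz).hasDerivAt.deriv] using hf₀ z hz

open Function Filter Metric Set Complex in
open scoped Pointwise Topology in
/-- If `U` is an open simply connected subset of `ℂ` which is not the whole field,
then there exists a map `f : ℂ → ℂ` such that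

- `f` maps `U` to the unit disk;
- `f` is injective on `U`;
- `f` is differentiable on `U` with nonzero derivative.
-/
lemma exists_mapsTo_unitBall_injOn {U : Set ℂ} (hUo : IsOpen U)
    (hUc : IsSimplyConnected U) (hU : U ≠ univ) :
    ∃ f : ℂ → ℂ, MapsTo f U (ball 0 1) ∧ InjOn f U ∧ ∀ z ∈ U, deriv f z ≠ 0 := by
  -- Take a continuous branch of the square root on `U`.
  -- It is injective, differentiable function on `U`, and `f '' U` isn't dense in `ℂ`.
  rcases exists_injective_not_dense_image hUo hUc hU with ⟨f, hf_inj, hfd, hdf⟩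
  -- Choose a closed ball `Metric.closedBall x ε`, `ε > 0`, that is disjoint with `f '' U`.
  obtain ⟨x, ε, hε₀, hε⟩ : ∃ (x : ℂ) (ε : ℝ), 0 < ε ∧ ∀ a ∈ U, ε < dist (f a) x := by
    simpa [Dense, mem_closure_iff_nhds_basis Metric.nhds_basis_closedBall] using hfd
  have hfx : ∀ z ∈ U, f z ≠ x := fun z hz ↦ by simpa using hε₀.trans (hε z hz)
  -- Then `z ↦ ε / (f z - x)` satisfies all the assertions.
  use fun z ↦ ε / (f z - x)
  refine ⟨?mapsTo, ?injOn, ?deriv⟩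
  case mapsTo =>
    intro z hz
    rw [mem_ball_zero_iff, norm_div, norm_real, Real.norm_of_nonneg hε₀.le, div_lt_one₀]
    · simpa [dist_eq_norm] using hε z hz
    · simpa [sub_eq_zero] using hfx z hz
  case injOn =>
    intro z hz w hw heq
    simpa [div_eq_mul_inv, hε₀.ne', hf_inj.eq_iff] using heq
  case deriv =>
    intro z hz
    have hdz : DifferentiableAt ℂ f z := differentiableAt_of_deriv_ne_zero (hdf z hz)
    rw [(hasDerivAt_const _ _).fun_div (hdz.hasDerivAt.sub_const _) _ |>.deriv] <;>
      simp [*, ne_of_gt, sub_eq_zero]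

/-- The class of injective holomorphic maps to the disc used in the Riemann mapping theorem. -/
structure IsDiscEmbedding (U : Set ℂ) (a : ℂ) (f : ℂ → ℂ) : Prop where
  diff : DifferentiableOn ℂ f U
  maps : MapsTo f U (Metric.ball 0 1)
  inj : InjOn f U
  deriv_ne : ∀ z ∈ U, deriv f z ≠ 0
  zero : f a = 0

theorem exists_isDiscEmbedding {U : Set ℂ} (hUo : IsOpen U) (hUc : IsSimplyConnected U)
    (hU : U ≠ univ) {a : ℂ} (ha : a ∈ U) : ∃ f, IsDiscEmbedding U a f := by
  obtain ⟨f, hm, hi, hd⟩ := exists_mapsTo_unitBall_injOn hUo hUc hU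
  have hb : ∀ z ∈ U, ‖f z‖ < 1 := fun z hz => mem_ball_zero_iff.1 (hm hz)
  have hdf : ∀ z ∈ U, DifferentiableAt ℂ f z :=
    fun z hz => differentiableAt_of_deriv_ne_zero (hd z hz)
  have hda : ∀ z ∈ U, HasDerivAt (discMob (f a) ∘ f) _ z := fun z hz =>
    (hasDerivAt_discMob (hb a ha) (hb z hz)).comp z (hdf z hz).hasDerivAt
  refine ⟨discMob (f a) ∘ f, ⟨fun z hz => (hda z hz).differentiableAt.differentiableWithinAt,
    fun z hz => mem_ball_zero_iff.2 (norm_discMob_lt (hb a ha) (hb z hz)),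
    fun z hz w hw h => hi hz hw (discMob_inj (hb a ha) (hb z hz) (hb w hw) h), ?_, ?_⟩⟩
  · intro z hz
    rw [(hda z hz).deriv]
    exact mul_ne_zero (div_ne_zero (discMob_den_ne (hb a ha) (hb a ha))
      (pow_ne_zero _ (discMob_den_ne (hb a ha) (hb z hz)))) (hd z hz)
  · simp [discMob]

theorem isDiscEmbedding_of_limit {U : Set ℂ} (hUo : IsOpen U) (hUc : IsPreconnected U)
    {a : ℂ} (ha : a ∈ U) {ι : Type*} {l : Filter ι} [l.NeBot] {F : ι → ℂ → ℂ} {f : ℂ → ℂ}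
    (hF : ∀ i, IsDiscEmbedding U a (F i)) (hlim : TendstoLocallyUniformlyOn F f l U)
    (hne : deriv f a ≠ 0) : IsDiscEmbedding U a f := by
  have hfd : DifferentiableOn ℂ f U :=
    hlim.differentiableOn (Eventually.of_forall fun i => (hF i).diff) hUo
  have han : AnalyticOnNhd ℂ f U := hfd.analyticOnNhd hUo
  have hnc : ∀ b ∈ U, ∀ c, ¬ ∀ᶠ z in 𝓝 b, f z = c := by
    intro b hb c h
    have := han.eqOn_of_preconnected_of_eventuallyEq analyticOnNhd_const hUc hb h
    have h2 : f =ᶠ[𝓝 a] fun _ => c := by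
      filter_upwards [hUo.mem_nhds ha] with z hz using this hz
    rw [h2.deriv_eq] at hne
    simp at hne
  have hle : ∀ z ∈ U, ‖f z‖ ≤ 1 := fun z hz =>
    le_of_tendsto' (hlim.tendsto_at hz).norm fun i => (mem_ball_zero_iff.1 ((hF i).maps hz)).le
  refine ⟨hfd, ?_, ?_, ?_, ?_⟩
  · intro z hz
    rw [mem_ball_zero_iff]
    refine lt_of_le_of_ne (hle z hz) fun h => ?_
    have := Complex.eqOn_of_isPreconnected_of_isMaxOn_norm hUc hUo hfd hz
      (fun w hw => (hle w hw).trans h.ge)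
    exact hnc z hz (f z) (by filter_upwards [hUo.mem_nhds hz] with w hw using this hw)
  · intro z hz w hw h
    by_contra hzw
    have hV : IsOpen (U \ {z}) := hUo.sdiff isClosed_singleton
    have := eventually_eq_zero_of_tendstoLocallyUniformlyOn (l := l)
      (F := fun i x => F i x - F i z) (f := fun x => f x - f z) (b := w) hV
      (fun i => ((hF i).diff.mono sdiff_subset).sub_const _)
      (fun i x hx => sub_ne_zero.2 fun h => hx.2 ((hF i).inj hx.1 hz h)) ?_
      ⟨hw, fun h => hzw h.symm⟩ (sub_eq_zero.2 h.symm)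
    · exact hnc w hw (f z) (this.mono fun x hx => sub_eq_zero.1 hx)
    · have h1 := hlim.mono (sdiff_subset (t := {z}))
      rw [Metric.tendstoLocallyUniformlyOn_iff] at h1 ⊢
      intro ε hε x hx
      obtain ⟨t, ht, h2⟩ := h1 (ε / 2) (by positivity) x hx
      refine ⟨t, ht, ?_⟩
      filter_upwards [h2, Metric.tendsto_nhds.1 (hlim.tendsto_at hz) (ε / 2) (by positivity)]
        with i hi hi' y hy
      have e1 := hi y hy
      rw [dist_comm] at hi'
      calc dist (f y - f z) (F i y - F i z) ≤ dist (f y) (F i y) + dist (f z) (F i z) :=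
            dist_sub_sub_le _ _ _ _
        _ < ε := by linarith
  · intro z hz h0
    have := eventually_eq_zero_of_tendstoLocallyUniformlyOn (l := l) hUo
      (fun i => (hF i).diff.deriv hUo) (fun i x hx => (hF i).deriv_ne x hx)
      (hlim.deriv (Eventually.of_forall fun i => (hF i).diff) hUo) hz h0
    have h3 := (han.deriv).eqOn_of_preconnected_of_eventuallyEq
      (analyticOnNhd_const (v := (0:ℂ))) hUc hz this
    exact hne (h3 ha)
  · exact tendsto_nhds_unique (hlim.tendsto_at ha)
      (by simp [(hF _).zero])

/-- The Koebe square root trick. -/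
theorem exists_deriv_lt_of_notMem {U : Set ℂ} (hUo : IsOpen U) (hUc : IsSimplyConnected U)
    {a : ℂ} (ha : a ∈ U) {f : ℂ → ℂ} (hf : IsDiscEmbedding U a f) {c : ℂ} (hc : ‖c‖ < 1)
    (hcU : c ∉ f '' U) : ∃ g, IsDiscEmbedding U a g ∧ ‖deriv f a‖ < ‖deriv g a‖ := by
  have hb : ∀ z ∈ U, ‖f z‖ < 1 := fun z hz => mem_ball_zero_iff.1 (hf.maps hz)
  have hdf : ∀ z ∈ U, DifferentiableAt ℂ f z :=
    fun z hz => hf.diff.differentiableAt (hUo.mem_nhds hz)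
  have hda : ∀ z ∈ U, HasDerivAt (discMob c ∘ f) _ z := fun z hz =>
    (hasDerivAt_discMob hc (hb z hz)).comp z (hdf z hz).hasDerivAt
  have hg0 : ∀ z ∈ U, discMob c (f z) ≠ 0 := by
    intro z hz h
    rw [discMob, div_eq_zero_iff] at h
    rcases h with h | h
    · exact hcU ⟨z, hz, sub_eq_zero.1 h⟩
    · exact discMob_den_ne hc (hb z hz) h
  obtain ⟨s, hsc, hs⟩ := Complex.exists_continuousOn_pow_eq hUc hUo (g := discMob c ∘ f)
    (fun z hz => (hda z hz).continuousAt.continuousWithinAt) (by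
      rintro ⟨z, hz, h⟩; exact hg0 z hz h) two_ne_zero
  have hs0 : ∀ z ∈ U, s z ≠ 0 := by
    intro z hz h
    exact hg0 z hz (by have := hs z; simpa [h] using this.symm)
  have hsb : ∀ z ∈ U, ‖s z‖ < 1 := by
    intro z hz
    have h1 : ‖s z‖ ^ 2 < 1 := by
      rw [← norm_pow, hs]; exact norm_discMob_lt hc (hb z hz)
    nlinarith [norm_nonneg (s z)]
  set D : ℂ → ℂ := fun z =>
    (1 - (starRingEnd ℂ) c * c) / (1 - (starRingEnd ℂ) c * f z) ^ 2 * deriv f z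
  have hsd : ∀ z ∈ U, HasDerivAt s (D z / (2 * s z)) z := by
    intro z hz
    have hcont : ContinuousAt s z := hsc.continuousAt (hUo.mem_nhds hz)
    obtain ⟨δ, hδ⟩ : ∃ d, d = D z / (2 * s z) := ⟨_, rfl⟩
    have hsum : s z + s z ≠ 0 := by
      rw [← two_mul]; exact mul_ne_zero two_ne_zero (hs0 z hz)
    rw [hasDerivAt_iff_tendsto_slope]
    have h1 := (hasDerivAt_iff_tendsto_slope.1 (hda z hz))
    have h2 : Tendsto (fun y => s y + s z) (𝓝[≠] z) (𝓝 (s z + s z)) :=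
      (hcont.tendsto.mono_left nhdsWithin_le_nhds).add_const _
    have h3 := h1.div h2 hsum
    rw [two_mul]
    refine h3.congr' ?_
    filter_upwards [h2.eventually_ne hsum] with y hy
    simp only [Pi.div_apply, slope_def_field]
    rw [← hs y, ← hs z]
    field_simp
    ring
  have hsa := hsb a ha
  have hga : ∀ z ∈ U, HasDerivAt (discMob (s a) ∘ s) _ z := fun z hz =>
    (hasDerivAt_discMob hsa (hsb z hz)).comp z (hsd z hz)
  have hcc : 1 - (starRingEnd ℂ) c * c ≠ 0 := discMob_den_ne hc hc
  have hss : 1 - (starRingEnd ℂ) (s a) * s a ≠ 0 := discMob_den_ne hsa hsa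
  refine ⟨discMob (s a) ∘ s, ⟨fun z hz => (hga z hz).differentiableAt.differentiableWithinAt,
    fun z hz => mem_ball_zero_iff.2 (norm_discMob_lt hsa (hsb z hz)), ?_, ?_, ?_⟩, ?_⟩
  · intro z hz w hw h
    have h1 := discMob_inj hsa (hsb z hz) (hsb w hw) h
    have h2 : discMob c (f z) = discMob c (f w) := by
      have e1 := hs z; have e2 := hs w
      simp only [Function.comp] at e1 e2
      rw [← e1, ← e2, h1]
    exact hf.inj hz hw (discMob_inj hc (hb z hz) (hb w hw) h2)
  · intro z hz
    rw [(hga z hz).deriv]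
    refine mul_ne_zero (div_ne_zero hss (pow_ne_zero _ (discMob_den_ne hsa (hsb z hz))))
      (div_ne_zero (mul_ne_zero (div_ne_zero hcc (pow_ne_zero _ (discMob_den_ne hc (hb z hz))))
        (hf.deriv_ne z hz)) (mul_ne_zero two_ne_zero (hs0 z hz)))
  · simp [discMob]
  · rw [(hga a ha).deriv]
    simp only [D, hf.zero, mul_zero, sub_zero, one_pow, div_one]
    have hsq : ‖s a‖ ^ 2 = ‖c‖ := by
      rw [← norm_pow, hs]; simp [discMob, hf.zero]
    set t := ‖s a‖ with ht
    have ht0 : 0 < t := norm_pos_iff.2 (hs0 a ha)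
    have e1 : ‖1 - (starRingEnd ℂ) (s a) * s a‖ = 1 - t ^ 2 := by
      rw [mul_comm, Complex.mul_conj, Complex.normSq_eq_norm_sq, ← ht, ← Complex.ofReal_one,
        ← Complex.ofReal_sub, Complex.norm_real, Real.norm_of_nonneg]
      nlinarith
    have e2 : ‖1 - (starRingEnd ℂ) c * c‖ = 1 - t ^ 4 := by
      rw [mul_comm, Complex.mul_conj, Complex.normSq_eq_norm_sq, ← hsq, ← Complex.ofReal_one,
        ← Complex.ofReal_sub, Complex.norm_real, Real.norm_of_nonneg]
      · ring
      · nlinarith [pow_le_one₀ ht0.le hsa.le (n := 4)]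
    have hfp : 0 < ‖deriv f a‖ := norm_pos_iff.2 (hf.deriv_ne a ha)
    have h1t : 0 < 1 - t ^ 2 := by nlinarith
    simp only [norm_mul, norm_div, norm_pow, e1, e2, ← ht, Complex.norm_ofNat]
    have : (1 - t ^ 2) / (1 - t ^ 2) ^ 2 * ((1 - t ^ 4) * ‖deriv f a‖ / (2 * t))
        = (1 + t ^ 2) / (2 * t) * ‖deriv f a‖ := by field_simp; ring
    rw [this]
    have h3 : 1 < (1 + t ^ 2) / (2 * t) := by
      rw [lt_div_iff₀ (by positivity)]; nlinarith [sq_pos_of_pos (sub_pos.2 hsa)]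
    nlinarith

/-- The Riemann mapping theorem. -/
theorem exists_riemann_map {U : Set ℂ} (hUo : IsOpen U) (hUc : IsSimplyConnected U)
    (hU : U ≠ univ) : ∃ h φ : ℂ → ℂ, DifferentiableOn ℂ h U ∧
      DifferentiableOn ℂ φ (Metric.ball 0 1) ∧ MapsTo h U (Metric.ball 0 1) ∧
      MapsTo φ (Metric.ball 0 1) U ∧ (∀ x ∈ U, φ (h x) = x) ∧
      ∀ ζ ∈ Metric.ball (0:ℂ) 1, h (φ ζ) = ζ := by
  obtain ⟨a, ha⟩ := hUc.nonempty
  have hpc : IsPreconnected U := hUc.isPathConnected.isConnected.isPreconnected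
  obtain ⟨R, hR, hRU⟩ := Metric.isOpen_iff.1 hUo a ha
  set S : Set ℝ := {x | ∃ f, IsDiscEmbedding U a f ∧ x = ‖deriv f a‖} with hS
  have hbd : BddAbove S := by
    refine ⟨1 / R, ?_⟩
    rintro x ⟨f, hf, rfl⟩
    refine Complex.norm_deriv_le_div_of_mapsTo_ball (hf.diff.mono hRU) ?_ hR
    rw [hf.zero]
    exact fun z hz => Metric.ball_subset_closedBall (hf.maps (hRU hz))
  obtain ⟨f0, hf0⟩ := exists_isDiscEmbedding hUo hUc hU ha
  have hne : S.Nonempty := ⟨_, f0, hf0, rfl⟩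
  obtain ⟨u, -, hu, huS⟩ := exists_seq_tendsto_sSup hne hbd
  choose F hF hFu using huS
  obtain ⟨f, hlim⟩ := exists_tendstoLocallyUniformlyOn_of_mapsTo_ball (hyperfilter ℕ) hUo
    (fun i => (hF i).diff) fun i => (hF i).maps
  have hder := (hlim.deriv (Eventually.of_forall fun i => (hF i).diff) hUo).tendsto_at ha
  have hmax : ‖deriv f a‖ = sSup S := by
    refine tendsto_nhds_unique hder.norm ?_
    have : Tendsto u (hyperfilter ℕ : Filter ℕ) (𝓝 (sSup S)) :=
      hu.mono_left Nat.hyperfilter_le_atTop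
    refine this.congr fun n => ?_
    rw [hFu n]
    rfl
  have hpos : 0 < sSup S :=
    lt_of_lt_of_le (norm_pos_iff.2 (hf0.deriv_ne a ha)) (le_csSup hbd ⟨f0, hf0, rfl⟩)
  have hf : IsDiscEmbedding U a f := isDiscEmbedding_of_limit hUo hpc ha hF hlim
    (norm_pos_iff.1 (hmax ▸ hpos))
  have hsurj : ∀ ζ ∈ Metric.ball (0:ℂ) 1, ζ ∈ f '' U := by
    intro ζ hζ
    by_contra hn
    obtain ⟨g, hg, hlt⟩ := exists_deriv_lt_of_notMem hUo hUc ha hf (mem_ball_zero_iff.1 hζ) hn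
    have := le_csSup hbd ⟨g, hg, rfl⟩
    linarith
  choose! φ hφU hφ using hsurj
  have hinv : ∀ x ∈ U, φ (f x) = x := fun x hx =>
    hf.inj (hφU _ (hf.maps hx)) hx (hφ _ (hf.maps hx))
  refine ⟨f, φ, hf.diff, ?_, hf.maps, hφU, hinv, hφ⟩
  intro ζ hζ
  have hz := hφU ζ hζ
  have hopen : ∀ s ⊆ U, IsOpen s → IsOpen (f '' s) := by
    rcases (hf.diff.analyticOnNhd hUo).is_constant_or_isOpen hpc with ⟨w, hw⟩ | h
    · exfalso
      have : f =ᶠ[𝓝 a] fun _ => w := by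
        filter_upwards [hUo.mem_nhds ha] with z hz using hw z hz
      exact hf.deriv_ne a ha (by rw [this.deriv_eq]; simp)
    · exact h
  have hcont : ContinuousAt φ ζ := by
    intro V hV
    obtain ⟨V', hV', hVo, hzV⟩ := mem_nhds_iff.1 hV
    refine mem_map.2 (mem_of_superset ((hopen (V' ∩ U) inter_subset_right
      (hVo.inter hUo)).mem_nhds ⟨φ ζ, ⟨hzV, hz⟩, hφ ζ hζ⟩) ?_)
    rintro _ ⟨x, hx, rfl⟩
    rw [mem_preimage, hinv x hx.2]
    exact hV' hx.1
  have hd : HasDerivAt f (deriv f (φ ζ)) (φ ζ) :=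
    (hf.diff.differentiableAt (hUo.mem_nhds hz)).hasDerivAt
  exact (HasDerivAt.of_local_left_inverse hcont hd (hf.deriv_ne _ hz) (by
    filter_upwards [Metric.isOpen_ball.mem_nhds hζ] with y hy using hφ y hy)
    ).differentiableAt.differentiableWithinAt

theorem exists_continuousOn_log_of_convex {E : Type*} [NormedAddCommGroup E] [NormedSpace ℝ E]
    {C : Set E} (hC : Convex ℝ C) (hCo : IsOpen C) (hne : C.Nonempty) {g : E → ℂ}
    (hg : ContinuousOn g C) (hg0 : ∀ x ∈ C, g x ≠ 0) :
    ∃ f : E → ℂ, ContinuousOn f C ∧ ∀ x ∈ C, Complex.exp (f x) = g x := by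
  have := hC.contractibleSpace hne
  have hs : IsSimplyConnected C := SimplyConnectedSpace.ofContractible C
  obtain ⟨f, hf, h⟩ := Complex.exists_continuousOn_eqOn_exp_comp hs hCo hg
    (by rintro ⟨x, hx, h⟩; exact hg0 x hx h)
  exact ⟨f, hf, h⟩

/-- Lifting a homotopy of nonvanishing functions through the exponential. -/
theorem exists_homotopy_log {Y : Type*} [TopologicalSpace Y] {g : unitInterval × Y → ℂ}
    (hg : Continuous g) (hg0 : ∀ x, g x ≠ 0) {f₀ : Y → ℂ} (hf₀ : Continuous f₀)
    (h0 : ∀ y, Complex.exp (f₀ y) = g (0, y)) :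
    ∃ f : unitInterval × Y → ℂ, Continuous f ∧ (∀ x, Complex.exp (f x) = g x) ∧
      ∀ y, f (0, y) = f₀ y := by
  let H : C(unitInterval × Y, {z : ℂ // z ≠ 0}) :=
    ⟨fun x => ⟨g x, hg0 x⟩, hg.subtype_mk _⟩
  have H0 : ∀ y, H (0, y) = (⟨Complex.exp (f₀ y), Complex.exp_ne_zero _⟩ : {z : ℂ // z ≠ 0}) :=
    fun y => Subtype.ext (h0 y).symm
  refine ⟨Complex.isCoveringMap_exp.liftHomotopy H ⟨f₀, hf₀⟩ H0, ContinuousMap.continuous _,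
    fun x => ?_, Complex.isCoveringMap_exp.liftHomotopy_zero H ⟨f₀, hf₀⟩ H0⟩
  exact congrArg Subtype.val
    (congrFun (Complex.isCoveringMap_exp.liftHomotopy_lifts H ⟨f₀, hf₀⟩ H0) x)

theorem exists_int_of_continuousOn_of_isPreconnected {Y : Type*} [TopologicalSpace Y] {S : Set Y}
    (hS : IsPreconnected S) {f : Y → ℂ} (hf : ContinuousOn f S)
    (h : ∀ x ∈ S, ∃ n : ℤ, f x = n * (2 * Real.pi * Complex.I)) :
    ∃ n : ℤ, ∀ x ∈ S, f x = n * (2 * Real.pi * Complex.I) := by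
  have hpi : (2 * Real.pi * Complex.I : ℂ) ≠ 0 := Complex.two_pi_I_ne_zero
  rcases S.eq_empty_or_nonempty with rfl | ⟨a, ha⟩
  · exact ⟨0, by simp⟩
  choose! n hn using h
  refine ⟨n a, fun x hx => ?_⟩
  have hre : ContinuousOn (fun x => ((f x / (2 * Real.pi * Complex.I)).re)) S :=
    Complex.continuous_re.comp_continuousOn (hf.div_const _)
  have hreq : EqOn (fun x => ((f x / (2 * Real.pi * Complex.I)).re)) (fun x => (n x : ℝ)) S := by
    intro x hx
    simp only
    rw [hn x hx, mul_div_cancel_right₀ _ hpi, Complex.intCast_re]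
  have hc : ContinuousOn (fun x => (n x : ℝ)) S := hre.congr hreq.symm
  have hcZ : ContinuousOn n S := by
    rw [continuousOn_iff_continuous_domRestrict] at hc ⊢
    exact Int.isClosedEmbedding_coe_real.isEmbedding.continuous_iff.2 hc
  have := hS.constant hcZ hx ha
  rw [hn x hx, this]

/-- Two continuous logarithms on a preconnected set differ by a constant in `2πiℤ`. -/
theorem exists_int_of_exp_eq {Y : Type*} [TopologicalSpace Y] {S : Set Y}
    (hS : IsPreconnected S) {f g : Y → ℂ} (hf : ContinuousOn f S) (hg : ContinuousOn g S)
    (h : ∀ x ∈ S, Complex.exp (f x) = Complex.exp (g x)) :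
    ∃ n : ℤ, ∀ x ∈ S, f x = g x + n * (2 * Real.pi * Complex.I) := by
  obtain ⟨n, hn⟩ := exists_int_of_continuousOn_of_isPreconnected hS (hf.sub hg) fun x hx => by
    obtain ⟨n, hn⟩ := Complex.exp_eq_exp_iff_exists_int.1 (h x hx)
    exact ⟨n, by simp [hn]⟩
  exact ⟨n, fun x hx => by rw [← hn x hx]; simp⟩

theorem log_change_eq {Y : Type*} [TopologicalSpace Y] {S : Set Y}
    (hS : IsPreconnected S) {f g : Y → ℂ} (hf : ContinuousOn f S) (hg : ContinuousOn g S)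
    (h : ∀ x ∈ S, Complex.exp (f x) = Complex.exp (g x)) {a b : Y} (ha : a ∈ S) (hb : b ∈ S) :
    f b - f a = g b - g a := by
  obtain ⟨n, hn⟩ := exists_int_of_exp_eq hS hf hg h
  rw [hn a ha, hn b hb]; ring

theorem differentiableAt_of_exp_eq {f g : ℂ → ℂ} {z : ℂ} (hf : ContinuousAt f z)
    (hg : DifferentiableAt ℂ g z) (h : ∀ᶠ x in 𝓝 z, Complex.exp (f x) = g x) :
    DifferentiableAt ℂ f z := by
  have hz : Complex.exp (f z) = g z := h.self_of_nhds
  have h1 : Tendsto (fun x => (f x - f z).im) (𝓝 z) (𝓝 0) := by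
    have := (Complex.continuous_im.tendsto _).comp (hf.tendsto.sub_const (f z))
    simp only [sub_self, Complex.zero_im] at this
    exact this
  have hev : f =ᶠ[𝓝 z] fun x => Complex.log (g x / g z) + f z := by
    filter_upwards [h, h1.eventually (Ioo_mem_nhds (neg_lt_zero.2 Real.pi_pos) Real.pi_pos)]
      with x hx hx2
    rw [← hx, ← hz, ← Complex.exp_sub, Complex.log_exp hx2.1 hx2.2.le]
    ring
  refine DifferentiableAt.congr_of_eventuallyEq ?_ hev
  have hgz : g z ≠ 0 := hz ▸ Complex.exp_ne_zero _
  refine (DifferentiableAt.clog (hg.div_const _) ?_).add_const _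
  rw [div_self hgz]
  exact Complex.one_mem_slitPlane

theorem log_sub_log_neg {z : ℂ} (hz : 0 < z.im) :
    Complex.log z - Complex.log (-z) = Real.pi * Complex.I := by
  rw [Complex.log, Complex.log, norm_neg, Complex.arg_neg_eq_arg_sub_pi_of_im_pos hz]
  push_cast; ring

/-- The branch of the logarithm cut along the positive real axis. -/
def logPos (z : ℂ) : ℂ := Complex.log (-z) + Real.pi * Complex.I

theorem exp_logPos {z : ℂ} (hz : z ≠ 0) : Complex.exp (logPos z) = z := by
  rw [logPos, Complex.exp_add, Complex.exp_log (neg_ne_zero.2 hz), Complex.exp_pi_mul_I]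
  ring

theorem continuousAt_logPos {z : ℂ} (hz : -z ∈ Complex.slitPlane) : ContinuousAt logPos z :=
  ((continuousAt_clog hz).comp continuous_neg.continuousAt).add_const _

theorem logPos_sub_logPos_neg {z : ℂ} (hz : 0 < z.im) :
    logPos z - logPos (-z) = -(Real.pi * Complex.I) := by
  rw [logPos, logPos, neg_neg, ← log_sub_log_neg hz]
  ring

/-- The topological core of the window lemma: a degree count on a square. -/
theorem window_core {T : ℂ} (hT : T = 2 * Real.pi * Complex.I) {Φ : ℂ → ℂ} {q : ℂ × ℂ → ℂ}
    (hq : ContinuousOn q ({w | w.re < 0} ×ˢ {w | w.re < 0}))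
    (hqe : ∀ w w' : ℂ, w.re < 0 → w'.re < 0 →
      Φ w - Φ w' = Complex.exp (q (w, w')) * (w - w'))
    (hΦT : ∀ w : ℂ, w.re < 0 → Φ (w + T) = Φ w + T)
    {p κ : ℝ → ℂ} (hp : Continuous p) (hκ : Continuous κ) (hpW : ∀ s, (p s).re < 0)
    (hκim : ∀ u, |(κ u).im| < Real.pi / 2) (h0 : κ 0 = Φ (p 0)) (h1 : κ 1 = Φ (p 1))
    (hpos : ∀ s u, Φ (p s) ≠ κ u + T)
    (hneg : ∀ s u, Φ (p s) ≠ κ u - T)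
    (him : 2 * Real.pi < (p 1 - p 0).im)
    (hs0 : ∀ s, -(p s - p 0 - T) ∈ Complex.slitPlane)
    (hs0' : ∀ s, -(p s - p 0 + T) ∈ Complex.slitPlane)
    (hs1 : ∀ s, -(p s - p 1 - T) ∈ Complex.slitPlane)
    (hs1' : ∀ s, -(p s - p 1 + T) ∈ Complex.slitPlane) : False := by
  have hTre : T.re = 0 := by simp [hT]
  have hTim : T.im = 2 * Real.pi := by simp [hT]
  have hT0 : T ≠ 0 := hT ▸ Complex.two_pi_I_ne_zero
  have hpi := Real.pi_pos
  set W : Set ℂ := {w | w.re < 0} with hW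
  have hWc : Convex ℝ W := convex_halfSpace_re_lt 0
  have hWT : ∀ w ∈ W, w + T ∈ W := fun w hw => by simpa [hW, hTre] using hw
  have hWT' : ∀ w ∈ W, w - T ∈ W := fun w hw => by simpa [hW, hTre] using hw
  have hmap : ∀ {Y : Type} [TopologicalSpace Y] {S : Set Y} {a b : Y → ℂ}, ContinuousOn a S →
      ContinuousOn b S → (∀ y ∈ S, a y ∈ W) → (∀ y ∈ S, b y ∈ W) →
      ContinuousOn (fun y => q (a y, b y)) S := fun ha hb h h' =>
    hq.comp (ha.prodMk hb) fun y hy => ⟨h y hy, h' y hy⟩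
  -- symmetry properties of `q`
  have hqsym : ∀ w ∈ W, ∀ w' ∈ W, q (w, w') = q (w', w) := by
    intro w hw w' hw'
    have hcx : IsPreconnected (W ×ˢ W) := (hWc.prod hWc).isPreconnected
    by_cases hww : w = w'
    · rw [hww]
    have hdiag : ∀ u v : ℂ, u ∈ W → v ∈ W → Complex.exp (q (u, v)) = Complex.exp (q (v, u)) := by
      have hcl : IsClosed {x : W × W | Complex.exp (q (x.1.1, x.2.1)) =
          Complex.exp (q (x.2.1, x.1.1))} := by
        refine isClosed_eq (Complex.continuous_exp.comp ?_) (Complex.continuous_exp.comp ?_)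
        · exact hq.comp_continuous (by fun_prop) fun x => ⟨x.1.2, x.2.2⟩
        · exact hq.comp_continuous (by fun_prop) fun x => ⟨x.2.2, x.1.2⟩
      intro u v hu hv
      by_cases huv : u = v
      · rw [huv]
      have e1 := hqe u v hu hv
      have e2 := hqe v u hv hu
      have : (Complex.exp (q (u, v)) - Complex.exp (q (v, u))) * (u - v) = 0 := by
        linear_combination -e1 - e2
      rcases mul_eq_zero.1 this with h | h
      · exact sub_eq_zero.1 h
      · exact absurd (sub_eq_zero.1 h) huv
    obtain ⟨n, hn⟩ := exists_int_of_exp_eq hcx (f := q) (g := fun x => q (x.2, x.1)) hq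
      (hmap continuous_snd.continuousOn continuous_fst.continuousOn (fun y hy => hy.2)
        fun y hy => hy.1) (fun x hx => hdiag x.1 x.2 hx.1 hx.2)
    have e1 := hn (w, w) ⟨hw, hw⟩
    have e2 := hn (w, w') ⟨hw, hw'⟩
    simp only at e1 e2
    rw [e2, left_eq_add.1 e1, add_zero]
  have hqT : ∃ D, ∀ w ∈ W, q (w, w + T) = D := by
    obtain ⟨n, hn⟩ := exists_int_of_exp_eq hWc.isPreconnected (f := fun w => q (w, w + T))
      (g := fun _ => 0) (hmap continuousOn_id (by fun_prop) (fun y hy => hy) hWT)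
      continuousOn_const (by
        intro w hw
        have := hqe w (w + T) hw (hWT w hw)
        rw [hΦT w hw] at this
        have h2 : T * (Complex.exp (q (w, w + T)) - 1) = 0 := by linear_combination this
        rcases mul_eq_zero.1 h2 with h | h
        · exact absurd h hT0
        · rw [Complex.exp_zero]; exact sub_eq_zero.1 h)
    exact ⟨_, fun w hw => hn w hw⟩
  obtain ⟨D, hD⟩ := hqT
  have hDsymm : ∀ w ∈ W, q (w, w - T) = D := by
    intro w hw
    rw [hqsym w hw _ (hWT' w hw), ← hD (w - T) (hWT' w hw), sub_add_cancel]
  have hqtr : ∀ w ∈ W, ∀ w' ∈ W, q (w + T, w' + T) = q (w, w') := by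
    have hcx : IsPreconnected (W ×ˢ W) := (hWc.prod hWc).isPreconnected
    have hc2 : ContinuousOn (fun x : ℂ × ℂ => q (x.1 + T, x.2 + T)) (W ×ˢ W) :=
      hmap (by fun_prop) (by fun_prop) (fun y hy => hWT _ hy.1) fun y hy => hWT _ hy.2
    have hexp : ∀ u ∈ W, ∀ v ∈ W, u ≠ v →
        Complex.exp (q (u + T, v + T)) = Complex.exp (q (u, v)) := by
      intro u hu v hv huv
      have e1 := hqe u v hu hv
      have e2 := hqe (u + T) (v + T) (hWT u hu) (hWT v hv)
      rw [hΦT u hu, hΦT v hv] at e2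
      have : (Complex.exp (q (u + T, v + T)) - Complex.exp (q (u, v))) * (u - v) = 0 := by
        linear_combination e1 - e2
      rcases mul_eq_zero.1 this with h | h
      · exact sub_eq_zero.1 h
      · exact absurd (sub_eq_zero.1 h) huv
    have hexp' : ∀ x ∈ W ×ˢ W,
        Complex.exp (q (x.1 + T, x.2 + T)) = Complex.exp (q x) := by
      rintro ⟨u, v⟩ ⟨hu, hv⟩
      by_cases huv : u = v
      · subst huv
        have t1 : Tendsto (fun v => Complex.exp (q (u + T, v + T))) (𝓝[≠] u)
            (𝓝 (Complex.exp (q (u + T, u + T)))) := by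
          have : ContinuousOn (fun v => Complex.exp (q (u + T, v + T))) W :=
            Complex.continuous_exp.comp_continuousOn
              (hmap continuousOn_const (by fun_prop) (fun y hy => hWT _ hu) fun y hy => hWT _ hy)
          exact (this.continuousAt ((isOpen_lt Complex.continuous_re
            continuous_const).mem_nhds hu)).tendsto.mono_left nhdsWithin_le_nhds
        have t2 : Tendsto (fun v => Complex.exp (q (u, v))) (𝓝[≠] u)
            (𝓝 (Complex.exp (q (u, u)))) := by
          have : ContinuousOn (fun v => Complex.exp (q (u, v))) W :=
            Complex.continuous_exp.comp_continuousOn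
              (hmap continuousOn_const (by fun_prop) (fun y hy => hu) fun y hy => hy)
          exact (this.continuousAt ((isOpen_lt Complex.continuous_re
            continuous_const).mem_nhds hu)).tendsto.mono_left nhdsWithin_le_nhds
        refine tendsto_nhds_unique t1 (t2.congr' ?_)
        filter_upwards [self_mem_nhdsWithin, mem_nhdsWithin_of_mem_nhds
          ((isOpen_lt Complex.continuous_re continuous_const).mem_nhds hu)] with v hv hvW
        exact (hexp u hu v hvW (Ne.symm hv)).symm
      · exact hexp u hu v hv huv
    obtain ⟨n, hn⟩ := exists_int_of_exp_eq hcx hc2 hq hexp'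
    intro w hw w' hw'
    have e1 := hn (w, w + T) ⟨hw, hWT w hw⟩
    have e2 := hn (w, w') ⟨hw, hw'⟩
    simp only at e1 e2
    rw [hD _ (hWT w hw), hD _ hw] at e1
    rw [e2, left_eq_add.1 e1, add_zero]
  -- logarithms on the square
  have hA : ∀ c : ℂ, (∀ s u, Φ (p s) ≠ κ u + c) → ∃ A : ℝ × ℝ → ℂ, Continuous A ∧
      ∀ x, Complex.exp (A x) = Φ (p x.1) - κ x.2 - c := by
    intro c hc
    have hΦc : ContinuousOn Φ W := by
      intro w hw
      have : ContinuousOn (fun v => Φ w + Complex.exp (q (v, w)) * (v - w)) W :=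
        continuousOn_const.add ((Complex.continuous_exp.comp_continuousOn
          (hmap continuousOn_id continuousOn_const (fun y hy => hy) fun y hy => hw)).mul
          (by fun_prop))
      refine (this.congr fun v hv => ?_) w hw
      linear_combination hqe v w hv hw
    obtain ⟨A, hAc, hAe⟩ := exists_continuousOn_log_of_convex (E := ℝ × ℝ) convex_univ isOpen_univ
      univ_nonempty (g := fun x => Φ (p x.1) - κ x.2 - c) (by
        refine Continuous.continuousOn ?_
        have : Continuous fun x : ℝ × ℝ => Φ (p x.1) :=
          hΦc.comp_continuous (by fun_prop) fun x => hpW _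
        exact (this.sub (hκ.comp continuous_snd)).sub continuous_const)
          (fun x _ h => hc x.1 x.2 (by linear_combination h))
    exact ⟨A, continuousOn_univ.1 hAc, fun x => hAe x trivial⟩
  obtain ⟨A, hAc, hAe⟩ := hA T hpos
  obtain ⟨B, hBc, hBe⟩ := hA (-T) (fun s u => by simpa [sub_eq_add_neg] using hneg s u)
  have hside : ∀ (v : ℂ), v ∈ W → (∀ s, -(p s - v) ∈ Complex.slitPlane) → ∀ a : ℝ → ℂ,
      Continuous a → (∀ s, Complex.exp (a s) = Φ (p s) - Φ v) →
      a 1 - a 0 = q (p 1, v) + logPos (p 1 - v) - (q (p 0, v) + logPos (p 0 - v)) := by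
    intro v hv hsl a ha hae
    refine log_change_eq (S := univ) isPreconnected_univ ha.continuousOn
      (g := fun s => q (p s, v) + logPos (p s - v)) ?_ ?_ trivial trivial
    · refine (hmap hp.continuousOn continuousOn_const (fun s _ => hpW s) fun _ _ => hv).add ?_
      exact fun s _ => ((continuousAt_logPos (hsl s)).comp
        (f := fun s => p s - v) (by fun_prop)).continuousWithinAt
    · intro s _
      have hne : p s - v ≠ 0 := fun h => Complex.slitPlane_ne_zero (hsl s) (by simp [h])
      rw [hae, Complex.exp_add, exp_logPos hne, hqe _ _ (hpW s) hv]
  have hbot : ∀ (c : ℂ), (∀ u, c - κ u ∈ Complex.slitPlane) → ∀ a : ℝ → ℂ,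
      Continuous a → (∀ u, Complex.exp (a u) = c - κ u) →
      a 1 - a 0 = Complex.log (c - κ 1) - Complex.log (c - κ 0) := by
    intro c hsl a ha hae
    refine log_change_eq (S := univ) isPreconnected_univ ha.continuousOn
      (g := fun u => Complex.log (c - κ u)) ?_ ?_ trivial trivial
    · exact fun s _ => ((continuousAt_clog (hsl s)).comp
        (f := fun s => c - κ s) (by fun_prop)).continuousWithinAt
    · intro s _
      rw [hae, Complex.exp_log (Complex.slitPlane_ne_zero (hsl s))]
  have e0 := hpW 0
  have e1 := hpW 1
  have I0 := hside (p 0 + T) (hWT _ e0) (fun s => by rw [← sub_sub]; exact hs0 s)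
    (fun s => A (s, 0)) (by fun_prop) (fun s => by rw [hAe, hΦT _ e0, h0]; ring)
  have I1 := hside (p 1 + T) (hWT _ e1) (fun s => by rw [← sub_sub]; exact hs1 s)
    (fun s => A (s, 1)) (by fun_prop) (fun s => by rw [hAe, hΦT _ e1, h1]; ring)
  have hΦT' : ∀ w ∈ W, Φ (w - T) = Φ w - T := fun w hw => by
    have := hΦT (w - T) (hWT' w hw)
    rw [sub_add_cancel] at this
    rw [this]; ring
  have J0 := hside (p 0 - T) (hWT' _ e0) (fun s => by rw [← sub_add]; exact hs0' s)
    (fun s => B (s, 0)) (by fun_prop) (fun s => by rw [hBe, hΦT' _ e0, h0]; ring)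
  have J1 := hside (p 1 - T) (hWT' _ e1) (fun s => by rw [← sub_add]; exact hs1' s)
    (fun s => B (s, 1)) (by fun_prop) (fun s => by rw [hBe, hΦT' _ e1, h1]; ring)
  have him' : ∀ u v, |(κ u).im - (κ v).im| < Real.pi := fun u v => by
    have h1 := abs_lt.1 (hκim u); have h2 := abs_lt.1 (hκim v)
    rw [abs_lt]; constructor <;> linarith
  have hsl : ∀ u v, κ v - T - κ u ∈ Complex.slitPlane := fun u v => by
    refine Complex.mem_slitPlane_iff.2 (Or.inr ?_)
    have := abs_lt.1 (him' u v)
    simp only [Complex.sub_im, hTim]; intro h; linarith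
  have hsl' : ∀ u v, κ v + T - κ u ∈ Complex.slitPlane := fun u v => by
    refine Complex.mem_slitPlane_iff.2 (Or.inr ?_)
    have := abs_lt.1 (him' u v)
    simp only [Complex.sub_im, Complex.add_im, hTim]; intro h; linarith
  have K0 := hbot (κ 0 - T) (fun u => hsl u 0) (fun u => A (0, u)) (by fun_prop)
    (fun u => by rw [hAe, ← h0]; ring)
  have K1 := hbot (κ 1 - T) (fun u => hsl u 1) (fun u => A (1, u)) (by fun_prop)
    (fun u => by rw [hAe, ← h1]; ring)
  have M0 := hbot (κ 0 + T) (fun u => hsl' u 0) (fun u => B (0, u)) (by fun_prop)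
    (fun u => by rw [hBe, ← h0]; ring)
  have M1 := hbot (κ 1 + T) (fun u => hsl' u 1) (fun u => B (1, u)) (by fun_prop)
    (fun u => by rw [hBe, ← h1]; ring)
  have hv := logPos_sub_logPos_neg (z := p 1 - p 0 - T) (by rw [Complex.sub_im, hTim]; linarith)
  have hv' := logPos_sub_logPos_neg (z := p 1 - p 0 + T) (by rw [Complex.add_im, hTim]; linarith)
  have hTT := logPos_sub_logPos_neg (z := T) (by rw [hTim]; linarith)
  have hz := log_sub_log_neg (z := κ 1 - κ 0 + T) (by
    have := abs_lt.1 (him' 1 0)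
    simp only [Complex.sub_im, Complex.add_im, hTim]; linarith)
  have hz' := log_sub_log_neg (z := κ 0 - κ 1 + T) (by
    have := abs_lt.1 (him' 0 1)
    simp only [Complex.sub_im, Complex.add_im, hTim]; linarith)
  have hTl := log_sub_log_neg (z := T) (by rw [hTim]; linarith)
  have r1 := hqtr (p 0) e0 (p 1 - T) (hWT' _ e1)
  have r2 := hqtr (p 1) e1 (p 0 - T) (hWT' _ e0)
  rw [sub_add_cancel] at r1 r2
  have r3 := hqsym (p 0 + T) (hWT _ e0) (p 1) e1
  have r4 := hqsym (p 1 + T) (hWT _ e1) (p 0) e0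
  have d0 := hD (p 0) e0
  have d1 := hD (p 1) e1
  have d0' := hDsymm (p 0) e0
  have d1' := hDsymm (p 1) e1
  have n1 : p 1 - (p 0 + T) = p 1 - p 0 - T := by ring
  have n2 : p 0 - (p 0 + T) = -T := by ring
  have n3 : p 1 - (p 1 + T) = -T := by ring
  have n4 : p 0 - (p 1 + T) = -(p 1 - p 0 + T) := by ring
  have n5 : p 1 - (p 0 - T) = p 1 - p 0 + T := by ring
  have n6 : p 0 - (p 0 - T) = T := by ring
  have n7 : p 1 - (p 1 - T) = T := by ring
  have n8 : p 0 - (p 1 - T) = -(p 1 - p 0 - T) := by ring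
  rw [n1, n2] at I0
  rw [n3, n4] at I1
  rw [n5, n6] at J0
  rw [n7, n8] at J1
  have m1 : κ 0 - T - κ 1 = -(κ 1 - κ 0 + T) := by ring
  have m2 : κ 0 - T - κ 0 = -T := by ring
  have m3 : κ 1 - T - κ 1 = -T := by ring
  have m4 : κ 1 - T - κ 0 = -(κ 0 - κ 1 + T) := by ring
  have m5 : κ 0 + T - κ 1 = κ 0 - κ 1 + T := by ring
  have m6 : κ 0 + T - κ 0 = T := by ring
  have m7 : κ 1 + T - κ 1 = T := by ring
  have m8 : κ 1 + T - κ 0 = κ 1 - κ 0 + T := by ring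
  rw [m1, m2] at K0
  rw [m3, m4] at K1
  rw [m5, m6] at M0
  rw [m7, m8] at M1
  have hfin : T = 0 := by
    linear_combination I0 - I1 + K1 - K0 - J0 + J1 - M1 + M0 + r1 - r3 + r2 - r4 - d0 - d1
      + d0' + d1' + hv - hv' + 2 * hTT - 2 * hTl + hz + hz' + hT
  exact hT0 hfin

theorem exists_differentiableOn_log {U : Set ℂ} (hUo : IsOpen U) (hUc : IsSimplyConnected U)
    {g : ℂ → ℂ} (hg : DifferentiableOn ℂ g U) (hg0 : ∀ x ∈ U, g x ≠ 0) :
    ∃ L : ℂ → ℂ, DifferentiableOn ℂ L U ∧ ∀ x ∈ U, Complex.exp (L x) = g x := by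
  obtain ⟨L, hL, h⟩ := Complex.exists_continuousOn_eqOn_exp_comp hUc hUo hg.continuousOn
    (by rintro ⟨x, hx, h⟩; exact hg0 x hx h)
  refine ⟨L, fun x hx => ?_, h⟩
  refine (differentiableAt_of_exp_eq (hL.continuousAt (hUo.mem_nhds hx))
    (hg.differentiableAt (hUo.mem_nhds hx)) ?_).differentiableWithinAt
  filter_upwards [hUo.mem_nhds hx] with y hy using h hy

theorem deriv_ne_zero_of_leftInverse {F G : ℂ → ℂ} {z : ℂ} (hF : DifferentiableAt ℂ F z)
    (hG : DifferentiableAt ℂ G (F z)) {E : ℂ → ℂ} (hE : deriv E z ≠ 0)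
    (h : ∀ᶠ x in 𝓝 z, G (F x) = E x) : deriv F z ≠ 0 := by
  intro h0
  have h1 : deriv (G ∘ F) z = deriv G (F z) * deriv F z := deriv_comp z hG hF
  rw [h0, mul_zero] at h1
  exact hE ((Filter.EventuallyEq.deriv_eq h).symm.trans h1)

/-- A Riemann map of `U` together with a logarithm on `U`, normalized so that
`L (φ ζ) = L (φ 0) + ζ * exp (lam ζ)`. -/
structure LogData (U : Set ℂ) where
  (h φ L lam : ℂ → ℂ)
  isOpen : IsOpen U
  differentiableOn_h : DifferentiableOn ℂ h U
  differentiableOn_φ : DifferentiableOn ℂ φ (Metric.ball 0 1)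
  mapsTo_h : MapsTo h U (Metric.ball 0 1)
  mapsTo_φ : MapsTo φ (Metric.ball 0 1) U
  φ_h : ∀ x ∈ U, φ (h x) = x
  h_φ : ∀ ζ ∈ Metric.ball (0 : ℂ) 1, h (φ ζ) = ζ
  differentiableOn_L : DifferentiableOn ℂ L U
  exp_L : ∀ x ∈ U, Complex.exp (L x) = x
  differentiableOn_lam : DifferentiableOn ℂ lam (Metric.ball 0 1)
  L_φ : ∀ ζ ∈ Metric.ball (0 : ℂ) 1, L (φ ζ) = L (φ 0) + ζ * Complex.exp (lam ζ)

theorem LogData.exists {U : Set ℂ} (hUo : IsOpen U) (hUc : IsSimplyConnected U)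
    (h0 : (0 : ℂ) ∉ U) : Nonempty (LogData U) := by
  obtain ⟨h, φ, hh, hφ, mh, mφ, φh, hφ'⟩ := exists_riemann_map hUo hUc
    (fun h => h0 (h ▸ mem_univ _))
  obtain ⟨L, hL, eL⟩ := exists_differentiableOn_log hUo hUc differentiableOn_id
    (fun x hx (h : x = 0) => h0 (h ▸ hx))
  have hball : IsSimplyConnected (Metric.ball (0 : ℂ) 1) := by
    have := (convex_ball (0 : ℂ) 1).contractibleSpace ⟨0, by simp⟩
    exact SimplyConnectedSpace.ofContractible _
  have h0b : (0 : ℂ) ∈ Metric.ball (0 : ℂ) 1 := by simp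
  set J : ℂ → ℂ := fun ζ => L (φ ζ) with hJ
  have hJd : DifferentiableOn ℂ J (Metric.ball 0 1) := hL.comp hφ mφ
  have hJinv : ∀ ζ ∈ Metric.ball (0 : ℂ) 1, h (Complex.exp (J ζ)) = ζ := fun ζ hζ => by
    rw [hJ]; simp only; rw [eL _ (mφ hζ)]; exact hφ' ζ hζ
  have hd : DifferentiableOn ℂ (dslope J 0) (Metric.ball 0 1) :=
    (Complex.differentiableOn_dslope (Metric.isOpen_ball.mem_nhds h0b)).2 hJd
  have hne : ∀ ζ ∈ Metric.ball (0 : ℂ) 1, dslope J 0 ζ ≠ 0 := by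
    intro ζ hζ
    by_cases hz : ζ = 0
    · subst hz
      rw [dslope_same]
      refine deriv_ne_zero_of_leftInverse (G := fun y => h (Complex.exp y)) (E := fun x => x)
        (hJd.differentiableAt (Metric.isOpen_ball.mem_nhds h0b)) ?_ (by simp) ?_
      · have : DifferentiableAt ℂ h (Complex.exp (J 0)) := by
          rw [show Complex.exp (J 0) = φ 0 from eL _ (mφ h0b)]
          exact hh.differentiableAt (hUo.mem_nhds (mφ h0b))
        exact this.comp (J 0) Complex.differentiableAt_exp
      · filter_upwards [Metric.isOpen_ball.mem_nhds h0b] with x hx using hJinv x hx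
    · rw [dslope_of_ne _ hz, slope_def_field]
      refine div_ne_zero (fun h => hz ?_) (sub_ne_zero.2 hz)
      rw [← hJinv ζ hζ, sub_eq_zero.1 h, hJinv 0 h0b]
  obtain ⟨lam, hlam, elam⟩ := exists_differentiableOn_log Metric.isOpen_ball hball hd hne
  refine ⟨⟨h, φ, L, lam, hUo, hh, hφ, mh, mφ, φh, hφ', hL, eL, hlam, fun ζ hζ => ?_⟩⟩
  rw [elam ζ hζ]
  have := sub_smul_dslope J 0 ζ
  simp only [sub_zero, smul_eq_mul] at this
  rw [this, hJ]; ring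

namespace LogData

variable {U : Set ℂ} (d : LogData U)

/-- The logarithm of the base point. -/
def k : ℂ := d.L (d.φ 0)

/-- The logarithmic form of the Riemann map, on the left half plane. -/
def Φ (w : ℂ) : ℂ := w + d.lam (Complex.exp w)

theorem zero_mem : (0 : ℂ) ∈ Metric.ball (0 : ℂ) 1 := by simp

theorem base_mem : d.φ 0 ∈ U := d.mapsTo_φ zero_mem

theorem h_base : d.h (d.φ 0) = 0 := d.h_φ 0 zero_mem

theorem norm_h_lt {x : ℂ} (hx : x ∈ U) : ‖d.h x‖ < 1 := by simpa using d.mapsTo_h hx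

theorem continuousOn_h : ContinuousOn d.h U := d.differentiableOn_h.continuousOn

theorem continuousOn_φ : ContinuousOn d.φ (Metric.ball 0 1) := d.differentiableOn_φ.continuousOn

theorem continuousOn_L : ContinuousOn d.L U := d.differentiableOn_L.continuousOn

theorem exp_k : Complex.exp d.k = d.φ 0 := d.exp_L _ d.base_mem

theorem exp_mem_ball {w : ℂ} (hw : w.re < 0) : Complex.exp w ∈ Metric.ball (0 : ℂ) 1 := by
  simpa [Complex.norm_exp] using hw

theorem L_eq {x : ℂ} (hx : x ∈ U) : d.L x - d.k = d.h x * Complex.exp (d.lam (d.h x)) := by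
  have := d.L_φ _ (d.mapsTo_h hx)
  rw [d.φ_h x hx] at this
  rw [this, k]; ring

theorem exp_Φ {w : ℂ} (hw : w.re < 0) :
    Complex.exp (d.Φ w) = d.L (d.φ (Complex.exp w)) - d.k := by
  rw [Φ, Complex.exp_add, d.L_φ _ (exp_mem_ball hw), k]; ring

theorem Φ_add (w : ℂ) : d.Φ (w + 2 * Real.pi * Complex.I) = d.Φ w + 2 * Real.pi * Complex.I := by
  rw [Φ, Φ, Complex.exp_periodic w]; ring

theorem differentiableAt_Φ {w : ℂ} (hw : w.re < 0) : DifferentiableAt ℂ d.Φ w := by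
  refine differentiableAt_id.add ?_
  exact (d.differentiableOn_lam.differentiableAt
    (Metric.isOpen_ball.mem_nhds (exp_mem_ball hw))).comp w Complex.differentiableAt_exp

theorem h_exp_exp_Φ {w : ℂ} (hw : w.re < 0) :
    d.h (Complex.exp (Complex.exp (d.Φ w) + d.k)) = Complex.exp w := by
  rw [d.exp_Φ hw, sub_add_cancel, d.exp_L _ (d.mapsTo_φ (exp_mem_ball hw)),
    d.h_φ _ (exp_mem_ball hw)]

theorem Φ_injOn {w w' : ℂ} (hw : w.re < 0) (hw' : w'.re < 0) (h : d.Φ w = d.Φ w') : w = w' := by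
  have he : Complex.exp w = Complex.exp w' := by
    rw [← d.h_exp_exp_Φ hw, ← d.h_exp_exp_Φ hw', h]
  rw [Φ, Φ, he] at h
  exact add_right_cancel h

theorem deriv_Φ_ne_zero {w : ℂ} (hw : w.re < 0) : deriv d.Φ w ≠ 0 := by
  refine deriv_ne_zero_of_leftInverse
    (G := fun y => d.h (Complex.exp (Complex.exp y + d.k))) (E := Complex.exp)
    (d.differentiableAt_Φ hw) ?_ ?_ ?_
  · have hm := d.mapsTo_φ (exp_mem_ball hw)
    have : Complex.exp (Complex.exp (d.Φ w) + d.k) = d.φ (Complex.exp w) := by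
      rw [d.exp_Φ hw, sub_add_cancel, d.exp_L _ hm]
    have h1 : DifferentiableAt ℂ d.h (Complex.exp (Complex.exp (d.Φ w) + d.k)) := by
      rw [this]; exact d.differentiableOn_h.differentiableAt (d.isOpen.mem_nhds hm)
    exact h1.comp (d.Φ w) (f := fun y => Complex.exp (Complex.exp y + d.k)) (by fun_prop)
  · simp
  · filter_upwards [(isOpen_lt Complex.continuous_re continuous_const).mem_nhds hw] with x hx
      using d.h_exp_exp_Φ hx

theorem exists_q : ∃ q : ℂ × ℂ → ℂ, ContinuousOn q ({w | w.re < 0} ×ˢ {w | w.re < 0}) ∧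
    ∀ w w' : ℂ, w.re < 0 → w'.re < 0 →
      d.Φ w - d.Φ w' = Complex.exp (q (w, w')) * (w - w') := by
  classical
  set W : Set ℂ := {w | w.re < 0} with hW
  have hWo : IsOpen W := isOpen_lt Complex.continuous_re continuous_const
  have hWc : Convex ℝ W := convex_halfSpace_re_lt 0
  have hΦW : DifferentiableOn ℂ d.Φ W := fun w hw =>
    (d.differentiableAt_Φ hw).differentiableWithinAt
  set Q : ℂ × ℂ → ℂ := fun x => dslope d.Φ x.1 x.2 with hQ
  have hQc : ContinuousOn Q (W ×ˢ W) := by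
    rintro ⟨a, b⟩ ⟨ha, hb⟩
    refine ContinuousAt.continuousWithinAt ?_
    by_cases hab : a = b
    · subst hab
      have hda : HasStrictDerivAt d.Φ (deriv d.Φ a) a :=
        ((hΦW.contDiffOn hWo).contDiffAt (hWo.mem_nhds ha)).hasStrictDerivAt (n := 1) (by simp)
      have hdc : ContinuousAt (deriv d.Φ) a :=
        (hΦW.deriv hWo).continuousOn.continuousAt (hWo.mem_nhds ha)
      have h2 := hda.isLittleO
      rw [ContinuousAt, Metric.tendsto_nhds]
      intro ε hε
      have h3 := h2.bound (half_pos hε)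
      have h4 : ∀ᶠ x : ℂ × ℂ in 𝓝 (a, a), dist (deriv d.Φ x.1) (deriv d.Φ a) < ε :=
        (hdc.comp (f := Prod.fst) (x := (a, a)) continuous_fst.continuousAt).eventually
          (Metric.ball_mem_nhds _ hε)
      filter_upwards [h3, h4] with x hx hx4
      have hQa : Q (a, a) = deriv d.Φ a := dslope_same _ _
      rw [hQa]
      by_cases hxx : x.2 = x.1
      · have : Q x = deriv d.Φ x.1 := by rw [hQ]; simp only; rw [hxx, dslope_same]
        rw [this]; exact hx4
      · have hne : x.2 - x.1 ≠ 0 := sub_ne_zero.2 hxx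
        have : Q x = (d.Φ x.2 - d.Φ x.1) / (x.2 - x.1) := by
          rw [hQ]; simp only; rw [dslope_of_ne _ hxx, slope_def_field]
        rw [this, dist_eq_norm]
        have e : (d.Φ x.2 - d.Φ x.1) / (x.2 - x.1) - deriv d.Φ a =
            (d.Φ x.1 - d.Φ x.2 - (x.1 - x.2) * deriv d.Φ a) / (x.1 - x.2) := by
          have hne' : x.1 - x.2 ≠ 0 := sub_ne_zero.2 (Ne.symm hxx)
          field_simp
          ring
        have hne' : x.1 - x.2 ≠ 0 := sub_ne_zero.2 (Ne.symm hxx)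
        rw [e, norm_div, div_lt_iff₀ (norm_pos_iff.2 hne')]
        simp only [ContinuousLinearMap.toSpanSingleton_apply, smul_eq_mul] at hx
        have := norm_pos_iff.2 hne'
        nlinarith
    · have hev : Q =ᶠ[𝓝 (a, b)] fun x => (d.Φ x.2 - d.Φ x.1) / (x.2 - x.1) := by
        have : {x : ℂ × ℂ | x.1 ≠ x.2} ∈ 𝓝 (a, b) :=
          (isOpen_ne_fun continuous_fst continuous_snd).mem_nhds hab
        filter_upwards [this] with x hx
        rw [hQ]; simp only; rw [dslope_of_ne _ (Ne.symm hx), slope_def_field]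
      refine ContinuousAt.congr ?_ hev.symm
      refine ContinuousAt.div ?_ (by fun_prop) (sub_ne_zero.2 (Ne.symm hab))
      exact ((d.differentiableAt_Φ hb).continuousAt.comp (f := Prod.snd) (x := (a, b))
        continuous_snd.continuousAt).sub ((d.differentiableAt_Φ ha).continuousAt.comp
        (f := Prod.fst) (x := (a, b)) continuous_fst.continuousAt)
  obtain ⟨q, hq, hqe⟩ := exists_continuousOn_log_of_convex (hWc.prod hWc) (hWo.prod hWo)
    (⟨(-1, -1), by simp [hW]⟩) hQc (by
      rintro ⟨a, b⟩ ⟨ha, hb⟩ h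
      by_cases hab : b = a
      · subst hab
        rw [hQ] at h; simp only [dslope_same] at h
        exact d.deriv_Φ_ne_zero ha h
      · rw [hQ] at h; simp only at h
        rw [dslope_of_ne _ hab, slope_def_field] at h
        rcases div_eq_zero_iff.1 h with h | h
        · exact hab (d.Φ_injOn hb ha (sub_eq_zero.1 h))
        · exact hab (sub_eq_zero.1 h))
  refine ⟨q, hq, fun w w' hw hw' => ?_⟩
  rw [hqe (w, w') ⟨hw, hw'⟩, hQ]
  have := sub_smul_dslope d.Φ w w'
  simp only [smul_eq_mul] at this
  simp only
  linear_combination this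

/-- The points of `U` lying above the base point in the logarithmic coordinate. -/
def top : Set ℂ := {x ∈ U | 0 < (d.L x - d.k).re}

/-- The logarithmic coordinate of `h x` for `x ∈ d.top`. -/
def wOf (x : ℂ) : ℂ := Complex.log (d.L x - d.k) - d.lam (d.h x)

/-- The argument of `h x`, for `x ∈ d.top`. -/
def θ (x : ℂ) : ℝ := (d.wOf x).im

theorem exp_wOf {x : ℂ} (hx : x ∈ d.top) : Complex.exp (d.wOf x) = d.h x := by
  have h0 : d.L x - d.k ≠ 0 := fun h => by have := hx.2; simp [h] at this
  rw [wOf, Complex.exp_sub, Complex.exp_log h0, d.L_eq hx.1,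
    mul_div_cancel_right₀ _ (Complex.exp_ne_zero _)]

theorem Φ_wOf {x : ℂ} (hx : x ∈ d.top) : d.Φ (d.wOf x) = Complex.log (d.L x - d.k) := by
  rw [Φ, d.exp_wOf hx, wOf]; ring

theorem norm_h_eq {x : ℂ} (hx : x ∈ d.top) : ‖d.h x‖ = Real.exp (d.wOf x).re := by
  rw [← d.exp_wOf hx, Complex.norm_exp]

theorem wOf_re {x : ℂ} (hx : x ∈ d.top) : (d.wOf x).re < 0 := by
  have := d.norm_h_lt hx.1
  rw [d.norm_h_eq hx] at this
  simpa using this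

theorem isOpen_top : IsOpen d.top := by
  have : ContinuousOn (fun x => (d.L x - d.k).re) U :=
    Complex.continuous_re.comp_continuousOn (d.continuousOn_L.sub continuousOn_const)
  exact this.isOpen_inter_preimage d.isOpen (isOpen_Ioi (a := 0))

theorem continuousOn_wOf : ContinuousOn d.wOf d.top := by
  have hs : d.top ⊆ U := fun x hx => hx.1
  refine ContinuousOn.sub ?_ ?_
  · exact ((d.continuousOn_L.sub continuousOn_const).mono hs).clog
      fun x hx => Complex.mem_slitPlane_iff.2 (Or.inl hx.2)
  · exact d.differentiableOn_lam.continuousOn.comp (d.continuousOn_h.mono hs)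
      fun x hx => d.mapsTo_h hx.1

theorem log_im_lt {x : ℂ} (hx : x ∈ d.top) : |(Complex.log (d.L x - d.k)).im| < Real.pi / 2 := by
  rw [Complex.log_im]
  exact Complex.abs_arg_lt_pi_div_two_iff.2 (Or.inl hx.2)

theorem mem_image_L_iff {y : ℂ} : y ∈ d.L '' U ↔ Complex.exp y ∈ U ∧ d.L (Complex.exp y) = y := by
  constructor
  · rintro ⟨x, hx, rfl⟩
    rw [d.exp_L x hx]; exact ⟨hx, rfl⟩
  · rintro ⟨h1, h2⟩; exact ⟨_, h1, h2⟩

theorem isOpen_image_L : IsOpen (d.L '' U) := by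
  rw [isOpen_iff_mem_nhds]
  rintro y hy
  obtain ⟨h1, h2⟩ := d.mem_image_L_iff.1 hy
  have hc : ContinuousAt (fun y => d.L (Complex.exp y) - y) y := by
    refine ContinuousAt.sub ?_ continuousAt_id
    exact (d.continuousOn_L.continuousAt (d.isOpen.mem_nhds h1)).comp
      Complex.continuous_exp.continuousAt
  have hc' : Tendsto (fun y => d.L (Complex.exp y) - y) (𝓝 y) (𝓝 0) := by
    have := hc.tendsto
    simpa [h2] using this
  have hU := Complex.continuous_exp.continuousAt.preimage_mem_nhds (d.isOpen.mem_nhds h1)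
  filter_upwards [hU, hc'.eventually (Metric.ball_mem_nhds 0 Real.pi_pos)] with x hx hx2
  refine d.mem_image_L_iff.2 ⟨hx, ?_⟩
  obtain ⟨n, hn⟩ := Complex.exp_eq_exp_iff_exists_int.1 (d.exp_L _ hx)
  rw [hn] at hx2
  simp only [add_sub_cancel_left, dist_zero_right, norm_mul,
    Complex.norm_intCast, Complex.norm_real, Complex.norm_I, mul_one, Complex.norm_ofNat,
    Real.norm_eq_abs, abs_of_pos Real.pi_pos] at hx2
  have h3 : |(n : ℝ)| < 1 := by
    have := Real.pi_pos
    nlinarith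
  have : n = 0 := by
    have h4 : |n| < 1 := by exact_mod_cast h3
    exact Int.abs_lt_one_iff.1 h4
  rw [hn, this]; simp

/-- Points of a path leaving `L '' U` approach the boundary of the disc. -/
theorem tendsto_norm_h {α : Type*} {l : Filter α} {g : α → ℂ} {y : ℂ} (hg : Tendsto g l (𝓝 y))
    (hy : y ∉ d.L '' U) (hgU : ∀ᶠ t in l, g t ∈ d.L '' U) {r : ℝ} (hr : r < 1) :
    ∀ᶠ t in l, r < ‖d.h (Complex.exp (g t))‖ := by
  have hsub : Metric.closedBall (0 : ℂ) r ⊆ Metric.ball 0 1 := Metric.closedBall_subset_ball hr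
  have hK : IsCompact ((fun ζ => d.L (d.φ ζ)) '' Metric.closedBall (0 : ℂ) r) :=
    (isCompact_closedBall (0 : ℂ) r).image_of_continuousOn
      ((d.continuousOn_L.comp d.continuousOn_φ d.mapsTo_φ).mono hsub)
  have hyK : y ∉ (fun ζ => d.L (d.φ ζ)) '' Metric.closedBall (0 : ℂ) r := by
    rintro ⟨ζ, hζ, rfl⟩
    exact hy ⟨_, d.mapsTo_φ (hsub hζ), rfl⟩
  filter_upwards [hg.eventually (hK.isClosed.isOpen_compl.mem_nhds hyK), hgU] with t ht1 ht2
  by_contra! hle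
  obtain ⟨h1, h2⟩ := d.mem_image_L_iff.1 ht2
  exact ht1 ⟨_, by simpa using hle, by simp only; rw [d.φ_h _ h1, h2]⟩

end LogData

theorem JoinedIn.exists_curve {Y : Type*} [TopologicalSpace Y] {F : Set Y} {x y : Y}
    (h : JoinedIn F x y) :
    ∃ γ : ℝ → Y, Continuous γ ∧ γ 0 = x ∧ γ 1 = y ∧ ∀ t, γ t ∈ F := by
  refine ⟨h.somePath.extend, h.somePath.continuous_extend, by simp, by simp, fun t => ?_⟩
  exact h.somePath_mem _

theorem IsCompact.exists_first_mem {S : Set ℝ} (hS : IsClosed S) {a b : ℝ}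
    (h : (S ∩ Icc a b).Nonempty) : ∃ t ∈ Icc a b, t ∈ S ∧ ∀ s ∈ Ico a t, s ∉ S := by
  obtain ⟨t, ht⟩ := (isCompact_Icc.inter_left hS).exists_isLeast h
  exact ⟨t, ht.1.2, ht.1.1, fun s hs hsS =>
    absurd (ht.2 ⟨hsS, hs.1, hs.2.le.trans ht.1.2.2⟩) (not_le.2 hs.2)⟩

namespace LogData

variable {U : Set ℂ} (d : LogData U)

theorem mem_top_of_norm {x : ℂ} (hx : x ∈ U) (h : ‖d.φ 0‖ < ‖x‖) : x ∈ d.top := by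
  refine ⟨hx, ?_⟩
  rw [← d.exp_L x hx, ← d.exp_k, Complex.norm_exp, Complex.norm_exp, Real.exp_lt_exp] at h
  simpa using h

theorem joinedIn_preimage {B : Set ℂ} (hBo : IsOpen B) (hBc : IsPreconnected B) (hBU : B ⊆ U)
    (h0 : d.φ 0 ∈ B) {w w' : ℂ} (hw : w.re < 0) (hw' : w'.re < 0)
    (hwB : d.φ (Complex.exp w) ∈ B) (hwB' : d.φ (Complex.exp w') ∈ B) :
    JoinedIn {v : ℂ | v.re < 0 ∧ d.φ (Complex.exp v) ∈ B} w w' := by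
  have hO : {ζ ∈ Metric.ball (0 : ℂ) 1 | d.φ ζ ∈ B} ∈ 𝓝 (0 : ℂ) :=
    (d.continuousOn_φ.isOpen_inter_preimage Metric.isOpen_ball hBo).mem_nhds ⟨zero_mem, h0⟩
  obtain ⟨ρ, hρ, hρB⟩ := Metric.nhds_basis_closedBall.mem_iff.1 hO
  have hlow : ∀ v : ℂ, v.re ≤ Real.log ρ → v.re < 0 ∧ d.φ (Complex.exp v) ∈ B := by
    intro v hv
    have : Complex.exp v ∈ Metric.closedBall (0 : ℂ) ρ := by
      rw [mem_closedBall_zero_iff, Complex.norm_exp]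
      exact (Real.le_log_iff_exp_le hρ).1 hv
    have h1 := hρB this
    refine ⟨?_, h1.2⟩
    have h2 := h1.1
    rw [mem_ball_zero_iff, Complex.norm_exp] at h2
    simpa using h2
  have hmain : ∀ w : ℂ, w.re < 0 → d.φ (Complex.exp w) ∈ B → ∃ v : ℂ, v.re ≤ Real.log ρ ∧
      JoinedIn {v : ℂ | v.re < 0 ∧ d.φ (Complex.exp v) ∈ B} w v := by
    intro w hw hwB
    have hBp : IsPathConnected B := (hBo.isConnected_iff_isPathConnected).1 ⟨⟨_, h0⟩, hBc⟩
    obtain ⟨γ, hγ, hγ0, hγ1, hγB⟩ := (hBp.joinedIn _ hwB _ h0).exists_curve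
    have hg : Continuous fun t => d.h (γ t) :=
      d.continuousOn_h.comp_continuous hγ fun t => hBU (hγB t)
    obtain ⟨t1, ht1, htS, hmin⟩ := IsCompact.exists_first_mem (S := {t | ‖d.h (γ t)‖ ≤ ρ})
      (isClosed_le hg.norm continuous_const) (a := 0) (b := 1)
      ⟨1, by simp [hγ1, d.h_base, hρ.le], by simp⟩
    have hG0 : ∀ t ∈ Icc 0 t1, ρ ≤ ‖d.h (γ t)‖ ∨ t = 0 := by
      intro t ht
      by_contra! hcon
      have hpos : 0 < t := lt_of_le_of_ne ht.1 (Ne.symm hcon.2)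
      have hc : Tendsto (fun s => ‖d.h (γ s)‖) (𝓝[<] t) (𝓝 ‖d.h (γ t)‖) :=
        (hg.norm.tendsto t).mono_left nhdsWithin_le_nhds
      have h1 := (hc.eventually (gt_mem_nhds hcon.1)).and (Ioo_mem_nhdsLT hpos)
      obtain ⟨s, hs1, hs2⟩ := h1.exists
      exact hmin s ⟨hs2.1.le, hs2.2.trans_le ht.2⟩ hs1.le
    have hγw : d.h (γ 0) = Complex.exp w := by rw [hγ0, d.h_φ _ (exp_mem_ball hw)]
    have hGne : ∀ t ∈ Icc 0 t1, d.h (γ t) ≠ 0 := by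
      intro t ht h
      rcases hG0 t ht with h1 | rfl
      · rw [h, norm_zero] at h1; exact absurd h1 (not_le.2 hρ)
      · exact Complex.exp_ne_zero w (hγw.symm.trans h)
    set c : ℝ → ℝ := fun t => max 0 (min t t1) with hc
    have hcI : ∀ t, c t ∈ Icc 0 t1 := fun t =>
      ⟨le_max_left _ _, max_le ht1.1 (min_le_right _ _)⟩
    obtain ⟨l, hl, hle⟩ := exists_continuousOn_log_of_convex (E := ℝ) convex_univ isOpen_univ
      univ_nonempty (g := fun t => d.h (γ (c t)))
      (hg.comp (by fun_prop : Continuous c)).continuousOn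
      fun t _ => hGne _ (hcI t)
    have hc0 : c 0 = 0 := by simp [hc, ht1.1]
    have hc1 : c 1 = t1 := by simp [hc, ht1.1, ht1.2]
    obtain ⟨n, hn⟩ := Complex.exp_eq_exp_iff_exists_int.1
      ((hle 0 trivial).trans ((congrArg (fun t => d.h (γ t)) hc0).trans hγw))
    have hexp : ∀ t, Complex.exp (l t - n * (2 * Real.pi * Complex.I)) = d.h (γ (c t)) := by
      intro t
      rw [Complex.exp_sub, hle t trivial, Complex.exp_int_mul_two_pi_mul_I, div_one]
    refine ⟨l 1 - n * (2 * Real.pi * Complex.I), ?_, ?_⟩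
    · rw [Real.le_log_iff_exp_le hρ, ← Complex.norm_exp, hexp, hc1]
      exact htS
    · refine JoinedIn.ofLine (f := fun t => l t - n * (2 * Real.pi * Complex.I)) ?_ ?_ rfl ?_
      · exact ((continuousOn_univ.1 hl).sub continuous_const).continuousOn
      · simp [hn]
      · rintro _ ⟨t, -, rfl⟩
        have hU := hBU (hγB (c t))
        constructor
        · have := d.norm_h_lt hU
          rw [← hexp, Complex.norm_exp] at this
          simpa using this
        · simp only
          rw [hexp, d.φ_h _ hU]; exact hγB _
  obtain ⟨v, hv, hj⟩ := hmain w hw hwB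
  obtain ⟨v', hv', hj'⟩ := hmain w' hw' hwB'
  have hseg : JoinedIn {v : ℂ | v.re < 0 ∧ d.φ (Complex.exp v) ∈ B} v v' := by
    refine JoinedIn.mono (JoinedIn.of_segment_subset (s := {v : ℂ | v.re ≤ Real.log ρ}) ?_) hlow
    exact (convex_halfSpace_re_le _).segment_subset hv hv'
  exact (hj.trans hseg).trans hj'.symm

/-- Far from the origin, connected subsets of `U` see a bounded variation of `d.θ`. -/
def SmallVariation (R : ℝ) : Prop :=
  ‖d.φ 0‖ < R ∧ ∀ Y ⊆ U, IsPreconnected Y → (∀ z ∈ Y, R < ‖z‖) →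
    ∀ x ∈ Y, ∀ x' ∈ Y, |d.θ x - d.θ x'| < Real.pi

theorem exists_end {R : ℝ} (hR : d.SmallVariation R) {γ : ℝ → ℂ} (hγ : Continuous γ)
    (hγR : ∀ t, Real.log R < (γ t).re) {x : ℂ} (hx : x ∈ U) (hγ0 : γ 0 = d.L x)
    (hexit : ∃ t ∈ Icc (0 : ℝ) 1, γ t ∉ d.L '' U) {M : ℝ} (hM : M < 0) :
    ∃ t₀ ∈ Icc (0 : ℝ) 1, ∃ e : ℂ, M < e.re ∧ d.Φ e = Complex.log (γ t₀ - d.k) ∧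
      JoinedIn {w | w.re < 0 ∧ |(d.Φ w).im| < Real.pi / 2 ∧ |w.im - e.im| < Real.pi ∧
        |w.im - d.θ x| < Real.pi} e (d.wOf x) := by
  have hR0 : 0 < R := (norm_nonneg _).trans_lt hR.1
  obtain ⟨s₀, hs₀, hs₀U, hmin⟩ := IsCompact.exists_first_mem (S := {t | γ t ∉ d.L '' U})
    (d.isOpen_image_L.isClosed_compl.preimage hγ) (a := 0) (b := 1)
    (by obtain ⟨t, h1, h2⟩ := hexit; exact ⟨t, h2, h1⟩)
  have h0U : γ 0 ∈ d.L '' U := hγ0 ▸ ⟨x, hx, rfl⟩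
  have hpos : 0 < s₀ := lt_of_le_of_ne hs₀.1 fun h => hs₀U (h ▸ h0U)
  have hin : ∀ s ∈ Ico 0 s₀, γ s ∈ d.L '' U := fun s hs => not_not.1 (hmin s hs)
  have htop : ∀ s ∈ Ico 0 s₀, Complex.exp (γ s) ∈ d.top ∧ R < ‖Complex.exp (γ s)‖ ∧
      d.L (Complex.exp (γ s)) = γ s := by
    intro s hs
    obtain ⟨h1, h2⟩ := d.mem_image_L_iff.1 (hin s hs)
    have h3 : R < ‖Complex.exp (γ s)‖ := by
      rw [Complex.norm_exp]; exact (Real.log_lt_iff_lt_exp hR0).1 (hγR s)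
    exact ⟨d.mem_top_of_norm h1 (hR.1.trans h3), h3, h2⟩
  have hev := d.tendsto_norm_h ((hγ.tendsto s₀).mono_left (nhdsWithin_le_nhds (s := Iio s₀))) hs₀U
    (by filter_upwards [Ioo_mem_nhdsLT hpos] with t ht using hin t ⟨ht.1.le, ht.2⟩)
    (show Real.exp M < 1 by simpa using hM)
  obtain ⟨t₀, ht1, ht2⟩ := (hev.and (Ioo_mem_nhdsLT hpos)).exists
  have ht₀ : t₀ ∈ Ico 0 s₀ := ⟨ht2.1.le, ht2.2⟩
  have hsub : ∀ s ∈ Icc 0 t₀, s ∈ Ico 0 s₀ := fun s hs => ⟨hs.1, hs.2.trans_lt ht2.2⟩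
  have hcexp : Continuous fun s => Complex.exp (γ s) := Complex.continuous_exp.comp hγ
  have hvar : ∀ s ∈ Icc 0 t₀, ∀ s' ∈ Icc 0 t₀,
      |d.θ (Complex.exp (γ s)) - d.θ (Complex.exp (γ s'))| < Real.pi := by
    intro s hs s' hs'
    refine hR.2 ((fun s => Complex.exp (γ s)) '' Icc 0 t₀) ?_
      (isPreconnected_Icc.image _ hcexp.continuousOn) ?_ _ ⟨s, hs, rfl⟩ _ ⟨s', hs', rfl⟩
    · rintro _ ⟨s, hs, rfl⟩; exact (htop s (hsub s hs)).1.1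
    · rintro _ ⟨s, hs, rfl⟩; exact (htop s (hsub s hs)).2.1
  have hx0 : Complex.exp (γ 0) = x := by rw [hγ0, d.exp_L x hx]
  refine ⟨t₀, ⟨ht2.1.le, ht2.2.le.trans hs₀.2⟩, d.wOf (Complex.exp (γ t₀)), ?_, ?_, ?_⟩
  · rw [d.norm_h_eq (htop t₀ ht₀).1] at ht1
    exact Real.exp_lt_exp.1 ht1
  · rw [d.Φ_wOf (htop t₀ ht₀).1, (htop t₀ ht₀).2.2]
  · refine JoinedIn.symm ?_
    refine JoinedIn.ofLine (f := fun u => d.wOf (Complex.exp (γ (u * t₀)))) ?_ ?_ ?_ ?_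
    · refine d.continuousOn_wOf.comp (hcexp.comp (continuous_id.mul continuous_const)).continuousOn
        fun u hu => ?_
      exact (htop _ (hsub _ ⟨mul_nonneg hu.1 ht2.1.le, mul_le_of_le_one_left ht2.1.le hu.2⟩)).1
    · simp [hx0]
    · simp
    · rintro _ ⟨u, hu, rfl⟩
      have hu' : u * t₀ ∈ Icc 0 t₀ :=
        ⟨mul_nonneg hu.1 ht2.1.le, mul_le_of_le_one_left ht2.1.le hu.2⟩
      have hT := (htop _ (hsub _ hu')).1
      refine ⟨d.wOf_re hT, ?_, hvar _ hu' _ ⟨ht2.1.le, le_rfl⟩, ?_⟩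
      · simp only; rw [d.Φ_wOf hT]; exact d.log_im_lt hT
      · have := hvar _ hu' 0 ⟨le_rfl, ht2.1.le⟩
        rwa [hx0] at this

theorem exists_near {x : ℂ} (hx : x ∈ d.top) {B : Set ℂ} (hxB : x ∈ closure B) :
    ∃ w : ℂ, w.re < 0 ∧ d.φ (Complex.exp w) ∈ B ∧
      JoinedIn {w | w.re < 0 ∧ |(d.Φ w).im| < Real.pi / 2 ∧ |w.im - d.θ x| < 1} (d.wOf x) w := by
  have hO : {w | w.re < 0 ∧ |(d.Φ w).im| < Real.pi / 2 ∧ |w.im - d.θ x| < 1} ∈ 𝓝 (d.wOf x) := by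
    have h1 : ∀ᶠ w : ℂ in 𝓝 (d.wOf x), w.re < 0 :=
      (isOpen_lt Complex.continuous_re continuous_const).mem_nhds (d.wOf_re hx)
    have h2 : ∀ᶠ w : ℂ in 𝓝 (d.wOf x), |(d.Φ w).im| < Real.pi / 2 := by
      have hc : ContinuousAt (fun w => |(d.Φ w).im|) (d.wOf x) :=
        (Complex.continuous_im.continuousAt.comp
          (d.differentiableAt_Φ (d.wOf_re hx)).continuousAt).abs
      refine hc.eventually_lt_const ?_
      simp only
      rw [d.Φ_wOf hx]; exact d.log_im_lt hx
    have h3 : ∀ᶠ w : ℂ in 𝓝 (d.wOf x), |w.im - d.θ x| < 1 := by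
      have hc : Continuous fun w : ℂ => |w.im - d.θ x| := by fun_prop
      exact (isOpen_lt hc continuous_const).mem_nhds (by simp [θ])
    filter_upwards [h1, h2, h3] with w a b c using ⟨a, b, c⟩
  obtain ⟨δ, hδ, hδO⟩ := Metric.mem_nhds_iff.1 hO
  have hn := (d.continuousOn_wOf.continuousAt (d.isOpen_top.mem_nhds hx)).preimage_mem_nhds
    (Metric.ball_mem_nhds _ hδ)
  obtain ⟨z, ⟨hz1, hz2⟩, hzB⟩ := mem_closure_iff_nhds.1 hxB _
    (Filter.inter_mem hn (d.isOpen_top.mem_nhds hx))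
  refine ⟨d.wOf z, d.wOf_re hz2, ?_, ?_⟩
  · rw [d.exp_wOf hz2, d.φ_h _ hz2.1]; exact hzB
  · refine (JoinedIn.of_segment_subset ?_).mono hδO
    exact (convex_ball _ _).segment_subset (Metric.mem_ball_self hδ) hz1

theorem window_aux {R : ℝ} (hR : d.SmallVariation R) {c : Set ℂ} (hc : IsPathConnected c)
    (hcc : IsClosed c) (hcR : ∀ y ∈ c, Real.log R < y.re) {x x' : ℂ} (hx : x ∈ U) (hx' : x' ∈ U)
    (hxc : d.L x ∈ c) (hxc' : d.L x' ∈ c)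
    (hxB : x ∈ closure (connectedComponentIn {x ∈ U | d.L x ∉ c} (d.φ 0)))
    (hxB' : x' ∈ closure (connectedComponentIn {x ∈ U | d.L x ∉ c} (d.φ 0))) :
    d.θ x' - d.θ x < 5 * Real.pi := by
  have hpi := Real.pi_gt_three
  by_contra! hcon
  have hR0 : 0 < R := (norm_nonneg _).trans_lt hR.1
  have hnorm : ∀ x ∈ U, d.L x ∈ c → R < ‖x‖ := by
    intro x hx hxc
    rw [← d.exp_L x hx, Complex.norm_exp]
    exact (Real.log_lt_iff_lt_exp hR0).1 (hcR _ hxc)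
  have hxt := d.mem_top_of_norm hx (hR.1.trans (hnorm x hx hxc))
  have hxt' := d.mem_top_of_norm hx' (hR.1.trans (hnorm x' hx' hxc'))
  set B := connectedComponentIn {x ∈ U | d.L x ∉ c} (d.φ 0) with hB
  have hBsub : B ⊆ {x ∈ U | d.L x ∉ c} := connectedComponentIn_subset _ _
  have hBU : B ⊆ U := fun z hz => (hBsub hz).1
  have hBo : IsOpen B := (d.continuousOn_L.isOpen_inter_preimage d.isOpen
    hcc.isOpen_compl).connectedComponentIn
  have h0B : d.φ 0 ∈ B := mem_connectedComponentIn ⟨d.base_mem, fun h =>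
    (hnorm _ d.base_mem h).not_gt hR.1⟩
  obtain ⟨γ, hγ, hγ0, hγ1, hγc⟩ := (hc.joinedIn _ hxc _ hxc').exists_curve
  have hγR : ∀ t, Real.log R < (γ t).re := fun t => hcR _ (hγc t)
  by_cases hin : ∀ t ∈ Icc (0 : ℝ) 1, γ t ∈ d.L '' U
  · have hcexp : Continuous fun s => Complex.exp (γ s) := Complex.continuous_exp.comp hγ
    have := hR.2 ((fun s => Complex.exp (γ s)) '' Icc 0 1) ?_
      (isPreconnected_Icc.image _ hcexp.continuousOn) ?_ x ⟨0, by simp, by simp [hγ0, d.exp_L x hx]⟩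
      x' ⟨1, by simp, by simp [hγ1, d.exp_L x' hx']⟩
    · have := abs_lt.1 this
      linarith
    · rintro _ ⟨s, hs, rfl⟩; exact (d.mem_image_L_iff.1 (hin s hs)).1
    · rintro _ ⟨s, hs, rfl⟩
      simp only; rw [Complex.norm_exp]; exact (Real.log_lt_iff_lt_exp hR0).1 (hγR s)
  push Not at hin
  obtain ⟨b, hbre, hbB, hbj⟩ := d.exists_near hxt hxB
  obtain ⟨b', hbre', hbB', hbj'⟩ := d.exists_near hxt' hxB'
  have hβ := d.joinedIn_preimage hBo isPreconnected_connectedComponentIn hBU h0B hbre hbre' hbB hbB'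
  obtain ⟨u₀, -, hu₀⟩ := isCompact_univ.exists_isMaxOn univ_nonempty
    (Complex.continuous_re.comp hβ.somePath.continuous).continuousOn
  set M := (hβ.somePath u₀).re with hM
  have hMlt : M < 0 := (hβ.somePath_mem u₀).1
  obtain ⟨t, ht, e, heM, heΦ, hej⟩ := d.exists_end hR hγ hγR hx hγ0 hin hMlt
  obtain ⟨t', ht', e', heM', heΦ', hej'⟩ := d.exists_end hR (γ := fun s => γ (1 - s))
    (hγ.comp (by fun_prop)) (fun s => hγR _) hx' (by simpa using hγ1)
    (by obtain ⟨s, hs, h⟩ := hin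
        exact ⟨1 - s, ⟨by linarith [hs.2], by linarith [hs.1]⟩, by simpa using h⟩) hMlt
  obtain ⟨heW, -, -, heθ⟩ := hej.source_mem
  obtain ⟨heW', -, -, heθ'⟩ := hej'.source_mem
  rw [abs_lt] at heθ heθ'
  have hkre : ∀ y ∈ c, 0 < (y - d.k).re := by
    intro y hy
    have h1 := hR.1
    rw [← d.exp_k, Complex.norm_exp, ← Real.lt_log_iff_exp_lt hR0] at h1
    have := hcR y hy
    simp only [Complex.sub_re]; linarith
  set κ : ℝ → ℂ := fun u => Complex.log (γ (t + u * (1 - t' - t)) - d.k) with hκ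
  have hκc : Continuous κ := by
    have h1 : Continuous fun u : ℝ => γ (t + u * (1 - t' - t)) - d.k :=
      (hγ.comp (by fun_prop)).sub continuous_const
    exact h1.clog fun u => Complex.mem_slitPlane_iff.2 (Or.inl (hkre _ (hγc _)))
  have hκim : ∀ u, |(κ u).im| < Real.pi / 2 := fun u => by
    rw [hκ]; simp only; rw [Complex.log_im]
    exact Complex.abs_arg_lt_pi_div_two_iff.2 (Or.inl (hkre _ (hγc _)))
  have hκexp : ∀ u, ∃ y ∈ c, Complex.exp (κ u) = y - d.k := fun u =>
    ⟨_, hγc _, Complex.exp_log fun h => by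
      have := hkre _ (hγc (t + u * (1 - t' - t))); simp [h] at this⟩
  obtain ⟨T, hT⟩ : ∃ T : ℂ, T = 2 * Real.pi * Complex.I := ⟨_, rfl⟩
  have hTre : T.re = 0 := by simp [hT]
  have hTim : T.im = 2 * Real.pi := by simp [hT]
  have hTexp : Complex.exp T = 1 := by rw [hT]; exact Complex.exp_two_pi_mul_I
  set S : Set ℂ := {w | w.re < 0 ∧ (∀ u, Φ d w ≠ κ u + T) ∧ (∀ u, d.Φ w ≠ κ u - T) ∧
    -(w - e - T) ∈ Complex.slitPlane ∧ -(w - e + T) ∈ Complex.slitPlane ∧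
    -(w - e' - T) ∈ Complex.slitPlane ∧ -(w - e' + T) ∈ Complex.slitPlane} with hS
  have hSβ : ∀ w : ℂ, w.re < 0 → d.φ (Complex.exp w) ∈ B → w.re ≤ M → w ∈ S := by
    intro w hw hwB hwM
    have hne : ∀ u, Complex.exp (d.Φ w) ≠ Complex.exp (κ u) := by
      intro u h
      obtain ⟨y, hy, he⟩ := hκexp u
      rw [d.exp_Φ hw, he] at h
      exact (hBsub hwB).2 (sub_left_injective h ▸ hy)
    refine ⟨hw, fun u h => hne u ?_, fun u h => hne u ?_, ?_, ?_, ?_, ?_⟩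
    · rw [h, Complex.exp_add, hTexp, mul_one]
    · rw [h, Complex.exp_sub, hTexp, div_one]
    all_goals
      refine Complex.mem_slitPlane_iff.2 (Or.inl ?_)
      simp only [Complex.neg_re, Complex.sub_re, Complex.add_re, hTre]
      linarith
  have hSim : ∀ w : ℂ, w.re < 0 → |(d.Φ w).im| < Real.pi / 2 →
      (w.im - e.im ≠ 2 * Real.pi ∧ w.im - e.im ≠ -(2 * Real.pi)) →
      (w.im - e'.im ≠ 2 * Real.pi ∧ w.im - e'.im ≠ -(2 * Real.pi)) → w ∈ S := by
    intro w hw hwΦ h1 h2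
    rw [abs_lt] at hwΦ
    refine ⟨hw, fun u h => ?_, fun u h => ?_, ?_, ?_, ?_, ?_⟩
    · have := abs_lt.1 (hκim u)
      have h := congrArg Complex.im h
      rw [Complex.add_im, hTim] at h; linarith
    · have := abs_lt.1 (hκim u)
      have h := congrArg Complex.im h
      rw [Complex.sub_im, hTim] at h; linarith
    all_goals
      refine Complex.mem_slitPlane_iff.2 (Or.inr fun h => ?_)
      simp only [Complex.neg_im, Complex.sub_im, Complex.add_im, hTim] at h
    · exact h1.1 (by linarith)
    · exact h1.2 (by linarith)
    · exact h2.1 (by linarith)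
    · exact h2.2 (by linarith)
  have j1 : JoinedIn S e (d.wOf x) := hej.mono fun w ⟨a1, a2, a3, a4⟩ => by
    rw [abs_lt] at a3 a4
    refine hSim w a1 a2 ⟨?_, ?_⟩ ⟨?_, ?_⟩ <;> intro h <;> linarith
  have j2 : JoinedIn S (d.wOf x) b := hbj.mono fun w ⟨a1, a2, a3⟩ => by
    rw [abs_lt] at a3
    refine hSim w a1 a2 ⟨?_, ?_⟩ ⟨?_, ?_⟩ <;> intro h <;> linarith
  have j3 : JoinedIn S b b' := ⟨hβ.somePath, fun u => hSβ _ (hβ.somePath_mem u).1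
    (hβ.somePath_mem u).2 (hu₀ (mem_univ u))⟩
  have j4 : JoinedIn S (d.wOf x') b' := hbj'.mono fun w ⟨a1, a2, a3⟩ => by
    rw [abs_lt] at a3
    refine hSim w a1 a2 ⟨?_, ?_⟩ ⟨?_, ?_⟩ <;> intro h <;> linarith
  have j5 : JoinedIn S e' (d.wOf x') := hej'.mono fun w ⟨a1, a2, a3, a4⟩ => by
    rw [abs_lt] at a3 a4
    refine hSim w a1 a2 ⟨?_, ?_⟩ ⟨?_, ?_⟩ <;> intro h <;> linarith
  obtain ⟨p, hp, hp0, hp1, hpS⟩ :=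
    (((j1.trans j2).trans j3).trans (j4.symm.trans j5.symm)).exists_curve
  obtain ⟨q, hq, hqe⟩ := d.exists_q
  refine window_core hT hq hqe (fun w hw => by rw [hT]; exact d.Φ_add w) hp hκc
    (fun s => (hpS s).1) hκim ?_ ?_ (fun s => (hpS s).2.1) (fun s => (hpS s).2.2.1) ?_
    (fun s => by rw [hp0]; exact (hpS s).2.2.2.1) (fun s => by rw [hp0]; exact (hpS s).2.2.2.2.1)
    (fun s => by rw [hp1]; exact (hpS s).2.2.2.2.2.1)
    (fun s => by rw [hp1]; exact (hpS s).2.2.2.2.2.2)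
  · rw [hp0, heΦ, hκ]; simp
  · rw [hp1, heΦ', hκ]; simp
  · rw [hp0, hp1, Complex.sub_im]; linarith

theorem window {R : ℝ} (hR : d.SmallVariation R) {c : Set ℂ} (hc : IsPathConnected c)
    (hcc : IsClosed c) (hcR : ∀ y ∈ c, Real.log R < y.re) {x x' : ℂ} (hx : x ∈ U) (hx' : x' ∈ U)
    (hxc : d.L x ∈ c) (hxc' : d.L x' ∈ c)
    (hxB : x ∈ closure (connectedComponentIn {x ∈ U | d.L x ∉ c} (d.φ 0)))
    (hxB' : x' ∈ closure (connectedComponentIn {x ∈ U | d.L x ∉ c} (d.φ 0))) :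
    |d.θ x' - d.θ x| < 5 * Real.pi := by
  rw [abs_lt]
  have h1 := d.window_aux hR hc hcc hcR hx hx' hxc hxc' hxB hxB'
  have h2 := d.window_aux hR hc hcc hcR hx' hx hxc' hxc hxB' hxB
  constructor <;> linarith

end LogData

theorem IsCompOf.isConnected {A D : Set X} (h : IsCompOf A D) : IsConnected D := by
  obtain ⟨x, hx, rfl⟩ := h
  exact isConnected_connectedComponentIn_iff.2 hx

theorem IsCompOf.subset {A D : Set X} (h : IsCompOf A D) : D ⊆ A := by
  obtain ⟨x, -, rfl⟩ := h
  exact connectedComponentIn_subset _ _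

theorem IsCompOf.subset_of_inter {A D Y : Set X} (h : IsCompOf A D) (hY : IsPreconnected Y)
    (hYA : Y ⊆ A) (hYD : (Y ∩ D).Nonempty) : Y ⊆ D := by
  obtain ⟨x, -, rfl⟩ := h
  obtain ⟨y, hy, hyD⟩ := hYD
  rw [connectedComponentIn_eq hyD]
  exact hY.subset_connectedComponentIn hy hYA

theorem IsCompOf.isOpen [LocallyConnectedSpace X] {A D : Set X} (h : IsCompOf A D)
    (hA : IsOpen A) : IsOpen D := by
  obtain ⟨x, -, rfl⟩ := h
  exact hA.connectedComponentIn

theorem IsCompOf.closure_inter_subset {A D : Set X} (h : IsCompOf A D) : closure D ∩ A ⊆ D := by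
  intro y hy
  have hne := h.isConnected.nonempty
  have hins : IsPreconnected (insert y D) :=
    h.isConnected.isPreconnected.subset_closure (subset_insert _ _)
      (insert_subset hy.1 subset_closure)
  exact h.subset_of_inter hins (insert_subset hy.2 h.subset)
    (hne.mono fun z hz => ⟨mem_insert_of_mem _ hz, hz⟩) (mem_insert _ _)

theorem IsCrossCut.exists_compact [T2Space X] {U γ : Set X} (hU : IsOpen U) (h : IsCrossCut U γ) :
    γ ⊆ U ∧ IsConnected γ ∧ ∃ K, IsCompact K ∧ K ∩ U = γ := by
  obtain ⟨g, hg, -, hgU, h0, h1, rfl, -⟩ := h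
  refine ⟨?_, ?_, g '' Icc 0 1, isCompact_Icc.image_of_continuousOn hg, ?_⟩
  · rintro _ ⟨t, ht, rfl⟩; exact hgU t ht
  · exact (isConnected_Ioo zero_lt_one).image _ (hg.mono Ioo_subset_Icc_self)
  · have hd : ∀ x ∈ frontier U, x ∉ U := fun x hx hxU => by
      rw [hU.frontier_eq] at hx; exact hx.2 hxU
    apply Subset.antisymm
    · rintro _ ⟨⟨t, ht, rfl⟩, hU⟩
      refine ⟨t, ⟨lt_of_le_of_ne ht.1 ?_, lt_of_le_of_ne ht.2 ?_⟩, rfl⟩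
      · rintro rfl; exact hd _ h0 hU
      · rintro rfl; exact hd _ h1 hU
    · rintro _ ⟨t, ht, rfl⟩
      exact ⟨⟨t, Ioo_subset_Icc_self ht, rfl⟩, hgU t ht⟩

theorem IsCrossCut.isOpen_sdiff [T2Space X] {U γ : Set X} (hU : IsOpen U) (h : IsCrossCut U γ) :
    IsOpen (U \ γ) := by
  obtain ⟨-, -, K, hK, rfl⟩ := h.exists_compact hU
  have : U \ (K ∩ U) = U \ K := by ext; simp
  rw [this]
  exact hU.sdiff hK.isClosed

theorem bdIn_subset {U γ D : Set X} (h : IsCompOf (U \ γ) D) : bdIn U D ⊆ γ := by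
  rintro x ⟨⟨hx, hxD⟩, hxU⟩
  by_contra hxγ
  exact hxD (h.closure_inter_subset ⟨hx, hxU, hxγ⟩)

theorem ChainDivides.trans {X : Type*} {D D' D'' : ℕ → Set X} (h : ChainDivides D D')
    (h' : ChainDivides D' D'') : ChainDivides D D'' := fun n => by
  obtain ⟨m, hm⟩ := h' n
  obtain ⟨l, hl⟩ := h m
  exact ⟨l, hl.trans hm⟩

theorem chainDivides_of_mk_eq {U : Set X} {C C' : PrimeChain U}
    (h : (Quot.mk _ C : PrimeEnd U) = Quot.mk _ C') : ChainDivides C.1 C'.1 := by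
  have hr : Equivalence fun C C' : PrimeChain U =>
      ChainDivides C.1 C'.1 ∧ ChainDivides C'.1 C.1 :=
    ⟨fun C => ⟨fun n => ⟨n, Subset.rfl⟩, fun n => ⟨n, Subset.rfl⟩⟩, fun h => ⟨h.2, h.1⟩,
      fun h h' => ⟨h.1.trans h'.1, h'.2.trans h.2⟩⟩
  exact (hr.eqvGen_iff.1 (Quot.eqvGen_exact h)).1

/-- A sequence of cross-sections shrinking to a boundary point: its cross-cuts eventually miss
one of any two disjoint compact sets. -/
structure IsNullChain (U : Set X) (D γ : ℕ → Set X) : Prop where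
  chain : IsPEChain U D
  comp : ∀ m, IsCompOf (U \ γ m) (D m)
  subset : ∀ m, γ m ⊆ U
  conn : ∀ m, IsPreconnected (γ m)
  small : ∀ A A' : Set X, IsCompact A → IsCompact A' → Disjoint A A' →
    ∀ᶠ m in atTop, Disjoint (γ m) A ∨ Disjoint (γ m) A'
  empty : ∀ x, ∀ᶠ m in atTop, x ∉ D m

theorem IsNullChain.chainDivides [LocallyConnectedSpace X] [T2Space X] {U : Set X} (hU : IsOpen U)
    {D γ : ℕ → Set X} (h : IsNullChain U D γ) {D' : ℕ → Set X} (hD' : IsPEChain U D')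
    (hne : ∀ i j, (D i ∩ D' j).Nonempty) : ChainDivides D D' := by
  intro n
  choose γ' hγ' hcomp using hD'.1
  have hcpt : ∀ n, IsCompact (closure (bdIn U (D' n))) := fun n => by
    obtain ⟨-, -, K, hK, hKU⟩ := (hγ' n).exists_compact hU
    exact hK.closure_of_subset ((bdIn_subset (hcomp n)).trans (hKU ▸ inter_subset_left))
  have hsm := h.small _ _ (hcpt n) (hcpt (n + 1))
    (disjoint_iff_inter_eq_empty.2 (hD'.2.2 n (n + 1) (by omega)))
  have hav : ∀ n', ∀ᶠ m in atTop, ¬ D' n' ⊆ D m ∧ ¬ γ' n' ⊆ D m := fun n' => by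
    obtain ⟨x, hx⟩ := (hcomp n').isConnected.nonempty
    obtain ⟨y, hy⟩ := ((hγ' n').exists_compact hU).2.1.nonempty
    filter_upwards [h.empty x, h.empty y] with m h1 h2
    exact ⟨fun h => h1 (h hx), fun h => h2 (h hy)⟩
  have key : ∀ n' m, (¬ D' n' ⊆ D m ∧ ¬ γ' n' ⊆ D m) →
      Disjoint (γ m) (closure (bdIn U (D' n'))) → D m ⊆ D' n' := by
    intro n' m ⟨h1, h2⟩ hdis
    have hopen : IsOpen (D' n') := (hcomp n').isOpen ((hγ' n').isOpen_sdiff hU)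
    have hγm : γ m ⊆ D' n' := by
      by_contra hcon
      have hsub : γ m ⊆ D' n' ∪ (closure (D' n'))ᶜ := by
        intro x hx
        by_cases hxD : x ∈ D' n'
        · exact Or.inl hxD
        · refine Or.inr fun hxc =>
            disjoint_left.1 hdis hx (subset_closure ⟨⟨hxc, hxD⟩, h.subset m hx⟩)
      have hd : Disjoint (γ m) (D' n') := by
        rw [disjoint_iff_inter_eq_empty]
        by_contra hne
        refine hcon ((h.conn m).subset_left_of_subset_union hopen isClosed_closure.isOpen_compl
          ?_ hsub (nonempty_iff_ne_empty.2 hne))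
        exact disjoint_compl_right_iff_subset.2 subset_closure
      refine h1 ((h.comp m).subset_of_inter (hcomp n').isConnected.isPreconnected ?_ ?_)
      · exact fun x hx => ⟨((hcomp n').subset hx).1, fun hxγ => disjoint_left.1 hd hxγ hx⟩
      · rw [inter_comm]; exact hne m n'
    obtain ⟨hγU, hγc, -⟩ := (hγ' n').exists_compact hU
    have hd' : Disjoint (D m) (γ' n') := by
      rw [disjoint_comm, disjoint_iff_inter_eq_empty]
      by_contra hne
      refine h2 ((h.comp m).subset_of_inter hγc.isPreconnected ?_ (nonempty_iff_ne_empty.2 hne))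
      exact fun x hx => ⟨hγU hx, fun hxγ => ((hcomp n').subset (hγm hxγ)).2 hx⟩
    refine (hcomp n').subset_of_inter (h.comp m).isConnected.isPreconnected ?_ (hne m n')
    exact fun x hx => ⟨((h.comp m).subset hx).1, disjoint_left.1 hd' hx⟩
  obtain ⟨m, hm1, hm2, hm3⟩ := (hsm.and ((hav n).and (hav (n + 1)))).exists
  rcases hm1 with hm1 | hm1
  · exact ⟨m, key n m hm2 hm1⟩
  · exact ⟨m, (key (n + 1) m hm3 hm1).trans (hD'.2.1 _ _ (by omega))⟩

theorem IsPEChain.nonempty {U : Set X} {D : ℕ → Set X} (h : IsPEChain U D) (i : ℕ) :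
    (D i).Nonempty := by
  obtain ⟨γ, -, hc⟩ := h.1 i
  exact hc.isConnected.nonempty

theorem IsNullChain.isPrimeChain [LocallyConnectedSpace X] [T2Space X] {U : Set X}
    (hU : IsOpen U) {D γ : ℕ → Set X} (h : IsNullChain U D γ) : IsPrimeChain U D := by
  refine ⟨h.chain, fun D' hD' hdiv => h.chainDivides hU hD' fun i j => ?_⟩
  obtain ⟨m, hm⟩ := hdiv i
  obtain ⟨x, hx⟩ := hD'.nonempty (max m j)
  exact ⟨x, hm (hD'.2.1 _ _ (le_max_left _ _) hx), hD'.2.1 _ _ (le_max_right _ _) hx⟩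

theorem exists_peOpen_subset {U : Set X} (C : PrimeChain U) {s : Set (PrimeEndComp U)}
    (hs : IsOpen s) (hp : peEnd U (Quot.mk _ C) ∈ s) :
    ∀ᶠ m in atTop, peOpen U (C.1 m) ⊆ s := by
  have mono : ∀ {E E' : Set X}, E ⊆ E' → peOpen U E ⊆ peOpen U E' :=
    fun h z ⟨x, hz, hx⟩ => ⟨x, hz, h hx⟩
  induction hs with
  | basic s hs =>
    rcases hs with ⟨V, -, -, rfl⟩ | ⟨E, -, rfl⟩
    · obtain ⟨x, hx, -⟩ := hp
      cases hx
    · rcases hp with ⟨x, hx, -⟩ | ⟨p, hp, C', hC', N, hN⟩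
      · cases hx
      · have hpC : p = Quot.mk _ C := (Sum.inr_injective hp).symm
        obtain ⟨m, hm⟩ := chainDivides_of_mk_eq (hpC ▸ hC' : Quot.mk _ C' = Quot.mk _ C).symm N
        filter_upwards [eventually_ge_atTop m] with k hk
        exact (mono ((C.2.1.2.1 _ _ hk).trans (hm.trans (hN N le_rfl)))).trans subset_union_left
  | univ => exact Eventually.of_forall fun m => subset_univ _
  | inter s t _ _ ih1 ih2 =>
    filter_upwards [ih1 hp.1, ih2 hp.2] with m h1 h2 using subset_inter h1 h2
  | sUnion S _ ih =>
    obtain ⟨s, hs, hps⟩ := hp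
    filter_upwards [ih s hs hps] with m hm using hm.trans (subset_sUnion_of_mem hs)

/-- If the extension to the prime ends compactification has no fixed prime end, null chains are
eventually displaced. -/
theorem IsNullChain.exists_displaced [LocallyConnectedSpace X] [T2Space X] {U : Set X}
    (hU : IsOpen U) {f : X ≃ₜ X} (hfU : ⇑f '' U = U) {F : PrimeEndComp U ≃ₜ PrimeEndComp U}
    (hF : IsPEExtension f U F) (hFp : ∀ p : PrimeEnd U, F (peEnd U p) ≠ peEnd U p)
    {D γ : ℕ → Set X} (h : IsNullChain U D γ) : ∃ m, Disjoint (f '' D m) (D m) := by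
  set C : PrimeChain U := ⟨D, h.isPrimeChain hU⟩ with hC
  have hmem : ∀ x ∈ U, f x ∈ U := fun x hx => hfU ▸ mem_image_of_mem f hx
  obtain ⟨p', hp'⟩ : ∃ p', F (peEnd U (Quot.mk _ C)) = peEnd U p' := by
    rcases hFx : F (peEnd U (Quot.mk _ C)) with ⟨y, hy⟩ | p'
    · exfalso
      have hy' := hy
      rw [← hfU] at hy'
      obtain ⟨x, hx, rfl⟩ := hy'
      have h2 := hF x hx hy
      have := F.injective (h2.trans hFx.symm)
      cases this
    · exact ⟨p', rfl⟩
  obtain ⟨C', rfl⟩ := Quot.exists_rep p'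
  by_cases hne : ∀ i j, (D i ∩ C'.1 j).Nonempty
  · have h1 := h.chainDivides hU C'.2.1 hne
    have h2 := C'.2.2 D h.chain h1
    refine absurd ?_ (hFp (Quot.mk _ C))
    rw [hp']
    exact congrArg (peEnd U) (Quot.sound ⟨h2, h1⟩)
  push Not at hne
  obtain ⟨i, j, hij⟩ := hne
  have hopen : IsOpen (F ⁻¹' peSection U (C'.1 j)) :=
    IsOpen.preimage F.continuous
      (TopologicalSpace.isOpen_generateFrom_of_mem (Or.inr ⟨_, C'.2.1.1 j, rfl⟩))
  have hin : peEnd U (Quot.mk _ C) ∈ F ⁻¹' peSection U (C'.1 j) := by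
    rw [mem_preimage, hp']
    exact Or.inr ⟨_, rfl, C', rfl, j, fun i hi => C'.2.1.2.1 _ _ hi⟩
  obtain ⟨m, hm, hmi⟩ := ((exists_peOpen_subset C hopen hin).and (eventually_ge_atTop i)).exists
  refine ⟨m, disjoint_left.2 ?_⟩
  rintro _ ⟨x, hx, rfl⟩ hfx
  have hxU : x ∈ U := ((h.comp m).subset hx).1
  have h1 : F (pePt U ⟨x, hxU⟩) ∈ peSection U (C'.1 j) := hm ⟨⟨x, hxU⟩, rfl, hx⟩
  rw [hF x hxU (hmem x hxU)] at h1
  rcases h1 with ⟨y, hy, hyj⟩ | ⟨p, hp, -⟩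
  · have : (⟨f x, hmem x hxU⟩ : U) = y := Sum.inl_injective hy
    rw [← this] at hyj
    have h3 : f x ∈ D i ∩ C'.1 j := ⟨h.chain.2.1 _ _ hmi hfx, hyj⟩
    rw [hij] at h3
    exact h3
  · cases hp

section LengthArea

open MeasureTheory ENNReal

/-- A weight on the plane, with finite total mass, giving infinite length to every path
tending to `0` or to `∞`. -/
def logWeight (r : ℝ) : ℝ := (r ^ 2 * (1 + Real.log r ^ 2))⁻¹

theorem measurable_logWeight : Measurable logWeight := by unfold logWeight; fun_prop

theorem lintegral_logWeight_lt_top (s : ℂ) :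
    ∫⁻ z : ℂ, ENNReal.ofReal (logWeight ‖z - s‖) < ∞ := by
  have hm := measurable_logWeight
  rw [lintegral_sub_right_eq_self (fun z : ℂ => ENNReal.ofReal (logWeight ‖z‖)) s,
    ← Complex.lintegral_comp_polarCoord_symm]
  have h1 : ∫⁻ p in polarCoord.target,
      ENNReal.ofReal p.1 • ENNReal.ofReal (logWeight ‖Complex.polarCoord.symm p‖) =
      ∫⁻ p in Ioi (0 : ℝ) ×ˢ Ioo (-Real.pi) Real.pi,
        ENNReal.ofReal (p.1 * logWeight p.1) := by
    rw [polarCoord_target]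
    refine setLIntegral_congr_fun (measurableSet_Ioi.prod measurableSet_Ioo) fun p hp => ?_
    have h0 : (0 : ℝ) < p.1 := hp.1
    have : ‖Complex.polarCoord.symm p‖ = p.1 := by
      rw [Complex.norm_polarCoord_symm, abs_of_pos h0]
    simp only [this, smul_eq_mul, ENNReal.ofReal_mul h0.le]
  rw [h1, Measure.volume_eq_prod, setLIntegral_prod _ (by fun_prop)]
  simp only [lintegral_const]
  rw [lintegral_mul_const _ (by fun_prop)]
  refine ENNReal.mul_lt_top ?_ (by simp)
  rw [← Real.range_exp, ← image_univ, lintegral_image_eq_lintegral_abs_deriv_mul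
    MeasurableSet.univ (fun x _ => (Real.hasDerivAt_exp x).hasDerivWithinAt)
    Real.exp_injective.injOn]
  have h2 : ∀ x : ℝ, ENNReal.ofReal |Real.exp x| *
      ENNReal.ofReal (Real.exp x * logWeight (Real.exp x)) = ENNReal.ofReal ((1 + x ^ 2)⁻¹) := by
    intro x
    rw [← ENNReal.ofReal_mul (abs_nonneg _), abs_of_pos (Real.exp_pos x), logWeight,
      Real.log_exp]
    congr 1
    have := Real.exp_ne_zero x
    field_simp
  simp only [h2]
  have := integrable_inv_one_add_sq.lintegral_lt_top
  simpa using this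

theorem lintegral_comp_deriv_le {V : Set ℂ} (hV : IsOpen V) {F : ℂ → ℂ}
    (hF : DifferentiableOn ℂ F V) (hinj : InjOn F V) (G : ℂ → ℝ≥0∞) :
    ∫⁻ z in V, ENNReal.ofReal (‖deriv F z‖ ^ 2) * G (F z) ≤ ∫⁻ z, G z := by
  have hd : ∀ z ∈ V, HasFDerivWithinAt F
      ((ContinuousLinearMap.toSpanSingleton ℂ (deriv F z)).restrictScalars ℝ) V z :=
    fun z hz => ((hF.differentiableAt (hV.mem_nhds hz)).hasDerivAt.hasFDerivAt.restrictScalars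
      ℝ).hasFDerivWithinAt
  have key := lintegral_image_eq_lintegral_abs_det_fderiv_mul volume hV.measurableSet hd hinj G
  refine le_trans (le_of_eq ?_) (key.symm.le.trans (setLIntegral_le_lintegral _ _))
  refine setLIntegral_congr_fun hV.measurableSet fun z _ => ?_
  congr 2
  have : ((ContinuousLinearMap.toSpanSingleton ℂ (deriv F z)).restrictScalars ℝ).det
      = ‖deriv F z‖ ^ 2 := by
    rw [← Complex.normSq_eq_norm_sq, ← Algebra.norm_complex_apply, Algebra.norm_apply,
      ContinuousLinearMap.det]
    congr 1
    ext; simp [mul_comm]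
  rw [this, abs_of_nonneg (by positivity)]

theorem exists_radius_lintegral_le {V : Set ℂ} (hV : IsOpen V) {F : ℂ → ℂ}
    (hF : DifferentiableOn ℂ F V) (hinj : InjOn F V) {G : ℂ → ℝ≥0∞} (hG : Measurable G)
    (hGt : ∫⁻ z, G z < ∞) {κ η : ℝ} (hκ : 0 < κ) (hη : 0 < η) :
    ∃ r ∈ Ioo 0 η, ∫⁻ t in Ioo (-Real.pi) Real.pi, ENNReal.ofReal (r ^ 2) *
      V.indicator (fun z => ENNReal.ofReal (‖deriv F z‖ ^ 2) * G (F z))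
        (Complex.polarCoord.symm (r, t)) ≤ ENNReal.ofReal κ := by
  classical
  set H : ℂ → ℝ≥0∞ := V.indicator (fun z => ENNReal.ofReal (‖deriv F z‖ ^ 2) * G (F z)) with hH
  have hHm : Measurable H := by
    have h1 : Measurable (V.piecewise F 0) :=
      hF.continuousOn.measurable_piecewise continuousOn_const hV.measurableSet
    have h2 : H = V.indicator
        (fun z => ENNReal.ofReal (‖deriv F z‖ ^ 2) * G (V.piecewise F 0 z)) := by
      rw [hH]
      refine indicator_congr fun z hz => by simp [hz]
    rw [h2]
    have := measurable_deriv F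
    exact Measurable.indicator (by fun_prop) hV.measurableSet
  have hps : Measurable fun p : ℝ × ℝ => Complex.polarCoord.symm p := by
    have : (fun p : ℝ × ℝ => Complex.polarCoord.symm p) =
        fun p => (p.1 : ℂ) * (Real.cos p.2 + Real.sin p.2 * Complex.I) :=
      funext fun p => Complex.polarCoord_symm_apply p
    rw [this]
    fun_prop
  have htot : ∫⁻ z, H z < ∞ := by
    rw [hH, lintegral_indicator hV.measurableSet]
    exact (lintegral_comp_deriv_le hV hF hinj G).trans_lt hGt
  by_contra! hcon
  rw [← Complex.lintegral_comp_polarCoord_symm, polarCoord_target, Measure.volume_eq_prod,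
    setLIntegral_prod _ (by fun_prop)] at htot
  have hlow : ∫⁻ r in Ioo (0 : ℝ) η, ENNReal.ofReal (κ * r⁻¹) < ∞ := by
    refine lt_of_le_of_lt ?_ htot
    refine le_trans ?_ (lintegral_mono_set (Ioo_subset_Ioi_self : Ioo (0 : ℝ) η ⊆ Ioi 0))
    refine setLIntegral_mono' measurableSet_Ioo fun r hr => ?_
    have h := (hcon r hr).le
    have hr0 : (0 : ℝ) < r := hr.1
    have h3 : ∫⁻ t in Ioo (-Real.pi) Real.pi, ENNReal.ofReal (r ^ 2) *
        H (Complex.polarCoord.symm (r, t)) = ENNReal.ofReal r *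
        ∫⁻ t in Ioo (-Real.pi) Real.pi, ENNReal.ofReal r •
          H (Complex.polarCoord.symm (r, t)) := by
      rw [← lintegral_const_mul _ (by fun_prop)]
      simp_rw [smul_eq_mul, ← mul_assoc, ← ENNReal.ofReal_mul hr0.le, ← sq]
    rw [h3] at h
    rw [mul_comm, ENNReal.ofReal_mul (by positivity), ENNReal.ofReal_inv_of_pos hr0, mul_comm,
      ← div_eq_mul_inv]
    exact ENNReal.div_le_of_le_mul' h
  have hint : IntegrableOn (fun r : ℝ => κ * r⁻¹) (Ioo 0 η) := by
    refine ⟨by fun_prop, ?_⟩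
    rw [hasFiniteIntegral_iff_ofReal]
    · exact hlow
    · filter_upwards [ae_restrict_mem measurableSet_Ioo] with r hr
      have : 0 < r := hr.1
      positivity
  have h4 : IntegrableOn (fun r : ℝ => r⁻¹) (Ioo 0 η) := by
    have := hint.const_mul κ⁻¹
    simpa [IntegrableOn, ← mul_assoc, hκ.ne'] using this
  have := (intervalIntegrable_iff_integrableOn_Ioo_of_le hη.le).2 h4
  rw [intervalIntegrable_inv_iff] at this
  rcases this with h | h
  · exact hη.ne h
  · exact h left_mem_uIcc

/-- A Cauchy–Schwarz estimate. -/
theorem sq_norm_sub_le_of_lintegral_deriv {E : Type*} [NormedAddCommGroup E] [NormedSpace ℝ E]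
    [CompleteSpace E] {u u' : ℝ → E} {a b κ : ℝ} (hκ : 0 < κ) (hab : a < b)
    (hu : ∀ t ∈ Icc a b, HasDerivAt u (u' t) t) (hu' : ContinuousOn u' (Icc a b))
    (hint : ∫⁻ t in Ioo a b, ENNReal.ofReal (‖u' t‖ ^ 2) ≤ ENNReal.ofReal κ) :
    ‖u b - u a‖ ^ 2 ≤ κ * (b - a) := by
  have hI : IntervalIntegrable u' volume a b := by
    apply ContinuousOn.intervalIntegrable
    rwa [uIcc_of_le hab.le]
  have hI2 : IntervalIntegrable (fun t => ‖u' t‖ ^ 2) volume a b := by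
    apply ContinuousOn.intervalIntegrable
    rw [uIcc_of_le hab.le]
    fun_prop
  have hsq : ∫ t in a..b, ‖u' t‖ ^ 2 ≤ κ := by
    rw [intervalIntegral.integral_of_le hab.le, integral_Ioc_eq_integral_Ioo,
      integral_eq_lintegral_of_nonneg_ae (ae_of_all _ fun t => by positivity)
        (((intervalIntegrable_iff_integrableOn_Ioo_of_le hab.le).1 hI2).aestronglyMeasurable)]
    exact ENNReal.toReal_le_of_le_ofReal hκ.le hint
  have hFTC : ∫ t in a..b, u' t = u b - u a :=
    intervalIntegral.integral_eq_sub_of_hasDerivAt (by rwa [uIcc_of_le hab.le]) hI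
  have hd : 0 < b - a := sub_pos.2 hab
  set ε := Real.sqrt (κ / (b - a)) with hε
  have hε0 : 0 < ε := Real.sqrt_pos.2 (by positivity)
  have hε2 : ε ^ 2 = κ / (b - a) := Real.sq_sqrt (by positivity)
  have h1 : ‖u b - u a‖ ≤ ∫ t in a..b, (ε / 2 + ‖u' t‖ ^ 2 / (2 * ε)) := by
    rw [← hFTC]
    refine (intervalIntegral.norm_integral_le_integral_norm hab.le).trans ?_
    refine intervalIntegral.integral_mono_on hab.le hI.norm
      (intervalIntegrable_const.add (hI2.div_const _)) fun t _ => ?_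
    have : 0 ≤ (‖u' t‖ - ε) ^ 2 / (2 * ε) := by positivity
    have h2 : (‖u' t‖ - ε) ^ 2 / (2 * ε) = ε / 2 + ‖u' t‖ ^ 2 / (2 * ε) - ‖u' t‖ := by
      field_simp; ring
    linarith
  rw [intervalIntegral.integral_add intervalIntegrable_const (hI2.div_const _),
    intervalIntegral.integral_const, intervalIntegral.integral_div, smul_eq_mul] at h1
  have h2 : ‖u b - u a‖ ≤ ε * (b - a) := by
    have h3 : (∫ t in a..b, ‖u' t‖ ^ 2) / (2 * ε) ≤ κ / (2 * ε) := by gcongr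
    have h4 : κ / (2 * ε) = ε * (b - a) / 2 := by
      have : κ = ε ^ 2 * (b - a) := by rw [hε2]; field_simp
      rw [this]; field_simp
    linarith
  calc ‖u b - u a‖ ^ 2 ≤ (ε * (b - a)) ^ 2 := by gcongr
    _ = κ * (b - a) := by rw [mul_pow, hε2]; field_simp

end LengthArea

section ShortArc

open MeasureTheory ENNReal

theorem abs_arsinh_log_deriv_le {v v' : ℂ} (hv : v ≠ 0) :
    ((Real.sqrt (1 + Real.log ‖v‖ ^ 2))⁻¹ * (inner ℝ v v' / ‖v‖ ^ 2)) ^ 2 ≤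
      ‖v'‖ ^ 2 * logWeight ‖v‖ := by
  have hv0 : 0 < ‖v‖ := norm_pos_iff.2 hv
  have h1 : (0 : ℝ) < 1 + Real.log ‖v‖ ^ 2 := by positivity
  rw [mul_pow, inv_pow, Real.sq_sqrt h1.le, logWeight, div_pow]
  have h2 : (inner ℝ v v') ^ 2 ≤ ‖v‖ ^ 2 * ‖v'‖ ^ 2 := by
    have := abs_real_inner_le_norm v v'
    rw [← mul_pow, ← sq_abs (inner ℝ v v')]
    gcongr
  calc (1 + Real.log ‖v‖ ^ 2)⁻¹ * (inner ℝ v v' ^ 2 / (‖v‖ ^ 2) ^ 2)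
      ≤ (1 + Real.log ‖v‖ ^ 2)⁻¹ * ((‖v‖ ^ 2 * ‖v'‖ ^ 2) / (‖v‖ ^ 2) ^ 2) := by gcongr
    _ = _ := by field_simp

theorem hasDerivAt_arsinh_log_norm {v : ℝ → ℂ} {v' : ℂ} {t : ℝ} (hv : HasDerivAt v v' t)
    (h0 : v t ≠ 0) : HasDerivAt (fun t => Real.arsinh (Real.log ‖v t‖))
      ((Real.sqrt (1 + Real.log ‖v t‖ ^ 2))⁻¹ * (inner ℝ (v t) v' / ‖v t‖ ^ 2)) t := by
  have hn : ‖v t‖ ^ 2 ≠ 0 := by simpa using h0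
  have h1 := ((hv.norm_sq).log hn).div_const 2
  have h2 : (fun t => Real.log (‖v t‖ ^ 2) / 2) = fun t => Real.log ‖v t‖ := by
    funext t; rw [Real.log_pow]; push_cast; ring
  rw [h2] at h1
  have h3 := (Real.hasDerivAt_arsinh (Real.log ‖v t‖)).comp t h1
  have e : inner ℝ (v t) v' / ‖v t‖ ^ 2 = 2 * inner ℝ (v t) v' / ‖v t‖ ^ 2 / 2 := by ring
  rw [e]
  exact h3

theorem exists_inv_logWeight_le (R : ℝ) : ∃ C, 0 < C ∧ ∀ r, 0 < r → r ≤ R →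
    1 ≤ C * logWeight r := by
  have hc : Continuous fun r : ℝ => r ^ 2 + (r * Real.log r) ^ 2 := by
    have := Real.continuous_mul_log
    fun_prop
  obtain ⟨C, hC⟩ := (isCompact_Icc (a := (0 : ℝ)) (b := R)).bddAbove_image hc.continuousOn
  refine ⟨max C 1, by positivity, fun r hr hrR => ?_⟩
  have h := hC (mem_image_of_mem _ ⟨hr.le, hrR⟩)
  have h1 : r ^ 2 * (1 + Real.log r ^ 2) ≤ max C 1 := by
    refine le_trans (le_of_eq (by ring)) (h.trans (le_max_left _ _))
  rw [logWeight, ← div_eq_mul_inv, one_le_div (by positivity)]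
  exact h1

variable {c c' : ℝ → ℂ} {a b κ : ℝ}

theorem arsinh_log_variation_le (hκ : 0 < κ) (hc : ∀ t ∈ Ioo a b, HasDerivAt c (c' t) t)
    (hc' : ContinuousOn c' (Ioo a b)) {s : ℂ} (hs : ∀ t ∈ Ioo a b, c t ≠ s)
    (hint : ∫⁻ t in Ioo a b, ENNReal.ofReal (‖c' t‖ ^ 2) *
      ENNReal.ofReal (logWeight ‖c t - s‖) ≤ ENNReal.ofReal κ)
    {t t' : ℝ} (ht : t ∈ Ioo a b) (ht' : t' ∈ Ioo a b) :
    (Real.arsinh (Real.log ‖c t - s‖) - Real.arsinh (Real.log ‖c t' - s‖)) ^ 2 ≤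
      κ * |t - t'| := by
  wlog h : t' < t generalizing t t'
  · rcases eq_or_lt_of_le (not_lt.1 h) with rfl | h
    · simp
    · rw [abs_sub_comm, ← neg_sq, neg_sub]; exact this ht' ht h
  have hsub : Icc t' t ⊆ Ioo a b := Icc_subset_Ioo ht'.1 ht.2
  have hcc : ContinuousOn c (Icc t' t) :=
    fun x hx => (hc x (hsub hx)).continuousAt.continuousWithinAt
  have hne : ∀ x ∈ Icc t' t, ‖c x - s‖ ≠ 0 := fun x hx => by
    simpa [sub_eq_zero] using hs x (hsub hx)
  have key := sq_norm_sub_le_of_lintegral_deriv hκ h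
    (u := fun t => Real.arsinh (Real.log ‖c t - s‖))
    (u' := fun t => (Real.sqrt (1 + Real.log ‖c t - s‖ ^ 2))⁻¹ *
      (inner ℝ (c t - s) (c' t) / ‖c t - s‖ ^ 2))
    (fun x hx => hasDerivAt_arsinh_log_norm ((hc x (hsub hx)).sub_const s)
      (sub_ne_zero.2 (hs x (hsub hx)))) ?_ ?_
  · rw [abs_of_pos (sub_pos.2 h)]
    simpa using key
  · have h1 : ContinuousOn (fun x => c x - s) (Icc t' t) := hcc.sub continuousOn_const
    have h2 : ContinuousOn c' (Icc t' t) := hc'.mono hsub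
    have h3 : ContinuousOn (fun x => Real.log ‖c x - s‖) (Icc t' t) := h1.norm.log hne
    refine ContinuousOn.mul (ContinuousOn.inv₀ (by fun_prop) fun x hx => ?_)
      (ContinuousOn.div (h1.inner h2) (by fun_prop) fun x hx => pow_ne_zero 2 (hne x hx))
    positivity
  · refine le_trans ?_ ((lintegral_mono_set (Ioo_subset_Icc_self.trans hsub)).trans hint)
    refine setLIntegral_mono' measurableSet_Ioo fun x hx => ?_
    rw [← ENNReal.ofReal_mul (by positivity), Real.norm_eq_abs, sq_abs]
    exact ENNReal.ofReal_le_ofReal (abs_arsinh_log_deriv_le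
      (sub_ne_zero.2 (hs x (hsub (Ioo_subset_Icc_self hx)))))

theorem sq_norm_sub_le_of_norm_le (hκ : 0 < κ) (hc : ∀ t ∈ Ioo a b, HasDerivAt c (c' t) t)
    (hc' : ContinuousOn c' (Ioo a b)) (hint : ∫⁻ t in Ioo a b, ENNReal.ofReal (‖c' t‖ ^ 2) *
      ENNReal.ofReal (logWeight ‖c t‖) ≤ ENNReal.ofReal κ)
    {C : ℝ} (hC : 0 < C) (hCw : ∀ t ∈ Ioo a b, 1 ≤ C * logWeight ‖c t‖)
    {t t' : ℝ} (ht : t ∈ Ioo a b) (ht' : t' ∈ Ioo a b) :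
    ‖c t - c t'‖ ^ 2 ≤ C * κ * |t - t'| := by
  wlog h : t' < t generalizing t t'
  · rcases eq_or_lt_of_le (not_lt.1 h) with rfl | h
    · simp
    · rw [abs_sub_comm, norm_sub_rev]; exact this ht' ht h
  have hsub : Icc t' t ⊆ Ioo a b := Icc_subset_Ioo ht'.1 ht.2
  rw [abs_of_pos (sub_pos.2 h)]
  refine sq_norm_sub_le_of_lintegral_deriv (by positivity) h (fun x hx => hc x (hsub hx))
    (hc'.mono hsub) ?_
  rw [ENNReal.ofReal_mul hC.le]
  refine le_trans ?_ (mul_le_mul_right ((lintegral_mono_set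
    (Ioo_subset_Icc_self.trans hsub)).trans hint) _)
  rw [← lintegral_const_mul' _ _ ENNReal.ofReal_ne_top]
  refine setLIntegral_mono' measurableSet_Ioo fun x hx => ?_
  rw [← ENNReal.ofReal_mul (by positivity), ← ENNReal.ofReal_mul hC.le]
  refine ENNReal.ofReal_le_ofReal ?_
  nlinarith [hCw x (hsub (Ioo_subset_Icc_self hx)), sq_nonneg ‖c' x‖]

theorem exists_continuousOn_Icc_of_holder {E : Type*} [NormedAddCommGroup E] [CompleteSpace E]
    {c : ℝ → E} {A : ℝ} (hab : a < b) (hA : 0 < A)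
    (h : ∀ t ∈ Ioo a b, ∀ t' ∈ Ioo a b, ‖c t - c t'‖ ^ 2 ≤ A * |t - t'|) :
    ∃ g : ℝ → E, ContinuousOn g (Icc a b) ∧ EqOn g c (Ioo a b) := by
  have hd : ∀ ε > 0, ∃ δ > 0, ∀ t ∈ Ioo a b, ∀ t' ∈ Ioo a b, |t - t'| < δ →
      dist (c t) (c t') < ε := by
    intro ε hε
    refine ⟨ε ^ 2 / A, by positivity, fun t ht t' ht' htt => ?_⟩
    rw [lt_div_iff₀ hA] at htt
    rw [dist_eq_norm]
    nlinarith [h t ht t' ht', norm_nonneg (c t - c t')]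
  have hu : UniformContinuousOn c (Ioo a b) := by
    rw [Metric.uniformContinuousOn_iff]
    intro ε hε
    obtain ⟨δ, hδ, H⟩ := hd ε hε
    exact ⟨δ, hδ, fun x hx y hy hxy => H x hx y hy hxy⟩
  have hlim : ∀ x, (𝓝[Ioo a b] x).NeBot → ∃ y, Tendsto c (𝓝[Ioo a b] x) (𝓝 y) := by
    intro x hx
    have hcau : Cauchy (map c (𝓝[Ioo a b] x)) := by
      rw [Metric.cauchy_iff]
      refine ⟨hx.map c, fun ε hε => ?_⟩
      obtain ⟨δ, hδ, H⟩ := hd ε hε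
      refine ⟨c '' (Ioo a b ∩ Metric.ball x (δ / 2)), image_mem_map
        (inter_mem self_mem_nhdsWithin (mem_nhdsWithin_of_mem_nhds
          (Metric.ball_mem_nhds x (by positivity)))), ?_⟩
      rintro _ ⟨t, ⟨ht, htx⟩, rfl⟩ _ ⟨t', ⟨ht', htx'⟩, rfl⟩
      refine H t ht t' ht' ?_
      rw [Metric.mem_ball, Real.dist_eq, abs_lt] at htx htx'
      rw [abs_lt]; constructor <;> linarith
    exact CompleteSpace.complete hcau
  have ha : (𝓝[Ioo a b] a).NeBot := by rw [nhdsWithin_Ioo_eq_nhdsGT hab]; infer_instance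
  have hb : (𝓝[Ioo a b] b).NeBot := by rw [nhdsWithin_Ioo_eq_nhdsLT hab]; infer_instance
  obtain ⟨la, hla⟩ := hlim a ha
  obtain ⟨lb, hlb⟩ := hlim b hb
  rw [nhdsWithin_Ioo_eq_nhdsGT hab] at hla
  rw [nhdsWithin_Ioo_eq_nhdsLT hab] at hlb
  refine ⟨extendFrom (Ioo a b) c, continuousOn_Icc_extendFrom_Ioo hu.continuousOn hla hlb,
    fun t ht => ?_⟩
  refine extendFrom_eq (subset_closure ht) ?_
  exact hu.continuousOn t ht

end ShortArc

namespace LogData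

section Wolff

open MeasureTheory ENNReal

variable {U : Set ℂ} (d : LogData U)

theorem zero_notMem (d : LogData U) : (0 : ℂ) ∉ U := fun h => Complex.exp_ne_zero _ (d.exp_L 0 h)

theorem φ_injOn : InjOn d.φ (Metric.ball 0 1) := fun x hx y hy h => by
  rw [← d.h_φ x hx, ← d.h_φ y hy, h]

/-- `g` parametrizes the image under the Riemann map of the arc `𝔻 ∩ ∂B(ξ, r)`, with endpoints
on the boundary of the domain. -/
structure IsArc (ξ : ℂ) (r : ℝ) (g : ℝ → ℂ) : Prop where
  continuousOn : ContinuousOn g (Icc 0 1)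
  injOn : InjOn g (Ioo 0 1)
  image : g '' Ioo 0 1 = d.φ '' (Metric.ball 0 1 ∩ Metric.sphere ξ r)
  left : g 0 ∈ frontier U
  right : g 1 ∈ frontier U

/-- The polar parametrization of the circle about a point `ξ` of the unit circle. -/
def circ (ξ : ℂ) (r t : ℝ) : ℂ := ξ * (1 - Complex.polarCoord.symm (r, t))

theorem circ_eq (ξ : ℂ) (r t : ℝ) : circ ξ r t = ξ * (1 - r * Complex.exp (t * Complex.I)) := by
  rw [circ, Complex.polarCoord_symm_apply, Complex.exp_mul_I]
  simp

theorem hasDerivAt_polarCoord_symm (r t : ℝ) :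
    HasDerivAt (fun t : ℝ => Complex.polarCoord.symm (r, t))
      (r * (Complex.exp (t * Complex.I) * Complex.I)) t := by
  have h1 : HasDerivAt (fun t : ℝ => (t : ℂ) * Complex.I) Complex.I t := by
    simpa using (Complex.ofRealCLM.hasDerivAt (x := t)).mul_const Complex.I
  have h2 := h1.cexp.const_mul (r : ℂ)
  have h3 : (fun t : ℝ => Complex.polarCoord.symm (r, t)) =
      fun t : ℝ => (r : ℂ) * Complex.exp (t * Complex.I) := by
    funext t
    rw [Complex.polarCoord_symm_apply, Complex.exp_mul_I]
    simp
  rw [h3]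
  exact h2

theorem norm_sq_circ {ξ : ℂ} (hξ : ‖ξ‖ = 1) (r t : ℝ) :
    ‖circ ξ r t‖ ^ 2 = 1 + r ^ 2 - 2 * r * Real.cos t := by
  rw [circ, norm_mul, hξ, one_mul, ← Complex.normSq_eq_norm_sq, Complex.polarCoord_symm_apply,
    Complex.normSq_apply]
  simp only [Complex.sub_re, Complex.sub_im, Complex.one_re, Complex.one_im, Complex.mul_re,
    Complex.mul_im, Complex.ofReal_re, Complex.ofReal_im, Complex.add_re, Complex.add_im,
    Complex.I_re, Complex.I_im]
  have := Real.sin_sq_add_cos_sq t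
  linear_combination r ^ 2 * this

theorem circ_mem_sphere {ξ : ℂ} (hξ : ‖ξ‖ = 1) {r : ℝ} (hr : 0 < r) (t : ℝ) :
    circ ξ r t ∈ Metric.sphere ξ r := by
  rw [mem_sphere_iff_norm, circ_eq]
  have : ξ * (1 - r * Complex.exp (t * Complex.I)) - ξ =
      -(ξ * (r * Complex.exp (t * Complex.I))) := by
    ring
  rw [this, norm_neg, norm_mul, norm_mul, hξ, Complex.norm_exp_ofReal_mul_I]
  simp [abs_of_pos hr]

theorem circ_mem_ball_iff {ξ : ℂ} (hξ : ‖ξ‖ = 1) {r : ℝ} (hr : 0 < r) {t : ℝ} :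
    circ ξ r t ∈ Metric.ball 0 1 ↔ r / 2 < Real.cos t := by
  rw [mem_ball_zero_iff, ← sq_lt_one_iff₀ (norm_nonneg _), norm_sq_circ hξ]
  constructor
  · intro h
    by_contra hc
    nlinarith
  · intro h
    nlinarith

theorem circ_mem_ball_iff_abs {ξ : ℂ} (hξ : ‖ξ‖ = 1) {r : ℝ} (hr : 0 < r) (hr1 : r < 1) {t : ℝ}
    (ht : t ∈ Ioc (-Real.pi) Real.pi) :
    circ ξ r t ∈ Metric.ball 0 1 ↔
      t ∈ Ioo (-Real.arccos (r / 2)) (Real.arccos (r / 2)) := by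
  rw [circ_mem_ball_iff hξ hr, ← Real.cos_abs, mem_Ioo, ← abs_lt]
  have hpi : |t| ≤ Real.pi := abs_le.2 ⟨ht.1.le, ht.2⟩
  have hc : Real.cos (Real.arccos (r / 2)) = r / 2 := Real.cos_arccos (by linarith) (by linarith)
  conv_lhs => rw [← hc]
  exact Real.strictAntiOn_cos.lt_iff_gt ⟨Real.arccos_nonneg _, Real.arccos_le_pi _⟩
    ⟨abs_nonneg t, hpi⟩

theorem image_circ {ξ : ℂ} (hξ : ‖ξ‖ = 1) {r : ℝ} (hr : 0 < r) (hr1 : r < 1) :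
    circ ξ r '' Ioo (-Real.arccos (r / 2)) (Real.arccos (r / 2)) =
      Metric.ball 0 1 ∩ Metric.sphere ξ r := by
  have hξ0 : ξ ≠ 0 := norm_ne_zero_iff.1 (by rw [hξ]; norm_num)
  have hle : Real.arccos (r / 2) ≤ Real.pi := Real.arccos_le_pi _
  apply Subset.antisymm
  · rintro _ ⟨t, ht, rfl⟩
    exact ⟨(circ_mem_ball_iff_abs hξ hr hr1 ⟨by linarith [ht.1], by linarith [ht.2]⟩).2 ht,
      circ_mem_sphere hξ hr t⟩
  · rintro z ⟨hz, hzs⟩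
    have hn : ‖1 - z / ξ‖ = r := by
      have : 1 - z / ξ = -((z - ξ) / ξ) := by field_simp; ring
      rw [this, norm_neg, norm_div, hξ, div_one]
      exact mem_sphere_iff_norm.1 hzs
    have hzc : circ ξ r (Complex.arg (1 - z / ξ)) = z := by
      rw [circ_eq, ← hn, Complex.norm_mul_exp_arg_mul_I]
      field_simp; ring
    refine ⟨_, (circ_mem_ball_iff_abs hξ hr hr1 (Complex.arg_mem_Ioc _)).1 ?_, hzc⟩
    rwa [hzc]

theorem circ_injOn {ξ : ℂ} (hξ : ‖ξ‖ = 1) {r : ℝ} (hr : 0 < r) :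
    InjOn (circ ξ r) (Ioc (-Real.pi) Real.pi) := by
  have hξ0 : ξ ≠ 0 := norm_ne_zero_iff.1 (by rw [hξ]; norm_num)
  intro t ht t' ht' h
  rw [circ_eq, circ_eq] at h
  have h2 := mul_left_cancel₀ hξ0 h
  have h3 : (r : ℂ) * Complex.exp (t * Complex.I) = r * Complex.exp (t' * Complex.I) := by
    linear_combination -h2
  rw [← Complex.arg_mul_cos_add_sin_mul_I hr ht, ← Complex.arg_mul_cos_add_sin_mul_I hr ht',
    ← Complex.exp_mul_I, ← Complex.exp_mul_I, h3]

theorem mem_frontier_of_tendsto {ι : Type*} {l : Filter ι} [l.NeBot] {z : ι → ℂ} {y : ℂ}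
    (hz : ∀ᶠ i in l, z i ∈ Metric.ball (0 : ℂ) 1) (h1 : Tendsto (fun i => ‖z i‖) l (𝓝 1))
    (hy : Tendsto (fun i => d.φ (z i)) l (𝓝 y)) : y ∈ frontier U := by
  rw [d.isOpen.frontier_eq]
  refine ⟨mem_closure_of_tendsto hy (hz.mono fun i hi => d.mapsTo_φ hi), fun hyU => ?_⟩
  have hc := ((d.continuousOn_h.continuousAt (d.isOpen.mem_nhds hyU)).tendsto.comp hy).norm
  have h2 : Tendsto (fun i => ‖z i‖) l (𝓝 ‖d.h y‖) := by
    refine hc.congr' (hz.mono fun i hi => ?_)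
    simp [d.h_φ _ hi]
  have := tendsto_nhds_unique h1 h2
  linarith [d.norm_h_lt hyU]

theorem exists_arc {ξ : ℂ} (hξ : ‖ξ‖ = 1) (S : Finset ℂ) (hS : ∀ s ∈ S, s ∉ U) (M : ℝ)
    {δ η : ℝ} (hδ : 0 < δ) (hη : 0 < η) :
    ∃ r ∈ Ioo 0 η, r < 1 ∧ ∃ g, d.IsArc ξ r g ∧ g 0 ∉ S ∧ g 1 ∉ S ∧
      ∀ x ∈ g '' Ioo 0 1, ∀ y ∈ g '' Ioo 0 1, ‖x‖ ≤ M → ‖x - y‖ ≤ δ := by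
  classical
  have hξ0 : ξ ≠ 0 := norm_ne_zero_iff.1 (by rw [hξ]; norm_num)
  have hpi := Real.pi_pos
  set S' := insert 0 S with hS'
  have hS'U : ∀ s ∈ S', s ∉ U := by
    intro s hs
    rcases Finset.mem_insert.1 hs with rfl | h
    · exact d.zero_notMem
    · exact hS s h
  set G : ℂ → ℝ≥0∞ := fun z => ∑ s ∈ S', ENNReal.ofReal (logWeight ‖z - s‖) with hG
  have hw := measurable_logWeight
  have hGm : Measurable G := by
    refine Finset.measurable_fun_sum _ fun s _ => ?_
    fun_prop
  have hGt : ∫⁻ z, G z < ∞ := by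
    rw [hG, lintegral_finsetSum _ fun s _ => by fun_prop]
    exact ENNReal.sum_lt_top.2 fun s _ => lintegral_logWeight_lt_top s
  set V : Set ℂ := {w | ξ * (1 - w) ∈ Metric.ball (0 : ℂ) 1} with hVdef
  have hV : IsOpen V := Metric.isOpen_ball.preimage (by fun_prop)
  set F : ℂ → ℂ := fun w => d.φ (ξ * (1 - w)) with hFdef
  have hF : DifferentiableOn ℂ F V := by
    refine d.differentiableOn_φ.comp (t := Metric.ball 0 1) ?_ fun w hw => hw
    fun_prop
  have hFinj : InjOn F V := fun w hw w' hw' h => by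
    have := mul_left_cancel₀ hξ0 (d.φ_injOn hw hw' h)
    linear_combination -this
  obtain ⟨C1, hC1, hC1w⟩ := exists_inv_logWeight_le
    (Real.exp (Real.sinh (Real.arsinh (Real.log (max M 1)) + 1)))
  set κ := min (1 / Real.pi) (δ ^ 2 / (C1 * Real.pi)) with hκdef
  have hκ : 0 < κ := by positivity
  obtain ⟨r, hr, hrint⟩ := exists_radius_lintegral_le hV hF hFinj hGm hGt hκ
    (lt_min hη one_pos)
  have hr0 : 0 < r := hr.1
  have hr1 : r < 1 := hr.2.trans_le (min_le_right _ _)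
  refine ⟨r, ⟨hr0, hr.2.trans_le (min_le_left _ _)⟩, hr1, ?_⟩
  set T := Real.arccos (r / 2) with hT
  have hT0 : 0 < T := Real.arccos_pos.2 (by linarith)
  have hT2 : T ≤ Real.pi / 2 := Real.arccos_le_pi_div_two.2 (by positivity)
  have hTT : -T < T := by linarith
  set p : ℝ → ℂ := fun t => Complex.polarCoord.symm (r, t) with hp
  have hball : ∀ t ∈ Ioo (-T) T, circ ξ r t ∈ Metric.ball (0 : ℂ) 1 := fun t ht =>
    (circ_mem_ball_iff_abs hξ hr0 hr1 ⟨by linarith [ht.1], by linarith [ht.2]⟩).2 ht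
  have hpV : ∀ t ∈ Ioo (-T) T, p t ∈ V := hball
  set c : ℝ → ℂ := fun t => d.φ (circ ξ r t) with hc
  set c' : ℝ → ℂ := fun t => deriv F (p t) * (r * (Complex.exp (t * Complex.I) * Complex.I))
    with hc'
  have hder : ∀ t ∈ Ioo (-T) T, HasDerivAt c (c' t) t := fun t ht =>
    (hF.differentiableAt (hV.mem_nhds (hpV t ht))).hasDerivAt.comp t
      (hasDerivAt_polarCoord_symm r t)
  have hpcont : Continuous p := continuous_iff_continuousAt.2 fun t =>
    (hasDerivAt_polarCoord_symm r t).continuousAt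
  have hcirc : Continuous (circ ξ r) := by
    have : circ ξ r = fun t => ξ * (1 - p t) := rfl
    rw [this]; fun_prop
  have hc'cont : ContinuousOn c' (Ioo (-T) T) := by
    refine ContinuousOn.mul ((hF.deriv hV).continuousOn.comp hpcont.continuousOn hpV) ?_
    fun_prop
  have hcU : ∀ t ∈ Ioo (-T) T, c t ∈ U := fun t ht => d.mapsTo_φ (hball t ht)
  have hcs : ∀ s ∈ S', ∀ t ∈ Ioo (-T) T, c t ≠ s := fun s hs t ht h =>
    hS'U s hs (h ▸ hcU t ht)
  have hint : ∀ s ∈ S', ∫⁻ t in Ioo (-T) T, ENNReal.ofReal (‖c' t‖ ^ 2) *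
      ENNReal.ofReal (logWeight ‖c t - s‖) ≤ ENNReal.ofReal κ := by
    intro s hs
    refine le_trans ?_ ((lintegral_mono_set (Ioo_subset_Ioo (by linarith) (by linarith) :
      Ioo (-T) T ⊆ Ioo (-Real.pi) Real.pi)).trans hrint)
    refine setLIntegral_mono' measurableSet_Ioo fun t ht => ?_
    rw [indicator_of_mem (hpV t ht), ← mul_assoc, ← ENNReal.ofReal_mul (p := r ^ 2) (by positivity)]
    have hn : ‖c' t‖ ^ 2 = r ^ 2 * ‖deriv F (p t)‖ ^ 2 := by
      rw [hc']
      simp only [norm_mul, Complex.norm_exp_ofReal_mul_I, Complex.norm_I, Complex.norm_real,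
        Real.norm_eq_abs, abs_of_pos hr0]
      ring
    rw [hn]
    gcongr
    exact Finset.single_le_sum (f := fun s => ENNReal.ofReal (logWeight ‖F (p t) - s‖))
      (fun _ _ => zero_le) hs
  have hvar : ∀ s ∈ S', ∀ t ∈ Ioo (-T) T, ∀ t' ∈ Ioo (-T) T,
      Real.arsinh (Real.log ‖c t - s‖) ≤ Real.arsinh (Real.log ‖c t' - s‖) + 1 ∧
      Real.arsinh (Real.log ‖c t' - s‖) - 1 ≤ Real.arsinh (Real.log ‖c t - s‖) := by
    intro s hs t ht t' ht'
    have h1 := arsinh_log_variation_le hκ hder hc'cont (hcs s hs) (hint s hs) ht ht'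
    have h2 : |t - t'| ≤ Real.pi := abs_le.2 ⟨by linarith [ht.1, ht'.2], by linarith [ht.2, ht'.1]⟩
    have h3 : κ * |t - t'| ≤ 1 := by
      calc κ * |t - t'| ≤ (1 / Real.pi) * Real.pi := by
            gcongr; exact min_le_left _ _
        _ = 1 := by field_simp
    have := abs_le.1 ((sq_le_one_iff_abs_le_one _).1 (h1.trans h3))
    constructor <;> linarith [this.1, this.2]
  have hpos : ∀ s ∈ S', ∀ t ∈ Ioo (-T) T, 0 < ‖c t - s‖ := fun s hs t ht =>
    norm_pos_iff.2 (sub_ne_zero.2 (hcs s hs t ht))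
  have h0mem : (0 : ℝ) ∈ Ioo (-T) T := ⟨by linarith, hT0⟩
  have hup : ∀ s ∈ S', ∀ B : ℝ, ∀ t ∈ Ioo (-T) T, Real.arsinh (Real.log ‖c t - s‖) ≤ B →
      ‖c t - s‖ ≤ Real.exp (Real.sinh B) := fun s hs B t ht h => by
    rw [← Real.log_le_iff_le_exp (hpos s hs t ht), ← Real.arsinh_le_arsinh, Real.arsinh_sinh]
    exact h
  have hlow : ∀ s ∈ S', ∃ m > 0, ∀ t ∈ Ioo (-T) T, m ≤ ‖c t - s‖ := fun s hs => by
    refine ⟨Real.exp (Real.sinh (Real.arsinh (Real.log ‖c 0 - s‖) - 1)), Real.exp_pos _,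
      fun t ht => ?_⟩
    rw [← Real.le_log_iff_exp_le (hpos s hs t ht), ← Real.arsinh_le_arsinh, Real.arsinh_sinh]
    exact (hvar s hs t ht 0 h0mem).2
  have h0S' : (0 : ℂ) ∈ S' := Finset.mem_insert_self _ _
  have hint0 := hint 0 h0S'
  have hpos0 := hpos 0 h0S'
  have hup0 := hup 0 h0S'
  have hvar0 := hvar 0 h0S'
  simp only [sub_zero] at hint0 hpos0 hup0 hvar0
  obtain ⟨C0, hC0, hC0w⟩ := exists_inv_logWeight_le
    (Real.exp (Real.sinh (Real.arsinh (Real.log ‖c 0‖) + 1)))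
  have hhol : ∀ t ∈ Ioo (-T) T, ∀ t' ∈ Ioo (-T) T, ‖c t - c t'‖ ^ 2 ≤ C0 * κ * |t - t'| :=
    fun t ht t' ht' => sq_norm_sub_le_of_norm_le hκ hder hc'cont hint0 hC0
      (fun t ht => hC0w _ (hpos0 t ht) (hup0 _ t ht (hvar0 t ht 0 h0mem).1)) ht ht'
  obtain ⟨g0, hg0, hg0c⟩ := exists_continuousOn_Icc_of_holder hTT (by positivity) hhol
  have hend : ∀ e, |e| = T → e ∈ Icc (-T) T → g0 e ∈ frontier U ∧ g0 e ∉ S := by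
    intro e he hmem
    have hne : (𝓝[Ioo (-T) T] e).NeBot := by
      rw [← mem_closure_iff_nhdsWithin_neBot, closure_Ioo hTT.ne]; exact hmem
    have hlim : Tendsto c (𝓝[Ioo (-T) T] e) (𝓝 (g0 e)) :=
      ((hg0 e hmem).mono_left (nhdsWithin_mono _ Ioo_subset_Icc_self)).congr'
        (eventually_nhdsWithin_of_forall hg0c)
    refine ⟨d.mem_frontier_of_tendsto (eventually_nhdsWithin_of_forall hball) ?_ hlim,
      fun heS => ?_⟩
    · have h1 : ‖circ ξ r e‖ = 1 := by
        rw [← sq_eq_sq₀ (norm_nonneg _) zero_le_one, norm_sq_circ hξ, ← Real.cos_abs, he, hT,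
          Real.cos_arccos (by linarith) (by linarith)]
        ring
      rw [← h1]
      exact (hcirc.norm.tendsto e).mono_left nhdsWithin_le_nhds
    · obtain ⟨m, hm, hml⟩ := hlow _ (Finset.mem_insert_of_mem heS)
      have h2 : Tendsto (fun t => ‖c t - g0 e‖) (𝓝[Ioo (-T) T] e) (𝓝 0) := by
        simpa using (hlim.sub_const (g0 e)).norm
      have := ge_of_tendsto h2 (eventually_nhdsWithin_of_forall hml)
      linarith
  set a : ℝ → ℝ := fun x => -T + 2 * T * x with ha
  have haIoo : a '' Ioo 0 1 = Ioo (-T) T := by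
    apply Subset.antisymm
    · rintro _ ⟨x, hx, rfl⟩
      constructor <;> simp only [ha] <;> nlinarith [hx.1, hx.2]
    · intro t ht
      refine ⟨(t + T) / (2 * T), ⟨by have := ht.1; apply div_pos <;> linarith, ?_⟩, ?_⟩
      · rw [div_lt_one (by linarith)]; linarith [ht.2]
      · simp only [ha]; field_simp; ring
  have haInj : Function.Injective a := fun x y h => by
    have : 2 * T * x = 2 * T * y := by simpa [ha] using h
    exact mul_left_cancel₀ (by positivity) this
  have himg : (fun x => g0 (a x)) '' Ioo 0 1 = c '' Ioo (-T) T := by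
    rw [← haIoo, image_image]
    exact image_congr fun x hx => hg0c (haIoo ▸ mem_image_of_mem a hx)
  have h0 := hend (-T) (by rw [abs_neg, abs_of_pos hT0]) ⟨le_rfl, hTT.le⟩
  have h1 := hend T (abs_of_pos hT0) ⟨hTT.le, le_rfl⟩
  have ha0 : a 0 = -T := by simp [ha]
  have ha1 : a 1 = T := by simp only [ha]; ring
  refine ⟨fun x => g0 (a x), ⟨?_, ?_, ?_, ?_, ?_⟩, ?_, ?_, ?_⟩
  · refine hg0.comp (by fun_prop) fun x hx => ?_
    constructor <;> simp only [ha] <;> nlinarith [hx.1, hx.2]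
  · intro x hx y hy hxy
    have hx' : a x ∈ Ioo (-T) T := haIoo ▸ mem_image_of_mem a hx
    have hy' : a y ∈ Ioo (-T) T := haIoo ▸ mem_image_of_mem a hy
    simp only [hg0c hx', hg0c hy'] at hxy
    refine haInj (circ_injOn hξ hr0 ⟨by linarith [hx'.1], by linarith [hx'.2]⟩
      ⟨by linarith [hy'.1], by linarith [hy'.2]⟩ (d.φ_injOn (hball _ hx') (hball _ hy') hxy))
  · rw [himg, ← image_circ hξ hr0 hr1, image_image]
  · simp only [ha0]; exact h0.1
  · simp only [ha1]; exact h1.1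
  · simp only [ha0]; exact h0.2
  · simp only [ha1]; exact h1.2
  · rw [himg]
    rintro _ ⟨t, ht, rfl⟩ _ ⟨t', ht', rfl⟩ hM
    have hu : Real.arsinh (Real.log ‖c t‖) ≤ Real.arsinh (Real.log (max M 1)) := by
      rw [Real.arsinh_le_arsinh]
      exact Real.log_le_log (hpos0 t ht) (hM.trans (le_max_left _ _))
    have hb : ∀ x ∈ Ioo (-T) T, 1 ≤ C1 * logWeight ‖c x‖ := fun x hx =>
      hC1w _ (hpos0 x hx) (hup0 _ x hx ((hvar0 x hx t ht).1.trans (by linarith)))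
    have h3 := sq_norm_sub_le_of_norm_le hκ hder hc'cont hint0 hC1 hb ht ht'
    have h4 : |t - t'| ≤ Real.pi := abs_le.2 ⟨by linarith [ht.1, ht'.2], by linarith [ht.2, ht'.1]⟩
    have h5 : C1 * κ * |t - t'| ≤ δ ^ 2 := by
      calc C1 * κ * |t - t'| ≤ C1 * (δ ^ 2 / (C1 * Real.pi)) * Real.pi := by
            gcongr; exact min_le_right _ _
        _ = δ ^ 2 := by field_simp
    exact (sq_le_sq₀ (norm_nonneg _) hδ.le).1 (h3.trans h5)

end Wolff

end LogData

namespace LogData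

variable {U : Set ℂ} (d : LogData U)

theorem IsArc.isBounded {d : LogData U} {ξ : ℂ} {r : ℝ} {g : ℝ → ℂ} (h : d.IsArc ξ r g) :
    Bornology.IsBounded (d.φ '' (Metric.ball 0 1 ∩ Metric.sphere ξ r)) := by
  rw [← h.image]
  exact ((isCompact_Icc.image_of_continuousOn h.continuousOn).isBounded).subset
    (image_mono Ioo_subset_Icc_self)

theorem exists_smallVariation : ∃ R, d.SmallVariation R := by
  have hex : ∀ ξ : ℂ, ∃ r : ℝ, ξ ∈ Metric.sphere (0 : ℂ) 1 → 0 < r ∧ r < 1 / 4 ∧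
      Bornology.IsBounded (d.φ '' (Metric.ball 0 1 ∩ Metric.sphere ξ r)) := by
    intro ξ
    by_cases hξ : ‖ξ‖ = 1
    · obtain ⟨r, hr, -, g, hg, -⟩ := d.exists_arc hξ ∅ (by simp) 0 (δ := 1) (η := 1 / 4)
        one_pos (by norm_num)
      exact ⟨r, fun _ => ⟨hr.1, hr.2, hg.isBounded⟩⟩
    · exact ⟨1, fun h => absurd (mem_sphere_zero_iff_norm.1 h) hξ⟩
  choose r hr using hex
  obtain ⟨t, ht, htc⟩ := (isCompact_sphere (0 : ℂ) 1).elim_nhds_subcover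
    (fun ξ => Metric.ball ξ (r ξ)) fun ξ hξ => Metric.ball_mem_nhds ξ (hr ξ hξ).1
  set O : Set ℂ := ⋃ ξ ∈ t, Metric.ball ξ (r ξ) with hO
  have hOo : IsOpen O := isOpen_biUnion fun ξ _ => Metric.isOpen_ball
  have hK : IsCompact (Metric.closedBall (0 : ℂ) 1 \ O) :=
    (isCompact_closedBall _ _).diff hOo
  have hKb : Metric.closedBall (0 : ℂ) 1 \ O ⊆ Metric.ball 0 1 := by
    rintro z ⟨hz, hzO⟩
    refine lt_of_le_of_ne hz fun h => hzO (htc h)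
  have hb1 := (hK.image_of_continuousOn (d.continuousOn_φ.mono hKb)).isBounded
  have hb2 : Bornology.IsBounded
      (⋃ ξ ∈ t, d.φ '' (Metric.ball 0 1 ∩ Metric.sphere ξ (r ξ))) :=
    (Bornology.isBounded_biUnion_finset t).2 fun ξ hξ => (hr ξ (ht ξ hξ)).2.2
  obtain ⟨R, hR⟩ := (hb1.union hb2).exists_norm_le
  refine ⟨max R (‖d.φ 0‖ + 1), lt_of_lt_of_le (by linarith) (le_max_right _ _), ?_⟩
  intro Y hYU hY hYR x hx x' hx'
  have htop : Y ⊆ d.top := fun z hz =>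
    d.mem_top_of_norm (hYU hz) (lt_of_le_of_lt (by linarith [le_max_right R (‖d.φ 0‖ + 1)])
      (hYR z hz))
  have hnot : ∀ z ∈ Y, d.φ (d.h z) ∉ d.φ '' (Metric.closedBall (0 : ℂ) 1 \ O) ∪
      ⋃ ξ ∈ t, d.φ '' (Metric.ball 0 1 ∩ Metric.sphere ξ (r ξ)) := by
    intro z hz hmem
    rw [d.φ_h z (hYU hz)] at hmem
    linarith [hR z hmem, hYR z hz, le_max_left R (‖d.φ 0‖ + 1)]
  have hxO : d.h x ∈ O := by
    by_contra hc
    exact hnot x hx (Or.inl (mem_image_of_mem _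
      ⟨Metric.ball_subset_closedBall (d.mapsTo_h (hYU hx)), hc⟩))
  obtain ⟨ξ, hξt, hxξ⟩ := mem_iUnion₂.1 hxO
  have hξ := hr ξ (ht ξ hξt)
  have hξ1 : ‖ξ‖ = 1 := by simpa using ht ξ hξt
  have hsub : d.h '' Y ⊆ Metric.ball ξ (r ξ) := by
    refine (hY.image _ (d.continuousOn_h.mono hYU)).subset_left_of_subset_union
      Metric.isOpen_ball Metric.isClosed_closedBall.isOpen_compl
      (disjoint_left.2 fun z hz hz' => hz' (Metric.ball_subset_closedBall hz)) ?_
      ⟨_, mem_image_of_mem _ hx, hxξ⟩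
    rintro _ ⟨z, hz, rfl⟩
    by_contra hc
    simp only [mem_union, Metric.mem_ball, mem_compl_iff, Metric.mem_closedBall, not_or, not_lt,
      not_not] at hc
    refine hnot z hz (Or.inr (mem_iUnion₂.2 ⟨ξ, hξt, mem_image_of_mem _
      ⟨d.mapsTo_h (hYU hz), le_antisymm hc.2 hc.1⟩⟩))
  have hre : ∀ z ∈ Y, 0 < (d.h z / ξ).re := by
    intro z hz
    have h1 : ‖d.h z / ξ - 1‖ < 1 := by
      have hξ0 : ξ ≠ 0 := norm_ne_zero_iff.1 (by rw [hξ1]; norm_num)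
      have : d.h z / ξ - 1 = (d.h z - ξ) / ξ := by field_simp
      rw [this, norm_div, hξ1, div_one]
      have := mem_ball_iff_norm.1 (hsub (mem_image_of_mem _ hz))
      linarith [hξ.2.1]
    have h2 := (Complex.abs_re_le_norm (d.h z / ξ - 1)).trans_lt h1
    have := (abs_lt.1 h2).1
    simp only [Complex.sub_re, Complex.one_re] at this
    linarith
  have hξ0 : ξ ≠ 0 := norm_ne_zero_iff.1 (by rw [hξ1]; norm_num)
  have key := log_change_eq hY (f := fun z => d.wOf z - Complex.log ξ)
    (g := fun z => Complex.log (d.h z / ξ))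
    ((d.continuousOn_wOf.mono htop).sub continuousOn_const)
    (((d.continuousOn_h.mono hYU).div_const ξ).clog fun z hz => Or.inl (hre z hz))
    (fun z hz => by
      have h0 : d.h z / ξ ≠ 0 := fun h => by have := hre z hz; simp [h] at this
      rw [Complex.exp_sub, d.exp_wOf (htop hz), Complex.exp_log hξ0, Complex.exp_log h0]) hx' hx
  have key2 := congrArg Complex.im key
  simp only [Complex.sub_im, Complex.log_im] at key2
  have h3 := Complex.abs_arg_lt_pi_div_two_iff.2 (Or.inl (hre x hx))
  have h4 := Complex.abs_arg_lt_pi_div_two_iff.2 (Or.inl (hre x' hx'))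
  have h5 : d.θ x - d.θ x' = (d.h x / ξ).arg - (d.h x' / ξ).arg := by
    rw [← key2]; simp only [θ]; ring
  rw [h5]
  rw [abs_lt] at h3 h4 ⊢
  constructor <;> linarith [h3.1, h3.2, h4.1, h4.2]

end LogData

theorem hasTwoComps_of_isOpen {Y : Type*} [TopologicalSpace Y] {A D₁ D₂ : Set Y}
    (h₁ : IsOpen D₁) (h₂ : IsOpen D₂) (hc₁ : IsConnected D₁) (hc₂ : IsConnected D₂)
    (hd : Disjoint D₁ D₂) (hA : A = D₁ ∪ D₂) : HasTwoComps A D₁ D₂ := by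
  subst hA
  have e₁ : ∀ x ∈ D₁, connectedComponentIn (D₁ ∪ D₂) x = D₁ := fun x hx =>
    Subset.antisymm (isPreconnected_connectedComponentIn.subset_left_of_subset_union h₁ h₂ hd
      (connectedComponentIn_subset _ _) ⟨x, mem_connectedComponentIn (Or.inl hx), hx⟩)
      (hc₁.isPreconnected.subset_connectedComponentIn hx subset_union_left)
  have e₂ : ∀ x ∈ D₂, connectedComponentIn (D₁ ∪ D₂) x = D₂ := fun x hx =>
    Subset.antisymm (isPreconnected_connectedComponentIn.subset_right_of_subset_union h₁ h₂ hd
      (connectedComponentIn_subset _ _) ⟨x, mem_connectedComponentIn (Or.inr hx), hx⟩)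
      (hc₂.isPreconnected.subset_connectedComponentIn hx subset_union_right)
  obtain ⟨x₁, hx₁⟩ := hc₁.nonempty
  obtain ⟨x₂, hx₂⟩ := hc₂.nonempty
  refine ⟨⟨x₁, Or.inl hx₁, (e₁ x₁ hx₁).symm⟩, ⟨x₂, Or.inr hx₂, (e₂ x₂ hx₂).symm⟩, ?_, ?_⟩
  · rintro rfl; exact disjoint_left.1 hd hx₁ hx₁
  · rintro x (hx | hx)
    exacts [Or.inl (e₁ x hx), Or.inr (e₂ x hx)]

theorem isConnected_ball_sdiff_closedBall {ξ : ℂ} (hξ : ‖ξ‖ = 1) {r : ℝ} (hr1 : r < 1) :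
    IsConnected (Metric.ball (0 : ℂ) 1 \ Metric.closedBall ξ r) := by
  set N : Set ℂ := Metric.ball 0 1 ∩ Metric.ball (-ξ) (2 - r) with hN
  have hNs : N ⊆ Metric.ball (0 : ℂ) 1 \ Metric.closedBall ξ r := by
    rintro z ⟨hz, hz2⟩
    refine ⟨hz, fun h => ?_⟩
    rw [mem_ball_iff_norm] at hz2
    rw [mem_closedBall_iff_norm] at h
    have h3 : ‖(z - -ξ) - (z - ξ)‖ = 2 := by
      rw [show (z - -ξ) - (z - ξ) = 2 * ξ by ring, norm_mul, hξ]; simp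
    linarith [norm_sub_le (z - -ξ) (z - ξ)]
  have hNc : Convex ℝ N := (convex_ball _ _).inter (convex_ball _ _)
  have h0 : (0 : ℂ) ∈ N := ⟨by simp, by simp [hξ]; linarith⟩
  refine ⟨⟨0, hNs h0⟩, isPreconnected_of_forall 0 fun z hz => ?_⟩
  set c : ℝ → ℂ := fun s => ((1 - s : ℝ) : ℂ) * z - (s : ℂ) * ξ with hc
  have hcc : Continuous c := by fun_prop
  have hzn : ‖z‖ < 1 := by simpa using hz.1
  have hzξ : r < ‖z - ξ‖ := by
    have := hz.2
    rwa [mem_closedBall_iff_norm, not_le] at this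
  have hcb : ∀ s ∈ Ico (0 : ℝ) 1, c s ∈ Metric.ball (0 : ℂ) 1 := by
    intro s hs
    rw [mem_ball_zero_iff]
    calc ‖c s‖ ≤ ‖((1 - s : ℝ) : ℂ) * z‖ + ‖(s : ℂ) * ξ‖ := norm_sub_le _ _
      _ = (1 - s) * ‖z‖ + s := by
        rw [norm_mul, norm_mul, hξ, Complex.norm_real, Complex.norm_real, Real.norm_eq_abs,
          Real.norm_eq_abs, abs_of_pos (by linarith [hs.2]), abs_of_nonneg hs.1, mul_one]
      _ < 1 := by nlinarith [hs.1, hs.2]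
  have hcs : c '' Ico 0 1 ⊆ Metric.ball (0 : ℂ) 1 \ Metric.closedBall ξ r := by
    rintro _ ⟨s, hs, rfl⟩
    refine ⟨hcb s hs, fun h => ?_⟩
    rw [mem_closedBall_iff_norm] at h
    have hmono : ‖z - ξ‖ ^ 2 ≤ ‖c s - ξ‖ ^ 2 := by
      have e1 : ‖ξ‖ ^ 2 = 1 := by rw [hξ]; norm_num
      have e2 : ‖z‖ ^ 2 < 1 := by nlinarith [norm_nonneg z]
      rw [← Complex.normSq_eq_norm_sq, Complex.normSq_apply] at e1 e2 ⊢
      rw [← Complex.normSq_eq_norm_sq, Complex.normSq_apply]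
      simp only [hc, Complex.sub_re, Complex.sub_im, Complex.mul_re, Complex.mul_im,
        Complex.ofReal_re, Complex.ofReal_im]
      have hs0 := hs.1
      have hs1 := hs.2
      have k1 : 0 ≤ s * (1 - s) * (1 - (z.re * z.re + z.im * z.im)) :=
        mul_nonneg (mul_nonneg hs0 (by linarith)) (by linarith)
      have k2 : 0 ≤ s * (1 + (z.re * ξ.re + z.im * ξ.im)) := by
        refine mul_nonneg hs0 ?_
        nlinarith [sq_nonneg (z.re + ξ.re), sq_nonneg (z.im + ξ.im)]
      have k3 : 0 ≤ s * (1 - (z.re * z.re + z.im * z.im)) := mul_nonneg hs0 (by linarith)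
      linear_combination k1 + 2 * s * k2 + k3 - ((1 + s) ^ 2 - 1) * e1
    have := (sq_le_sq₀ (norm_nonneg _) (norm_nonneg _)).1 hmono
    linarith
  obtain ⟨s, hs, hsN⟩ : ∃ s ∈ Ico (0 : ℝ) 1, c s ∈ N := by
    have h1 : Tendsto c (𝓝[<] 1) (𝓝 (-ξ)) := by
      have := (hcc.tendsto 1).mono_left (nhdsWithin_le_nhds (s := Iio 1))
      simpa [hc] using this
    have h2 := h1.eventually (Metric.ball_mem_nhds (-ξ) (by linarith : 0 < 2 - r))
    obtain ⟨s, hs2, hs⟩ := (h2.and (Ico_mem_nhdsLT (zero_lt_one' ℝ))).exists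
    exact ⟨s, hs, hcb s hs, hs2⟩
  refine ⟨c '' Ico 0 1 ∪ N, union_subset hcs hNs, Or.inr h0,
    Or.inl ⟨0, by simp, by simp [hc]⟩, ?_⟩
  exact (isPreconnected_Ico.image c hcc.continuousOn).union (c s) (mem_image_of_mem c hs) hsN
    hNc.isPreconnected

namespace LogData

variable {U : Set ℂ} (d : LogData U)

theorem image_φ_eq {W : Set ℂ} (hW : W ⊆ Metric.ball 0 1) : d.φ '' W = U ∩ d.h ⁻¹' W := by
  ext x
  constructor
  · rintro ⟨z, hz, rfl⟩
    exact ⟨d.mapsTo_φ (hW hz), by rw [mem_preimage, d.h_φ z (hW hz)]; exact hz⟩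
  · rintro ⟨hx, hz⟩
    exact ⟨d.h x, hz, d.φ_h x hx⟩

theorem isOpen_image_φ {W : Set ℂ} (hW : W ⊆ Metric.ball 0 1) (hWo : IsOpen W) :
    IsOpen (d.φ '' W) := by
  rw [d.image_φ_eq hW]
  exact d.continuousOn_h.isOpen_inter_preimage d.isOpen hWo

theorem notMem_of_mem_frontier {U : Set ℂ} (d : LogData U) {x : ℂ} (hx : x ∈ frontier U) :
    x ∉ U := by
  rw [d.isOpen.frontier_eq] at hx
  exact hx.2

variable {d} in
theorem IsArc.subset {ξ : ℂ} {r : ℝ} {g : ℝ → ℂ} (h : d.IsArc ξ r g) : g '' Ioo 0 1 ⊆ U := by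
  rw [h.image]
  rintro _ ⟨z, hz, rfl⟩
  exact d.mapsTo_φ hz.1

theorem exists_mem_frontier {ξ : ℂ} (hξ : ‖ξ‖ = 1) {η : ℝ} (hη : 0 < η) (S : Finset ℂ)
    (hS : ∀ s ∈ S, s ∉ U) :
    ∃ b ∈ frontier U, b ∉ S ∧ b ∈ closure (d.φ '' (Metric.ball 0 1 ∩ Metric.ball ξ η)) := by
  obtain ⟨r, hr, -, g, hg, h0, -⟩ := d.exists_arc hξ S hS 0 one_pos hη
  refine ⟨g 0, hg.left, h0, ?_⟩
  have h1 : g 0 ∈ closure (g '' Ioo 0 1) := by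
    refine (hg.continuousOn.mono ?_).image_closure (mem_image_of_mem g ?_)
    · rw [closure_Ioo (by norm_num)]
    · rw [closure_Ioo (by norm_num)]; simp
  refine closure_mono ?_ h1
  rw [hg.image]
  exact image_mono (inter_subset_inter_right _ fun z hz => by
    rw [mem_sphere_iff_norm] at hz; rw [mem_ball_iff_norm, hz]; exact hr.2)

variable {d} in
theorem IsArc.isCrossCut {ξ : ℂ} (hξ : ‖ξ‖ = 1) {r : ℝ} {g : ℝ → ℂ} (h : d.IsArc ξ r g)
    (hr : 0 < r) (hr1 : r < 1) :
    IsCrossCut U (g '' Ioo 0 1) ∧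
      IsCompOf (U \ g '' Ioo 0 1) (d.φ '' (Metric.ball 0 1 ∩ Metric.ball ξ r)) := by
  have s1 : Metric.ball (0 : ℂ) 1 ∩ Metric.ball ξ r ⊆ Metric.ball 0 1 := inter_subset_left
  have s2 : Metric.ball (0 : ℂ) 1 \ Metric.closedBall ξ r ⊆ Metric.ball 0 1 := sdiff_subset
  have s3 : Metric.ball (0 : ℂ) 1 ∩ Metric.sphere ξ r ⊆ Metric.ball 0 1 := inter_subset_left
  have o1 := d.isOpen_image_φ s1 (Metric.isOpen_ball.inter Metric.isOpen_ball)
  have o2 := d.isOpen_image_φ s2 (Metric.isOpen_ball.sdiff Metric.isClosed_closedBall)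
  have c1 : IsConnected (Metric.ball (0 : ℂ) 1 ∩ Metric.ball ξ r) := by
    refine ((convex_ball _ _).inter (convex_ball _ _)).isConnected
      ⟨((1 - r / 2 : ℝ) : ℂ) * ξ, ?_, ?_⟩
    · rw [mem_ball_zero_iff, norm_mul, hξ, Complex.norm_real, Real.norm_eq_abs,
        abs_of_pos (by linarith)]; linarith
    · rw [mem_ball_iff_norm, show ((1 - r / 2 : ℝ) : ℂ) * ξ - ξ = ((-(r / 2) : ℝ) : ℂ) * ξ by
        push_cast; ring, norm_mul, hξ, Complex.norm_real, Real.norm_eq_abs, abs_neg,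
        abs_of_pos (by linarith)]; linarith
  have two : HasTwoComps (U \ g '' Ioo 0 1) (d.φ '' (Metric.ball 0 1 ∩ Metric.ball ξ r))
      (d.φ '' (Metric.ball 0 1 \ Metric.closedBall ξ r)) := by
    refine hasTwoComps_of_isOpen o1 o2 (c1.image _ (d.continuousOn_φ.mono s1))
      ((isConnected_ball_sdiff_closedBall hξ hr1).image _ (d.continuousOn_φ.mono s2)) ?_ ?_
    · rw [d.image_φ_eq s1, d.image_φ_eq s2, disjoint_left]
      rintro x ⟨-, -, hx⟩ ⟨-, -, hx'⟩
      exact hx' (Metric.ball_subset_closedBall hx)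
    · rw [h.image, d.image_φ_eq s1, d.image_φ_eq s2, d.image_φ_eq s3]
      ext x
      constructor
      · rintro ⟨hx, hx'⟩
        rcases lt_trichotomy (dist (d.h x) ξ) r with h | h | h
        exacts [Or.inl ⟨hx, d.mapsTo_h hx, h⟩, absurd ⟨hx, d.mapsTo_h hx, h⟩ hx',
          Or.inr ⟨hx, d.mapsTo_h hx, fun h' => h.not_ge h'⟩]
      · rintro (⟨hx, -, h⟩ | ⟨hx, -, h⟩)
        exacts [⟨hx, fun h' => (Metric.mem_ball.1 h).ne h'.2.2⟩,
          ⟨hx, fun h' => h (Metric.sphere_subset_closedBall h'.2.2)⟩]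
  have hb : ∀ D : Set ℂ, IsOpen D → D ⊆ U → (∃ ξ' : ℂ, ∃ η : ℝ, ‖ξ'‖ = 1 ∧ 0 < η ∧
      d.φ '' (Metric.ball 0 1 ∩ Metric.ball ξ' η) ⊆ D) →
      (frontier D ∩ (frontier U \ g '' Icc 0 1)).Nonempty := by
    rintro D hDo hDU ⟨ξ', η, hξ', hη, hsub⟩
    have hl := d.notMem_of_mem_frontier h.left
    have hrt := d.notMem_of_mem_frontier h.right
    classical
    obtain ⟨b, hbU, hbS, hbc⟩ := d.exists_mem_frontier hξ' hη {g 0, g 1} (by simp [hl, hrt])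
    have hbn := d.notMem_of_mem_frontier hbU
    refine ⟨b, ?_, hbU, ?_⟩
    · rw [hDo.frontier_eq]
      exact ⟨closure_mono hsub hbc, fun hb => hbn (hDU hb)⟩
    · rintro ⟨t, ht, rfl⟩
      simp only [Finset.mem_insert, Finset.mem_singleton, not_or] at hbS
      rcases ht.1.eq_or_lt with h0 | h0
      · exact hbS.1 (by rw [← h0])
      rcases ht.2.eq_or_lt with h1 | h1
      · exact hbS.2 (by rw [h1])
      exact hbn (h.subset (mem_image_of_mem _ ⟨h0, h1⟩))
  have i1 : d.φ '' (Metric.ball 0 1 ∩ Metric.ball ξ r) ⊆ U := by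
    rw [d.image_φ_eq s1]; exact inter_subset_left
  have i2 : d.φ '' (Metric.ball 0 1 \ Metric.closedBall ξ r) ⊆ U := by
    rw [d.image_φ_eq s2]; exact inter_subset_left
  refine ⟨⟨g, h.continuousOn, h.injOn, fun t ht => h.subset (mem_image_of_mem _ ht), h.left,
    h.right, rfl, _, _, two, hb _ o1 i1 ⟨ξ, r, hξ, hr, subset_rfl⟩,
    hb _ o2 i2 ⟨-ξ, 2 - r, by rwa [norm_neg], by linarith, image_mono ?_⟩⟩, two.1⟩
  rintro z ⟨hz, hz2⟩
  refine ⟨hz, fun h => ?_⟩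
  rw [mem_ball_iff_norm] at hz2
  rw [mem_closedBall_iff_norm] at h
  have h3 : ‖(z - -ξ) - (z - ξ)‖ = 2 := by
    rw [show (z - -ξ) - (z - ξ) = 2 * ξ by ring, norm_mul, hξ]; simp
  linarith [norm_sub_le (z - -ξ) (z - ξ)]

theorem exists_isNullChain {ξ : ℂ} (hξ : ‖ξ‖ = 1) : ∃ (r : ℕ → ℝ) (γ : ℕ → Set ℂ),
    (∀ m, 0 < r m) ∧
      IsNullChain U (fun m => d.φ '' (Metric.ball 0 1 ∩ Metric.ball ξ (r m))) γ := by
  obtain ⟨a, ha, har⟩ := exists_seq_of_forall_finset_exists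
    (fun y : ℝ × (ℝ → ℂ) => 0 < y.1 ∧ y.1 < 1 ∧ d.IsArc ξ y.1 y.2)
    (fun x y => y.1 < x.1 / 2 ∧ (y.2 0 ≠ x.2 0 ∧ y.2 0 ≠ x.2 1 ∧ y.2 1 ≠ x.2 0 ∧ y.2 1 ≠ x.2 1) ∧
      ∀ p ∈ y.2 '' Ioo 0 1, ∀ q ∈ y.2 '' Ioo 0 1, ‖p‖ ≤ 1 / x.1 → ‖p - q‖ ≤ x.1) (by
    intro s hs
    classical
    obtain ⟨ρ, hρ, hρ0⟩ : ∃ ρ : ℝ, (∀ x ∈ s, ρ ≤ x.1) ∧ 0 < ρ := by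
      have h1 : ∀ᶠ ρ in 𝓝[>] (0 : ℝ), ∀ x ∈ s, ρ ≤ x.1 :=
        (eventually_all_finset s).2 fun x hx =>
          (eventually_le_nhds (hs x hx).1).filter_mono nhdsWithin_le_nhds
      exact (h1.and self_mem_nhdsWithin).exists
    obtain ⟨r, hr, hr1, g, hg, h0, h1, hsm⟩ := d.exists_arc hξ
      (s.biUnion fun x => {x.2 0, x.2 1}) (by
        intro z hz
        simp only [Finset.mem_biUnion, Finset.mem_insert, Finset.mem_singleton] at hz
        obtain ⟨x, hx, rfl | rfl⟩ := hz
        exacts [d.notMem_of_mem_frontier (hs x hx).2.2.left,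
          d.notMem_of_mem_frontier (hs x hx).2.2.right]) (1 / ρ) hρ0 (half_pos hρ0)
    simp only [Finset.mem_biUnion, Finset.mem_insert, Finset.mem_singleton, not_exists, not_and,
      not_or] at h0 h1
    refine ⟨(r, g), ⟨hr.1, hr1, hg⟩, fun x hx => ⟨?_, ⟨(h0 x hx).1, (h0 x hx).2, (h1 x hx).1,
      (h1 x hx).2⟩, fun p hp q hq hpx => ?_⟩⟩
    · have := hρ x hx
      have := hr.2
      simp only; linarith
    · exact (hsm p hp q hq (hpx.trans (one_div_le_one_div_of_le hρ0 (hρ x hx)))).trans (hρ x hx))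
  set r : ℕ → ℝ := fun m => (a m).1 with hr
  set g : ℕ → ℝ → ℂ := fun m => (a m).2 with hgdef
  have hr0 : ∀ m, 0 < r m := fun m => (ha m).1
  have hr1 : ∀ m, r m < 1 := fun m => (ha m).2.1
  have hg : ∀ m, d.IsArc ξ (r m) (g m) := fun m => (ha m).2.2
  have hanti : ∀ i j, i < j → r j < r i := fun i j hij => by
    have := (har i j hij).1
    have := hr0 i
    simp only [hr] at *; linarith
  have hlim : Tendsto r atTop (𝓝 0) := by
    have hle : ∀ m, r m ≤ (1 / 2) ^ m := by
      intro m
      induction m with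
      | zero => simpa using (hr1 0).le
      | succ m ih =>
        have := (har m (m + 1) (Nat.lt_succ_self m)).1
        rw [pow_succ]
        simp only [hr] at *; linarith
    exact squeeze_zero (fun m => (hr0 m).le) hle
      (tendsto_pow_atTop_nhds_zero_of_lt_one (by norm_num) (by norm_num))
  have hcut := fun m => (hg m).isCrossCut hξ (hr0 m) (hr1 m)
  have hcl : ∀ m, closure (bdIn U (d.φ '' (Metric.ball 0 1 ∩ Metric.ball ξ (r m)))) ⊆
      g m '' Icc 0 1 := fun m =>
    closure_minimal ((bdIn_subset (hcut m).2).trans (image_mono Ioo_subset_Icc_self))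
      (isCompact_Icc.image_of_continuousOn (hg m).continuousOn).isClosed
  have hIcc : ∀ m, ∀ x ∈ g m '' Icc 0 1, x = g m 0 ∨ x = g m 1 ∨ x ∈ g m '' Ioo 0 1 := by
    rintro m _ ⟨t, ht, rfl⟩
    rcases ht.1.eq_or_lt with h0 | h0
    · exact Or.inl (by rw [← h0])
    rcases ht.2.eq_or_lt with h1 | h1
    · exact Or.inr (Or.inl (by rw [h1]))
    exact Or.inr (Or.inr (mem_image_of_mem _ ⟨h0, h1⟩))
  have hdis : ∀ i j, i < j → ∀ x, x ∈ g i '' Icc 0 1 → x ∈ g j '' Icc 0 1 → False := by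
    intro i j hij x hx hx'
    have hne := (har i j hij).2.1
    have l := fun m => d.notMem_of_mem_frontier (hg m).left
    have l' := fun m => d.notMem_of_mem_frontier (hg m).right
    rcases hIcc i x hx with h | h | h <;> rcases hIcc j x hx' with h' | h' | h'
    · exact hne.1 (h'.symm.trans h)
    · exact hne.2.2.1 (h'.symm.trans h)
    · exact l i (h ▸ (hg j).subset h')
    · exact hne.2.1 (h'.symm.trans h)
    · exact hne.2.2.2 (h'.symm.trans h)
    · exact l' i (h ▸ (hg j).subset h')
    · exact l j (h' ▸ (hg i).subset h)
    · exact l' j (h' ▸ (hg i).subset h)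
    · rw [(hg i).image, d.image_φ_eq inter_subset_left] at h
      rw [(hg j).image, d.image_φ_eq inter_subset_left] at h'
      exact (hanti i j hij).ne (h'.2.2.symm.trans h.2.2)
  refine ⟨r, fun m => g m '' Ioo 0 1, hr0, ⟨⟨fun m => ⟨_, hcut m⟩, fun i j hij => ?_,
    fun i j hij => ?_⟩, fun m => (hcut m).2, fun m => (hg m).subset, fun m => ?_, ?_, ?_⟩⟩
  · refine image_mono (inter_subset_inter_right _ (Metric.ball_subset_ball ?_))
    rcases hij.eq_or_lt with rfl | h
    exacts [le_rfl, (hanti j i h).le]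
  · refine disjoint_iff_inter_eq_empty.1 (disjoint_left.2 fun x hx hx' => ?_)
    rcases lt_or_gt_of_ne hij with h | h
    exacts [hdis i j h x (hcl i hx) (hcl j hx'), hdis j i h x (hcl j hx') (hcl i hx)]
  · exact isPreconnected_Ioo.image _ ((hg m).continuousOn.mono Ioo_subset_Icc_self)
  · intro A A' hA hA' hAA'
    obtain ⟨δ, hδ, hδA⟩ := Metric.exists_pos_forall_lt_edist hA hA'.isClosed hAA'
    obtain ⟨M, hM⟩ := hA.isBounded.exists_norm_le
    have e1 : ∀ᶠ m in atTop, r m < 1 / max M 1 :=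
      hlim.eventually_lt_const (one_div_pos.2 (lt_max_of_lt_right one_pos))
    have e2 : ∀ᶠ m in atTop, r m < δ := hlim.eventually_lt_const (by exact_mod_cast hδ)
    obtain ⟨m, hm1, hm2⟩ := (e1.and e2).exists
    filter_upwards [eventually_gt_atTop m] with n hn
    by_contra hcon
    rw [not_or, not_disjoint_iff, not_disjoint_iff] at hcon
    obtain ⟨⟨p, hp, hpA⟩, q, hq, hqA⟩ := hcon
    have h1 := (har m n hn).2.2 p hp q hq ((hM p hpA).trans ((le_max_left M 1).trans
      ((le_one_div (lt_max_of_lt_right one_pos) (hr0 m)).2 hm1.le)))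
    have h2 := hδA p hpA q hqA
    rw [edist_nndist, ENNReal.coe_lt_coe, ← NNReal.coe_lt_coe, coe_nndist, dist_eq_norm] at h2
    linarith
  · intro x
    by_cases hx : x ∈ U
    · have hpos : 0 < ‖d.h x - ξ‖ := by
        rw [norm_pos_iff, sub_ne_zero]
        rintro h
        have := d.norm_h_lt hx
        rw [h, hξ] at this
        exact lt_irrefl _ this
      filter_upwards [hlim.eventually_lt_const hpos] with m hm
      rw [d.image_φ_eq inter_subset_left]
      rintro ⟨-, -, h⟩
      rw [mem_ball_iff_norm] at h
      linarith
    · refine Eventually.of_forall fun m h => hx ?_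
      rw [d.image_φ_eq inter_subset_left] at h
      exact h.1

end LogData

section Transport

variable {Y Z : Type*} [TopologicalSpace Y] [TopologicalSpace Z] (e : Y ≃ₜ Z)

theorem IsCompOf.image {A D : Set Y} (h : IsCompOf A D) : IsCompOf (e '' A) (e '' D) := by
  obtain ⟨x, hx, rfl⟩ := h
  exact ⟨e x, mem_image_of_mem e hx, e.image_connectedComponentIn hx⟩

theorem HasTwoComps.image {A D₁ D₂ : Set Y} (h : HasTwoComps A D₁ D₂) :
    HasTwoComps (e '' A) (e '' D₁) (e '' D₂) := by
  refine ⟨h.1.image e, h.2.1.image e, fun h' => h.2.2.1 (e.injective.image_injective h'), ?_⟩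
  rintro _ ⟨x, hx, rfl⟩
  rw [← e.image_connectedComponentIn hx]
  exact (h.2.2.2 x hx).imp (congrArg _) (congrArg _)

theorem IsCrossCut.image {U γ : Set Y} (h : IsCrossCut U γ) : IsCrossCut (e '' U) (e '' γ) := by
  obtain ⟨g, hg, hi, hU, h0, h1, rfl, D₁, D₂, h2, hb₁, hb₂⟩ := h
  have key : ∀ D : Set Y, (frontier D ∩ (frontier U \ g '' Icc 0 1)).Nonempty →
      (frontier (e '' D) ∩ (frontier (e '' U) \ (fun t => e (g t)) '' Icc 0 1)).Nonempty := by
    rintro D ⟨x, hx, hxU, hxg⟩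
    refine ⟨e x, ?_, ?_, ?_⟩
    · rw [← e.image_frontier]; exact mem_image_of_mem e hx
    · rw [← e.image_frontier]; exact mem_image_of_mem e hxU
    · rintro ⟨t, ht, hte⟩
      exact hxg ⟨t, ht, e.injective hte⟩
  refine ⟨fun t => e (g t), e.continuous.comp_continuousOn hg, fun s hs t ht hst =>
    hi hs ht (e.injective hst), fun t ht => mem_image_of_mem e (hU t ht), ?_, ?_, ?_,
    e '' D₁, e '' D₂, ?_, key _ hb₁, key _ hb₂⟩
  · rw [← e.image_frontier]; exact mem_image_of_mem e h0
  · rw [← e.image_frontier]; exact mem_image_of_mem e h1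
  · rw [image_image]
  · rw [← image_sdiff e.injective]; exact h2.image e

theorem IsCrossSection.image {U D : Set Y} (h : IsCrossSection U D) :
    IsCrossSection (e '' U) (e '' D) := by
  obtain ⟨γ, hγ, hD⟩ := h
  refine ⟨e '' γ, hγ.image e, ?_⟩
  rw [← image_sdiff e.injective]
  exact hD.image e

theorem image_bdIn (U D : Set Y) : bdIn (e '' U) (e '' D) = e '' bdIn U D := by
  rw [bdIn, bdIn, image_inter e.injective, image_sdiff e.injective, e.image_closure]

theorem IsPEChain.image {U : Set Y} {D : ℕ → Set Y} (h : IsPEChain U D) :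
    IsPEChain (e '' U) fun m => e '' D m := by
  refine ⟨fun i => (h.1 i).image e, fun i j hij => image_mono (h.2.1 i j hij), fun i j hij => ?_⟩
  rw [image_bdIn, image_bdIn, ← e.image_closure, ← e.image_closure, ← image_inter e.injective,
    h.2.2 i j hij, image_empty]

theorem IsNullChain.image {U : Set Y} {D γ : ℕ → Set Y} (h : IsNullChain U D γ) :
    IsNullChain (e '' U) (fun m => e '' D m) fun m => e '' γ m := by
  refine ⟨h.chain.image e, fun m => ?_, fun m => image_mono (h.subset m),
    fun m => (h.conn m).image e e.continuous.continuousOn, fun A A' hA hA' hAA' => ?_, fun x => ?_⟩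
  · rw [← image_sdiff e.injective]; exact (h.comp m).image e
  · have := h.small (e ⁻¹' A) (e ⁻¹' A') (e.isCompact_preimage.2 hA) (e.isCompact_preimage.2 hA')
      (hAA'.preimage e)
    filter_upwards [this] with m hm
    rw [disjoint_image_left, disjoint_image_left]
    exact hm
  · filter_upwards [h.empty (e.symm x)] with m hm
    rintro ⟨y, hy, rfl⟩
    exact hm (by simpa using hy)

theorem iterZ_conj (f : Y ≃ₜ Y) (k : ℤ) (A : Set Z) :
    iterZ ((e.symm.trans f).trans e) k A = e '' iterZ f k (e.symm '' A) := by
  have key : ∀ k : ℤ, ((e.symm.trans f).trans e).toEquiv ^ k =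
      (e.symm.toEquiv.trans (f.toEquiv ^ k)).trans e.toEquiv := by
    intro k
    have := map_zpow e.toEquiv.permCongrHom f.toEquiv k
    exact this.symm
  rw [iterZ, key, iterZ, image_image, image_image]
  rfl

theorem BdNonwandering.conj {f : Y ≃ₜ Y} {U : Set Y} (h : BdNonwandering f U) :
    BdNonwandering ((e.symm.trans f).trans e) (e '' U) := by
  intro n hn
  obtain ⟨K, hK, hKU, hD⟩ := h n hn
  refine ⟨e '' K, hK.image e.continuous, image_mono hKU, fun D hDw => ?_⟩
  have hs : e.symm '' (e '' U) = U := by rw [image_image]; simp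
  have hW : IsWanderingSection f U n (e.symm '' D) := by
    refine ⟨by have := hDw.1.image e.symm; rwa [hs] at this, fun k hk => ?_⟩
    have h1 := hDw.2 k hk
    rw [iterZ_conj] at h1
    have h2 := congrArg (fun s => e.symm '' s) h1
    simpa only [image_inter e.symm.injective, image_image, e.symm_apply_apply, image_id',
      image_empty] using h2
  obtain ⟨⟨k, hk, hk'⟩, l, hl, hl'⟩ := hD _ hW
  refine ⟨⟨k, hk, ?_⟩, l, hl, ?_⟩
  · rw [iterZ_conj, ← image_inter e.injective]; exact hk'.image e
  · rw [iterZ_conj, ← image_inter e.injective]; exact hl'.image e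

end Transport

namespace LogData

variable {U : Set ℂ} (d : LogData U)

theorem exists_lt_norm_h {f : ℂ ≃ₜ ℂ} (hfU : f '' U = U) {s : ℝ} (hs : s < 1) :
    ∃ r < 1, ∀ x ∈ U, r < ‖d.h x‖ → s < ‖d.h (f x)‖ := by
  have hf : ∀ x ∈ U, f x ∈ U := fun x hx => hfU ▸ mem_image_of_mem f hx
  have hf' : ∀ x ∈ U, f.symm x ∈ U := fun x hx => by
    rw [← hfU] at hx
    obtain ⟨y, hy, rfl⟩ := hx
    simpa using hy
  have hsub : Metric.closedBall (0 : ℂ) (max s 0) ⊆ Metric.ball 0 1 :=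
    Metric.closedBall_subset_ball (max_lt hs one_pos)
  have hcont : ContinuousOn (fun z => ‖d.h (f.symm (d.φ z))‖)
      (Metric.closedBall (0 : ℂ) (max s 0)) :=
    (d.continuousOn_h.comp (f.symm.continuous.comp_continuousOn (d.continuousOn_φ.mono hsub))
      fun z hz => hf' _ (d.mapsTo_φ (hsub hz))).norm
  obtain ⟨z, hz, hmax⟩ := (isCompact_closedBall (0 : ℂ) (max s 0)).exists_isMaxOn
    ⟨0, by simp⟩ hcont
  refine ⟨_, d.norm_h_lt (hf' _ (d.mapsTo_φ (hsub hz))), fun x hx hxr => ?_⟩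
  by_contra! hc
  have := hmax (mem_closedBall_zero_iff.2 (hc.trans (le_max_left s 0)))
  simp only [mem_ofPred_eq, d.φ_h _ (hf x hx), f.symm_apply_apply] at this
  exact absurd hxr this.not_gt

theorem exists_unit_sep {f : ℂ ≃ₜ ℂ} (hfU : f '' U = U)
    (hdisp : ∀ (r : ℕ → ℝ) (γ : ℕ → Set ℂ) (ξ : ℂ),
      IsNullChain U (fun m => d.φ '' (Metric.ball 0 1 ∩ Metric.ball ξ (r m))) γ →
      ∃ m, Disjoint (f '' (d.φ '' (Metric.ball 0 1 ∩ Metric.ball ξ (r m))))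
        (d.φ '' (Metric.ball 0 1 ∩ Metric.ball ξ (r m)))) :
    ∃ δ > 0, ∃ r₀ < 1, ∀ x ∈ U, r₀ < ‖d.h x‖ → d.h x ≠ 0 ∧ d.h (f x) ≠ 0 ∧
      δ ≤ ‖d.h (f x) / ‖d.h (f x)‖ - d.h x / ‖d.h x‖‖ := by
  have hf : ∀ x ∈ U, f x ∈ U := fun x hx => hfU ▸ mem_image_of_mem f hx
  have h1 : ∀ ξ : ℂ, ∃ r > 0, ‖ξ‖ = 1 → ∀ x ∈ U, ‖d.h x - ξ‖ < r → r ≤ ‖d.h (f x) - ξ‖ := by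
    intro ξ
    by_cases hξ : ‖ξ‖ = 1
    · obtain ⟨r, γ, hr, hn⟩ := d.exists_isNullChain hξ
      obtain ⟨m, hm⟩ := hdisp r γ ξ hn
      refine ⟨r m, hr m, fun _ x hx hxr => ?_⟩
      by_contra! hc
      refine disjoint_left.1 hm ⟨x, ?_, rfl⟩ ?_
      · rw [d.image_φ_eq inter_subset_left]
        exact ⟨hx, d.mapsTo_h hx, mem_ball_iff_norm.2 hxr⟩
      · rw [d.image_φ_eq inter_subset_left]
        exact ⟨hf x hx, d.mapsTo_h (hf x hx), mem_ball_iff_norm.2 hc⟩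
    · exact ⟨1, one_pos, fun h => absurd h hξ⟩
  choose r hr hrd using h1
  obtain ⟨t, ht, htc⟩ := (isCompact_sphere (0 : ℂ) 1).elim_nhds_subcover
    (fun ξ => Metric.ball ξ (r ξ / 2)) fun ξ hξ => Metric.ball_mem_nhds ξ (half_pos (hr ξ))
  obtain ⟨ρ, ⟨hρ, hρ1⟩, hρ0⟩ : ∃ ρ : ℝ, ((∀ ξ ∈ t, ρ ≤ r ξ / 2) ∧ ρ ≤ 1) ∧ 0 < ρ := by
    have h1 : ∀ᶠ ρ in 𝓝[>] (0 : ℝ), (∀ ξ ∈ t, ρ ≤ r ξ / 2) ∧ ρ ≤ 1 :=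
      ((eventually_all_finset t).2 fun x hx =>
        (eventually_le_nhds (half_pos (hr x))).filter_mono nhdsWithin_le_nhds).and
        ((eventually_le_nhds one_pos).filter_mono nhdsWithin_le_nhds)
    exact (h1.and self_mem_nhdsWithin).exists
  obtain ⟨r₁, hr₁, hr₁K⟩ := d.exists_lt_norm_h hfU (by linarith : 1 - ρ / 2 < 1)
  refine ⟨ρ / 2, half_pos hρ0, max r₁ (1 - ρ), max_lt hr₁ (by linarith), fun x hx hxr => ?_⟩
  have hx1 : 1 - ρ < ‖d.h x‖ := (le_max_right _ _).trans_lt hxr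
  have hfx1 : 1 - ρ / 2 < ‖d.h (f x)‖ := hr₁K x hx ((le_max_left _ _).trans_lt hxr)
  have n0 : 0 < ‖d.h x‖ := by linarith
  have n0' : 0 < ‖d.h (f x)‖ := by linarith
  refine ⟨norm_pos_iff.1 n0, norm_pos_iff.1 n0', ?_⟩
  have hun : ∀ z : ℂ, 0 < ‖z‖ → ‖z‖ < 1 → ‖z / ‖z‖‖ = 1 ∧ ‖z - z / ‖z‖‖ = 1 - ‖z‖ := by
    intro z hz hz1
    have hc : (‖z‖ : ℂ) ≠ 0 := by exact_mod_cast hz.ne'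
    have e1 : ‖z / ‖z‖‖ = 1 := by
      rw [norm_div, Complex.norm_real, norm_norm, div_self hz.ne']
    refine ⟨e1, ?_⟩
    have : z - z / ‖z‖ = ((‖z‖ - 1 : ℝ) : ℂ) * (z / ‖z‖) := by
      push_cast; field_simp
    rw [this, norm_mul, e1, Complex.norm_real, Real.norm_eq_abs, abs_of_neg (by linarith)]
    ring
  obtain ⟨u1, u2⟩ := hun _ n0 (d.norm_h_lt hx)
  obtain ⟨-, v2⟩ := hun _ n0' (d.norm_h_lt (hf x hx))
  obtain ⟨ξ, hξt, hξ⟩ := mem_iUnion₂.1 (htc (mem_sphere_zero_iff_norm.2 u1))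
  rw [mem_ball_iff_norm] at hξ
  have hξ1 : ‖ξ‖ = 1 := mem_sphere_zero_iff_norm.1 (ht ξ hξt)
  have a1 : ‖d.h x - ξ‖ < r ξ := by
    calc ‖d.h x - ξ‖ ≤ ‖d.h x - d.h x / ‖d.h x‖‖ + ‖d.h x / ‖d.h x‖ - ξ‖ :=
          norm_sub_le_norm_sub_add_norm_sub _ _ _
      _ < r ξ := by linarith [hρ ξ hξt]
  have a2 := hrd ξ hξ1 x hx a1
  have a3 := norm_sub_le_norm_sub_add_norm_sub (d.h (f x)) (d.h (f x) / ‖d.h (f x)‖) ξ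
  have a4 := norm_sub_le_norm_sub_add_norm_sub (d.h (f x) / ‖d.h (f x)‖) (d.h x / ‖d.h x‖) ξ
  linarith [hρ ξ hξt]

end LogData

section Lift

theorem exists_int_of_exp_eq_of_continuous {f g : ℂ → ℂ} (hf : Continuous f) (hg : Continuous g)
    (h : ∀ x, Complex.exp (f x) = Complex.exp (g x)) :
    ∃ n : ℤ, ∀ x, f x = g x + n * (2 * Real.pi * Complex.I) := by
  obtain ⟨n, hn⟩ := exists_int_of_exp_eq isPreconnected_univ hf.continuousOn hg.continuousOn
    fun x _ => h x
  exact ⟨n, fun x => hn x (mem_univ x)⟩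

theorem exists_continuous_lift {f : ℂ ≃ₜ ℂ} (h0 : f 0 = 0) :
    ∃ F : ℂ → ℂ, Continuous F ∧ ∀ y, Complex.exp (F y) = f (Complex.exp y) := by
  obtain ⟨F, hF, h⟩ := exists_continuousOn_log_of_convex (convex_univ (𝕜 := ℝ) (E := ℂ)) isOpen_univ
    univ_nonempty (g := fun y => f (Complex.exp y))
    (f.continuous.comp Complex.continuous_exp).continuousOn fun y _ hy =>
      Complex.exp_ne_zero y (f.injective (hy.trans h0.symm))
  exact ⟨F, continuousOn_univ.1 hF, fun y => h y (mem_univ y)⟩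

/-- A homeomorphism of the plane fixing `0` lifts along the exponential map. -/
theorem exists_lift {f : ℂ ≃ₜ ℂ} (h0 : f 0 = 0) :
    ∃ F : ℂ ≃ₜ ℂ, ∀ y, Complex.exp (F y) = f (Complex.exp y) := by
  obtain ⟨F, hF, hFe⟩ := exists_continuous_lift h0
  obtain ⟨G, hG, hGe⟩ := exists_continuous_lift (f := f.symm) (by rw [f.symm_apply_eq, h0])
  obtain ⟨n, hn⟩ := exists_int_of_exp_eq_of_continuous (hG.comp hF) continuous_id fun y => by
    simp [hGe, hFe]
  obtain ⟨m, hm⟩ := exists_int_of_exp_eq_of_continuous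
    (f := fun y => F (G y - n * (2 * Real.pi * Complex.I)))
    (hF.comp (hG.sub continuous_const)) continuous_id fun y => by
      have : Complex.exp (G y - n * (2 * Real.pi * Complex.I)) = Complex.exp (G y) :=
        (Complex.exp_eq_exp_iff_exists_int).2 ⟨-n, by push_cast; ring⟩
      simp [hGe, hFe, this]
  simp only [Function.comp_apply, id] at hn hm
  have hm0 : (m : ℂ) * (2 * Real.pi * Complex.I) = 0 := by
    have := hm (F 0)
    rw [hn 0] at this
    simpa using this
  exact ⟨{ toFun := F
           invFun := fun y => G y - n * (2 * Real.pi * Complex.I)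
           left_inv := fun y => by simp [hn]
           right_inv := fun y => by simp only [hm, hm0, add_zero]
           continuous_toFun := hF
           continuous_invFun := hG.sub continuous_const }, hFe⟩

theorem exists_log_div {f : ℂ ≃ₜ ℂ} {H : unitInterval × ℂ → ℂ} (hH : Continuous H)
    (hH0 : ∀ x, H (0, x) = x) (hH1 : ∀ x, H (1, x) = f x)
    (hHi : ∀ t, Function.Injective fun x => H (t, x)) (h0 : f 0 = 0) {F : ℂ ≃ₜ ℂ}
    (hF : ∀ y, Complex.exp (F y) = f (Complex.exp y)) (k : ℂ) :
    ∃ ℓ : {y : ℂ // y ≠ k} → ℂ, Continuous ℓ ∧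
      ∀ y, Complex.exp (ℓ y) = (F y - F k) / (y - k) := by
  have hcur : ∀ z, Continuous fun t => H (t, z) := fun z => by fun_prop
  obtain ⟨l, hl, hle, hl0⟩ := exists_homotopy_log (Y := {z : ℂ // z ≠ 0})
    (g := fun p => (H (p.1, p.2) - H (p.1, 0)) / p.2) (f₀ := fun _ => 0)
    (Continuous.div (by fun_prop) (by fun_prop) fun p => p.2.2)
    (fun p => div_ne_zero (sub_ne_zero.2 fun h => p.2.2 (hHi p.1 h)) p.2.2) continuous_const
    (fun y => by simp [hH0, y.2])
  set E : ℂ → {z : ℂ // z ≠ 0} := fun y => ⟨Complex.exp y, Complex.exp_ne_zero y⟩ with hE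
  have hEc : Continuous E := Complex.continuous_exp.subtype_mk _
  set ft : unitInterval × ℂ → ℂ := fun p => p.2 + l (p.1, E p.2) with hft
  have hftc : Continuous ft :=
    continuous_snd.add (hl.comp (continuous_fst.prodMk (hEc.comp continuous_snd)))
  have hexp : ∀ t y, Complex.exp (ft (t, y)) = H (t, Complex.exp y) - H (t, 0) := by
    intro t y
    simp only [hft, Complex.exp_add, hle, hE]
    rw [mul_div_cancel₀ _ (Complex.exp_ne_zero y)]
  have hinj : ∀ t y y', ft (t, y) = ft (t, y') → y = y' := by
    intro t y y' h
    have h1 := hexp t y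
    rw [h, hexp] at h1
    have h2 : Complex.exp y' = Complex.exp y := hHi t (sub_left_injective h1)
    have h3 : E y = E y' := Subtype.ext h2.symm
    simp only [hft, h3] at h
    exact add_right_cancel h
  have hft0 : ∀ y, ft (0, y) = y := fun y => by simp [hft, hl0]
  obtain ⟨n, hn⟩ := exists_int_of_exp_eq_of_continuous (f := F) (g := fun y => ft (1, y))
    F.continuous (by fun_prop) fun y => by rw [hF, hexp, hH1, hH1, h0, sub_zero]
  obtain ⟨ℓ, hℓ, hℓe, -⟩ := exists_homotopy_log (Y := {y : ℂ // y ≠ k})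
    (g := fun p => (ft (p.1, p.2) - ft (p.1, k)) / (p.2 - k)) (f₀ := fun _ => 0)
    (Continuous.div (by fun_prop) (by fun_prop) fun p => sub_ne_zero.2 p.2.2)
    (fun p => div_ne_zero (sub_ne_zero.2 fun h => p.2.2 (hinj _ _ _ h)) (sub_ne_zero.2 p.2.2))
    continuous_const
    (fun y => by simp [hft0, sub_ne_zero.2 y.2])
  refine ⟨fun y => ℓ (1, y), by fun_prop, fun y => ?_⟩
  rw [hℓe, hn, hn k]
  simp

end Lift

namespace LogData

variable {U : Set ℂ} (d : LogData U)

theorem isPreconnected {U : Set ℂ} (d : LogData U) : IsPreconnected U := by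
  have : U = d.φ '' Metric.ball 0 1 := by
    rw [d.image_φ_eq subset_rfl]
    exact (inter_eq_left.2 fun x hx => d.mapsTo_h hx).symm
  rw [this]
  exact (convex_ball _ _).isPreconnected.image _ d.continuousOn_φ

theorem exists_lift {f : ℂ ≃ₜ ℂ} (hfU : f '' U = U) (h0 : f 0 = 0) :
    ∃ F : ℂ ≃ₜ ℂ, (∀ y, Complex.exp (F y) = f (Complex.exp y)) ∧
      ∀ x ∈ U, F (d.L x) = d.L (f x) := by
  have hf : MapsTo f U U := fun x hx => hfU ▸ mem_image_of_mem f hx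
  obtain ⟨F, hF⟩ := _root_.exists_lift h0
  obtain ⟨n, hn⟩ := exists_int_of_exp_eq d.isPreconnected
    (f := fun x => d.L (f x)) (g := fun x => F (d.L x))
    (d.continuousOn_L.comp f.continuous.continuousOn hf)
    (F.continuous.comp_continuousOn d.continuousOn_L) fun x hx => by
      rw [d.exp_L _ (hf hx), hF, d.exp_L x hx]
  refine ⟨F.trans (Homeomorph.addRight (n * (2 * Real.pi * Complex.I))), fun y => ?_,
    fun x hx => ?_⟩
  · rw [← hF]
    exact (Complex.exp_eq_exp_iff_exists_int).2 ⟨n, rfl⟩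
  · exact (hn x hx).symm

theorem isPreconnected_collar {r : ℝ} (hr : 0 ≤ r) : IsPreconnected {x ∈ U | r < ‖d.h x‖} := by
  have e1 : {x ∈ U | r < ‖d.h x‖} = d.φ '' (Metric.ball 0 1 ∩ {z | r < ‖z‖}) := by
    rw [d.image_φ_eq inter_subset_left]
    ext x
    exact ⟨fun h => ⟨h.1, d.mapsTo_h h.1, h.2⟩, fun h => ⟨h.1, h.2.2⟩⟩
  rw [e1]
  refine IsPreconnected.image ?_ _ (d.continuousOn_φ.mono inter_subset_left)
  by_cases hr1 : r < 1
  swap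
  · convert isPreconnected_empty
    ext z
    simp only [mem_inter_iff, mem_ball_zero_iff, mem_ofPred_eq, mem_empty_iff_false, iff_false]
    rintro ⟨h1, h2⟩; linarith
  have e2 : Metric.ball (0 : ℂ) 1 ∩ {z | r < ‖z‖} =
      Complex.exp '' {w : ℂ | w.re < 0 ∧ r < Real.exp w.re} := by
    ext z
    constructor
    · rintro ⟨h1, h2⟩
      rw [mem_ball_zero_iff] at h1
      have hz : z ≠ 0 := norm_pos_iff.1 (hr.trans_lt h2)
      refine ⟨Complex.log z, ⟨?_, ?_⟩, Complex.exp_log hz⟩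
      · rw [Complex.log_re]; exact Real.log_neg (norm_pos_iff.2 hz) h1
      · rw [Complex.log_re, Real.exp_log (norm_pos_iff.2 hz)]; exact h2
    · rintro ⟨w, ⟨h1, h2⟩, rfl⟩
      exact ⟨exp_mem_ball h1, by rw [mem_ofPred_eq, Complex.norm_exp]; exact h2⟩
  rw [e2]
  refine IsPreconnected.image ?_ _ Complex.continuous_exp.continuousOn
  have e3 : {w : ℂ | w.re < 0 ∧ r < Real.exp w.re} =
      Complex.reLm ⁻¹' {s : ℝ | s < 0 ∧ r < Real.exp s} := rfl
  rw [e3]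
  refine (Convex.is_linear_preimage ?_ Complex.reLm.isLinear).isPreconnected
  refine OrdConnected.convex ⟨fun a ha b hb c hc => ⟨hc.2.trans_lt hb.1,
    ha.2.trans_le (Real.exp_le_exp.2 hc.1)⟩⟩

end LogData

namespace LogData

variable {U : Set ℂ} (d : LogData U)

theorem exists_log_on_sdiff {F : ℂ ≃ₜ ℂ} {ℓ : {y : ℂ // y ≠ d.k} → ℂ} (hℓ : Continuous ℓ)
    (hℓe : ∀ y, Complex.exp (ℓ y) = (F y - F d.k) / (y - d.k)) {ω : unitInterval → ℂ}
    (hω : Continuous ω) (hω0 : ω 0 = F d.k) (hω1 : ω 1 = d.k) :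
    ∃ Λ : ℂ → ℂ, ContinuousOn Λ {y | y ≠ d.k ∧ F y ∉ range ω} ∧
      ∀ y, y ≠ d.k → F y ∉ range ω → Complex.exp (Λ y) = (F y - d.k) / (y - d.k) := by
  classical
  have hne : ∀ y, y ≠ d.k → F y - F d.k ≠ 0 := fun y hy =>
    sub_ne_zero.2 fun h => hy (F.injective h)
  obtain ⟨m, hm, hme, -⟩ := exists_homotopy_log (Y := {y : ℂ // y ≠ d.k ∧ F y ∉ range ω})
    (g := fun p => (F p.2 - ω p.1) / (F p.2 - F d.k)) (f₀ := fun _ => 0)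
    (Continuous.div (by fun_prop) (by fun_prop) fun p => hne _ p.2.2.1)
    (fun p => div_ne_zero (sub_ne_zero.2 fun h => p.2.2.2 ⟨_, h.symm⟩) (hne _ p.2.2.1))
    continuous_const (fun y => by simp [hω0, hne _ y.2.1])
  refine ⟨fun y => if h : y ≠ d.k ∧ F y ∉ range ω then m (1, ⟨y, h⟩) + ℓ ⟨y, h.1⟩ else 0, ?_, ?_⟩
  · rw [continuousOn_iff_continuous_domRestrict]
    have : Continuous fun y : {y : ℂ // y ≠ d.k ∧ F y ∉ range ω} => m (1, y) + ℓ ⟨y, y.2.1⟩ :=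
      Continuous.add (by fun_prop) (hℓ.comp (continuous_subtype_val.subtype_mk _))
    refine this.congr fun y => ?_
    have hy : (y : ℂ) ≠ d.k ∧ F y ∉ range ω := y.2
    simp only [Set.domRestrict_apply, dif_pos hy]
  · intro y hy hy'
    have h : y ≠ d.k ∧ F y ∉ range ω := ⟨hy, hy'⟩
    simp only [dif_pos h, Complex.exp_add, hme, hℓe, hω1]
    rw [div_mul_div_cancel₀ (hne y hy)]

theorem exists_re_lift_gt {f F : ℂ ≃ₜ ℂ} (hF : ∀ y, Complex.exp (F y) = f (Complex.exp y))
    (M : ℝ) : ∃ ρ, ∀ y : ℂ, ρ < y.re → M < (F y).re := by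
  obtain ⟨B, hB⟩ := ((isCompact_closedBall (0 : ℂ) (Real.exp M)).image
    f.symm.continuous).isBounded.exists_norm_le
  refine ⟨Real.log (max B 1), fun y hy => ?_⟩
  by_contra! hc
  have h1 : Complex.exp y ∈ f.symm '' Metric.closedBall (0 : ℂ) (Real.exp M) :=
    ⟨f (Complex.exp y), by
      rw [← hF, mem_closedBall_zero_iff, Complex.norm_exp]; exact Real.exp_le_exp.2 hc, by simp⟩
  have h2 := (hB _ h1).trans (le_max_left B 1)
  rw [Complex.norm_exp, ← Real.le_log_iff_exp_le (lt_max_of_lt_right one_pos)] at h2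
  linarith

theorem exists_lt_norm_h_of_norm {r : ℝ} (hr : r < 1) : ∃ B, ∀ x ∈ U, B < ‖x‖ → r < ‖d.h x‖ := by
  have hsub : Metric.closedBall (0 : ℂ) r ⊆ Metric.ball 0 1 := Metric.closedBall_subset_ball hr
  obtain ⟨B, hB⟩ := ((isCompact_closedBall (0 : ℂ) r).image_of_continuousOn
    (d.continuousOn_φ.mono hsub)).isBounded.exists_norm_le
  refine ⟨B, fun x hx hxB => ?_⟩
  by_contra! hc
  have := hB x ⟨d.h x, mem_closedBall_zero_iff.2 hc, d.φ_h x hx⟩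
  linarith

theorem forall_mem_Ioo_of_isPreconnected {S : Set ℝ} (hS : IsPreconnected S) {δ : ℝ} (hδ : 0 < δ)
    (h : ∀ t ∈ S, δ ≤ ‖Complex.exp (Complex.I * t) - 1‖) :
    ∃ j : ℤ, ∀ t ∈ S, 2 * Real.pi * j + δ ≤ t ∧ t ≤ 2 * Real.pi * (j + 1) - δ := by
  have hfar : ∀ t ∈ S, ∀ n : ℤ, δ ≤ |t - 2 * Real.pi * n| := by
    intro t ht n
    have h1 : Complex.exp (Complex.I * t) =
        Complex.exp (Complex.I * ((t - 2 * Real.pi * n : ℝ) : ℂ)) :=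
      (Complex.exp_eq_exp_iff_exists_int).2 ⟨n, by push_cast; ring⟩
    have h2 := h t ht
    rw [h1] at h2
    exact h2.trans (Real.norm_exp_I_mul_ofReal_sub_one_le)
  rcases S.eq_empty_or_nonempty with rfl | ⟨s, hs⟩
  · exact ⟨0, by simp⟩
  have hpi := Real.two_pi_pos
  set j := ⌊s / (2 * Real.pi)⌋ with hj
  have hj1 : 2 * Real.pi * j ≤ s := by
    have := Int.floor_le (s / (2 * Real.pi))
    rw [← hj, le_div_iff₀ hpi] at this; linarith
  have hj2 : s < 2 * Real.pi * (j + 1) := by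
    have := Int.lt_floor_add_one (s / (2 * Real.pi))
    rw [← hj, div_lt_iff₀ hpi] at this; linarith
  refine ⟨j, fun t ht => ?_⟩
  have hnot : ∀ n : ℤ, 2 * Real.pi * n ∉ S := fun n hn => by
    have := hfar _ hn n
    rw [sub_self, abs_zero] at this; linarith
  have ht1 : 2 * Real.pi * j < t := by
    by_contra! hc
    exact hnot j (hS.ordConnected.out ht hs ⟨hc, hj1⟩)
  have ht2 : t < 2 * Real.pi * (j + 1) := by
    by_contra! hc
    have := hnot (j + 1)
    push_cast at this
    exact this (hS.ordConnected.out hs ht ⟨hj2.le, hc⟩)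
  have e1 := hfar t ht j
  have e2 := hfar t ht (j + 1)
  rw [abs_of_pos (by linarith)] at e1
  push_cast at e2
  rw [abs_of_neg (by linarith)] at e2
  constructor <;> linarith

theorem exists_twist {f F : ℂ ≃ₜ ℂ} (hfU : f '' U = U)
    (hF : ∀ y, Complex.exp (F y) = f (Complex.exp y)) (hFL : ∀ x ∈ U, F (d.L x) = d.L (f x))
    {ℓ : {y : ℂ // y ≠ d.k} → ℂ} (hℓ : Continuous ℓ)
    (hℓe : ∀ y, Complex.exp (ℓ y) = (F y - F d.k) / (y - d.k))
    (hsep : ∃ δ > 0, ∃ r₀ < 1, ∀ x ∈ U, r₀ < ‖d.h x‖ → d.h x ≠ 0 ∧ d.h (f x) ≠ 0 ∧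
      δ ≤ ‖d.h (f x) / ‖d.h (f x)‖ - d.h x / ‖d.h x‖‖) :
    ∃ ε > 0, ∃ R : ℝ, (∀ x ∈ U, R < ‖x‖ → d.θ x + ε ≤ d.θ (f x)) ∨
      ∀ x ∈ U, R < ‖x‖ → d.θ (f x) + ε ≤ d.θ x := by
  obtain ⟨δ, hδ, r₀, hr₀, hsep⟩ := hsep
  have hf : MapsTo f U U := fun x hx => hfU ▸ mem_image_of_mem f hx
  set z₀ := d.h (f (d.φ 0)) with hz₀
  have hz₀n : ‖z₀‖ < 1 := d.norm_h_lt (hf d.base_mem)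
  have hseg : ∀ t : unitInterval, ((1 - t : ℝ) : ℂ) * z₀ ∈ Metric.ball (0 : ℂ) 1 ∧
      ‖((1 - t : ℝ) : ℂ) * z₀‖ ≤ ‖z₀‖ := by
    intro t
    have h1 : ‖((1 - t : ℝ) : ℂ) * z₀‖ ≤ ‖z₀‖ := by
      rw [norm_mul, Complex.norm_real, Real.norm_eq_abs, abs_of_nonneg (by linarith [t.2.2])]
      exact mul_le_of_le_one_left (norm_nonneg _) (by linarith [t.2.1])
    exact ⟨mem_ball_zero_iff.2 (h1.trans_lt hz₀n), h1⟩
  set ω : unitInterval → ℂ := fun t => d.L (d.φ (((1 - t : ℝ) : ℂ) * z₀)) with hω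
  have hωc : Continuous ω := by
    refine (d.continuousOn_L.comp d.continuousOn_φ d.mapsTo_φ).comp_continuous ?_
      fun t => (hseg t).1
    fun_prop
  have hFk : F d.k = d.L (f (d.φ 0)) := hFL _ d.base_mem
  have hω0 : ω 0 = F d.k := by simp [hω, hFk, hz₀, d.φ_h _ (hf d.base_mem)]
  have hω1 : ω 1 = d.k := by simp [hω, k]
  obtain ⟨Λ, hΛ, hΛe⟩ := d.exists_log_on_sdiff hℓ hℓe hωc hω0 hω1
  obtain ⟨r₁, hr₁, hr₁'⟩ := d.exists_lt_norm_h hfU hz₀n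
  set r := max (max r₀ r₁) 0 with hr
  have hr0 : 0 ≤ r := le_max_right _ _
  have hrr₀ : r₀ ≤ r := (le_max_left _ _).trans (le_max_left _ _)
  have hrr₁ : r₁ ≤ r := (le_max_right _ _).trans (le_max_left _ _)
  have hr1 : r < 1 := max_lt (max_lt hr₀ hr₁) one_pos
  set V := {x ∈ U | r < ‖d.h x‖} with hV
  have hVS : MapsTo d.L V {y | y ≠ d.k ∧ F y ∉ range ω} := by
    rintro x ⟨hx, hxr⟩
    refine ⟨fun h => ?_, ?_⟩
    · have h1 := d.L_eq hx
      rw [h, sub_self, eq_comm, mul_eq_zero] at h1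
      have : d.h x = 0 := h1.resolve_right (Complex.exp_ne_zero _)
      rw [this, norm_zero] at hxr
      linarith
    · rintro ⟨t, ht⟩
      rw [hFL x hx] at ht
      have h1 := congrArg Complex.exp ht
      rw [d.exp_L _ (hf hx), hω, d.exp_L _ (d.mapsTo_φ (hseg t).1)] at h1
      have h2 := hr₁' x hx (hrr₁.trans_lt hxr)
      rw [← h1, d.h_φ _ (hseg t).1] at h2
      linarith [(hseg t).2]
  set T : ℂ → ℂ := fun x => Λ (d.L x) - d.lam (d.h (f x)) + d.lam (d.h x) with hT
  have hVU : V ⊆ U := fun x hx => hx.1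
  have hlam : ContinuousOn (fun x => d.lam (d.h x)) U :=
    d.differentiableOn_lam.continuousOn.comp d.continuousOn_h d.mapsTo_h
  have hTc : ContinuousOn T V :=
    ((hΛ.comp (d.continuousOn_L.mono hVU) hVS).sub
      ((hlam.comp f.continuous.continuousOn hf).mono hVU)).add (hlam.mono hVU)
  have hTe : ∀ x ∈ V, Complex.exp (T x) = d.h (f x) / d.h x := by
    intro x hx
    have h1 := hΛe _ (hVS hx).1 (hVS hx).2
    rw [hFL x hx.1, d.L_eq (hf hx.1), d.L_eq hx.1] at h1
    have h3 := (hsep x hx.1 (hrr₀.trans_lt hx.2)).1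
    simp only [hT]
    rw [Complex.exp_add, Complex.exp_sub, h1]
    field_simp
  obtain ⟨j, hj⟩ := forall_mem_Ioo_of_isPreconnected (S := (fun x => (T x).im) '' V)
    ((d.isPreconnected_collar hr0).image _ (Complex.continuous_im.comp_continuousOn hTc)) hδ (by
      rintro _ ⟨x, hx, rfl⟩
      obtain ⟨h1, h2, h3⟩ := hsep x hx.1 (hrr₀.trans_lt hx.2)
      refine h3.trans_eq ?_
      have n1 : (‖d.h x‖ : ℂ) ≠ 0 := by simpa using h1
      have n2 : (‖d.h (f x)‖ : ℂ) ≠ 0 := by simpa using h2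
      have e1 : Complex.exp (Complex.I * ((T x).im : ℂ)) =
          (d.h (f x) / ‖d.h (f x)‖) / (d.h x / ‖d.h x‖) := by
        have e2 : Complex.I * ((T x).im : ℂ) = T x - ((T x).re : ℂ) := by
          apply Complex.ext <;> simp
        have e3 : Complex.exp ((T x).re : ℂ) = ‖d.h (f x)‖ / ‖d.h x‖ := by
          rw [← Complex.ofReal_exp, ← Complex.norm_exp, hTe x hx, norm_div, Complex.ofReal_div]
        rw [e2, Complex.exp_sub, hTe x hx, e3]
        field_simp
      have e4 : d.h (f x) / ‖d.h (f x)‖ - d.h x / ‖d.h x‖ =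
          (Complex.exp (Complex.I * ((T x).im : ℂ)) - 1) * (d.h x / ‖d.h x‖) := by
        rw [e1]; field_simp
      rw [e4, norm_mul, norm_div (d.h x), Complex.norm_real, norm_norm,
        div_self (norm_ne_zero_iff.2 h1), mul_one])
  obtain ⟨Mω, hMω⟩ := (isCompact_range hωc).isBounded.exists_norm_le
  obtain ⟨ρ₁, hρ₁⟩ := exists_re_lift_gt hF (max Mω d.k.re)
  set ρ := max ρ₁ d.k.re with hρ
  have hP : ∀ y : ℂ, ρ < y.re → 0 < (F y - d.k).re ∧ 0 < (y - d.k).re ∧ F y ∉ range ω := by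
    intro y hy
    have h1 := hρ₁ y ((le_max_left _ _).trans_lt hy)
    refine ⟨?_, ?_, fun h => ?_⟩
    · rw [Complex.sub_re]; linarith [le_max_right Mω d.k.re]
    · rw [Complex.sub_re]; linarith [le_max_right ρ₁ d.k.re]
    · have := (Complex.re_le_norm _).trans (hMω _ h)
      linarith [le_max_left Mω d.k.re]
  have hne : ∀ z : ℂ, 0 < z.re → z ≠ 0 := by rintro z hz rfl; simp at hz
  obtain ⟨n, hn⟩ := exists_int_of_exp_eq (S := {y : ℂ | ρ < y.re})
    ((convex_halfSpace_re_gt ρ).isPreconnected) (f := Λ)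
    (g := fun y => Complex.log (F y - d.k) - Complex.log (y - d.k))
    (hΛ.mono fun y hy => ⟨sub_ne_zero.1 (hne _ (hP y hy).2.1), (hP y hy).2.2⟩)
    ((ContinuousOn.clog (by fun_prop) fun y hy => Or.inl (hP y hy).1).sub
      (ContinuousOn.clog (by fun_prop) fun y hy => Or.inl (hP y hy).2.1)) fun y hy => by
      have n1 := hne _ (hP y hy).1
      have n2 := hne _ (hP y hy).2.1
      rw [hΛe y (sub_ne_zero.1 n2) (hP y hy).2.2, Complex.exp_sub, Complex.exp_log n1,
        Complex.exp_log n2]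
  obtain ⟨B, hB⟩ := d.exists_lt_norm_h_of_norm hr1
  have key : ∀ x ∈ U, max B (Real.exp ρ) < ‖x‖ →
      2 * Real.pi * (j - n : ℤ) + δ ≤ d.θ (f x) - d.θ x ∧
        d.θ (f x) - d.θ x ≤ 2 * Real.pi * (j - n + 1 : ℤ) - δ := by
    intro x hx hxR
    have hxV : x ∈ V := ⟨hx, hB x hx ((le_max_left _ _).trans_lt hxR)⟩
    have hre : ρ < (d.L x).re := by
      have h1 := (le_max_right B (Real.exp ρ)).trans_lt hxR
      rwa [← d.exp_L x hx, Complex.norm_exp, Real.exp_lt_exp] at h1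
    have e := hn _ hre
    have hθ : d.θ (f x) - d.θ x = (T x).im - 2 * Real.pi * n := by
      simp only [hT, e, θ, wOf, hFL x hx]
      simp
      ring
    have := hj _ (mem_image_of_mem _ hxV)
    rw [hθ]
    push_cast
    constructor <;> linarith [this.1, this.2]
  have hpi := Real.two_pi_pos
  refine ⟨δ, hδ, max B (Real.exp ρ), ?_⟩
  rcases le_or_gt 0 (j - n) with h | h
  · refine Or.inl fun x hx hxR => ?_
    have h1 : (0 : ℝ) ≤ ((j - n : ℤ) : ℝ) := by exact_mod_cast h
    have := (key x hx hxR).1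
    nlinarith
  · refine Or.inr fun x hx hxR => ?_
    have h1 : ((j - n + 1 : ℤ) : ℝ) ≤ 0 := by exact_mod_cast h
    have := (key x hx hxR).2
    nlinarith

end LogData

section Wandering

variable {Y : Type*} [TopologicalSpace Y]

theorem IsPreconnected.inter_closure_sdiff_nonempty {S D : Set Y} (hS : IsPreconnected S)
    (hD : IsOpen D) (h : (S ∩ D).Nonempty) (hn : ¬S ⊆ D) : (S ∩ (closure D \ D)).Nonempty := by
  by_contra! hc
  obtain ⟨x, hx, hxD⟩ := not_subset.1 hn
  have hout : ∀ y ∈ S, y ∉ D → y ∈ (closure D)ᶜ := fun y hy hyD hyc =>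
    (hc.subset ⟨hy, hyc, hyD⟩ : y ∈ (∅ : Set Y))
  obtain ⟨y, -, hy1, hy2⟩ := hS D (closure D)ᶜ hD isClosed_closure.isOpen_compl
    (fun y hy => (em (y ∈ D)).imp_right (hout y hy)) h ⟨x, hx, hout x hx hxD⟩
  exact hy2 (subset_closure hy1)

theorem closure_connectedComponentIn_inter_subset {S : Set Y} {a : Y} :
    closure (connectedComponentIn S a) ∩ S ⊆ connectedComponentIn S a := by
  by_cases ha : a ∈ S
  · have h : IsPreconnected (closure (connectedComponentIn S a) ∩ S) :=
      isPreconnected_connectedComponentIn.subset_closure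
        (subset_inter subset_closure (connectedComponentIn_subset S a)) inter_subset_left
    exact h.subset_connectedComponentIn ⟨subset_closure (mem_connectedComponentIn ha), ha⟩
      inter_subset_right
  · simp [connectedComponentIn_eq_empty ha]

/-- If the component of `a` off `C₁ ∪ C₂` does not accumulate at `C₁`, then the component of `a` off
`C₂` has its relative closure inside the component of `a` off `C₁`. -/
theorem closure_connectedComponentIn_sdiff_subset {U C₁ C₂ : Set Y} {a : Y} (ha : a ∈ U)
    (ha1 : a ∉ C₁) (ha2 : a ∉ C₂)
    (ho : IsOpen (connectedComponentIn (U \ (C₁ ∪ C₂)) a))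
    (h : ∀ x ∈ closure (connectedComponentIn (U \ (C₁ ∪ C₂)) a), x ∉ C₁) :
    closure (connectedComponentIn (U \ C₂) a) ∩ U ⊆ connectedComponentIn (U \ C₁) a := by
  have ha12 : a ∈ U \ (C₁ ∪ C₂) := ⟨ha, fun h => h.elim ha1 ha2⟩
  have hsub : connectedComponentIn (U \ C₂) a ⊆ connectedComponentIn (U \ (C₁ ∪ C₂)) a := by
    by_contra hn
    have hpre : IsPreconnected (connectedComponentIn (U \ C₂) a) :=
      isPreconnected_connectedComponentIn
    obtain ⟨x, hx, hxc, hxn⟩ := hpre.inter_closure_sdiff_nonempty ho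
      ⟨a, mem_connectedComponentIn ⟨ha, ha2⟩, mem_connectedComponentIn ha12⟩ hn
    have hxU := connectedComponentIn_subset _ _ hx
    exact hxn (closure_connectedComponentIn_inter_subset
      ⟨hxc, hxU.1, fun h' => h'.elim (h x hxc) hxU.2⟩)
  rintro x ⟨hxc, hxU⟩
  have hx := closure_mono hsub hxc
  have hmono : connectedComponentIn (U \ (C₁ ∪ C₂)) a ⊆ connectedComponentIn (U \ C₁) a :=
    connectedComponentIn_mono _ (sdiff_subset_sdiff_right subset_union_left)
  exact closure_connectedComponentIn_inter_subset ⟨closure_mono hmono hx, hxU, h x hx⟩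

theorem exists_wandering_point (g : Y ≃ₜ Y) {A : Set Y} (hA : MapsTo g A A) {a : Y} (ha : a ∈ A) :
    ∃ p ∈ A, ∀ E e : Set Y, IsOpen E → E ⊆ connectedComponentIn A a → closure E ∩ A ⊆ E ∪ e →
      Disjoint e (g '' A) → p ∉ E → ∀ k : ℕ, 1 ≤ k → Disjoint (g^[k] '' E) E := by
  classical
  set C := connectedComponentIn A a with hC
  have hCA : C ⊆ A := connectedComponentIn_subset _ _
  have haC : a ∈ C := mem_connectedComponentIn ha
  have hAk : ∀ k, MapsTo g^[k] A A := fun k => hA.iterate k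
  by_cases hM : ∃ k, 1 ≤ k ∧ (g^[k] '' C ∩ C).Nonempty
  swap
  · refine ⟨a, ha, fun E e _ hEC _ _ _ k hk => ?_⟩
    rw [Set.disjoint_iff_inter_eq_empty]
    by_contra hne
    exact hM ⟨k, hk, (nonempty_iff_ne_empty.2 hne).mono
      (inter_subset_inter (image_mono hEC) hEC)⟩
  set m := Nat.find hM with hm
  obtain ⟨hm1, hmC⟩ := Nat.find_spec hM
  rw [← hm] at hm1 hmC
  have hmpre : IsPreconnected (g^[m] '' C) :=
    isPreconnected_connectedComponentIn.image _ (g.continuous.iterate m).continuousOn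
  have hmA : g^[m] '' C ⊆ A := ((hAk m).mono_left hCA).image_subset
  have hmsub : g^[m] '' C ⊆ C := by
    obtain ⟨x, hx, hxC⟩ := hmC
    have := hmpre.subset_connectedComponentIn hx hmA
    rwa [← connectedComponentIn_eq hxC] at this
  have hmq : ∀ q, MapsTo g^[m * q] C C := by
    intro q
    rw [Function.iterate_mul]
    exact (mapsTo_iff_image_subset.2 hmsub).iterate q
  have hkm : ∀ k, 1 ≤ k → (g^[k] '' C ∩ C).Nonempty → g^[k] '' C ⊆ g^[m] '' C := by
    rintro k hk ⟨_, ⟨x, hx, rfl⟩, hxC⟩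
    have hs : k % m = 0 := by
      by_contra hs
      refine Nat.find_min hM (Nat.mod_lt k hm1) ⟨Nat.one_le_iff_ne_zero.2 hs, g^[k] x, ?_, hxC⟩
      refine ⟨g^[m * (k / m)] x, hmq _ hx, ?_⟩
      rw [← Function.iterate_add_apply, Nat.mod_add_div]
    obtain ⟨q, rfl⟩ := Nat.dvd_of_mod_eq_zero hs
    obtain ⟨q, rfl⟩ : ∃ q', q = q' + 1 := ⟨q - 1, by
      have : q ≠ 0 := by rintro rfl; omega
      omega⟩
    rintro _ ⟨z, hz, rfl⟩
    refine ⟨g^[m * q] z, hmq _ hz, ?_⟩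
    rw [← Function.iterate_add_apply, mul_add, mul_one, add_comm]
  refine ⟨g^[m] a, hAk m ha, fun E e hEo hEC hEe he hp k hk => ?_⟩
  rw [Set.disjoint_iff_inter_eq_empty]
  by_contra hne
  obtain ⟨x, hx, hxE⟩ := nonempty_iff_ne_empty.2 hne
  have hxm : x ∈ g^[m] '' C := hkm k hk ⟨x, image_mono hEC hx, hEC hxE⟩ (image_mono hEC hx)
  obtain ⟨y, hy, hyc, hyE⟩ := hmpre.inter_closure_sdiff_nonempty hEo ⟨x, hxm, hxE⟩
    fun h => hp (h (mem_image_of_mem _ haC))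
  have hye : y ∈ e := (hEe ⟨hyc, hmA hy⟩).resolve_left hyE
  refine he.notMem_of_mem_left hye ?_
  obtain ⟨z, hz, rfl⟩ := hy
  obtain ⟨m', hm'⟩ : ∃ m', m = m' + 1 := ⟨m - 1, by omega⟩
  rw [hm', Function.iterate_succ_apply']
  exact mem_image_of_mem _ (hAk m' (hCA hz))

end Wandering

namespace LogData

variable {U : Set ℂ} (d : LogData U)

/-- A vertical segment in the logarithmic coordinate, starting at a point `L x₀` that is reached
from the base point inside the disc of radius `R`, leaves `L '' U`. -/
theorem exists_escape (hU : ¬Bornology.IsBounded U) {R : ℝ} (hR : ‖d.φ 0‖ < R) :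
    ∃ (P : Set ℂ) (x₀ : ℂ) (t₁ η : ℝ), IsPreconnected P ∧ P ⊆ U ∧ d.φ 0 ∈ P ∧ x₀ ∈ closure P ∧
      (∀ x ∈ P, ‖x‖ < R) ∧ x₀ ∈ U ∧ ‖x₀‖ = R ∧ 0 < t₁ ∧ 0 < η ∧
      (∀ t ∈ Ico 0 t₁, d.L x₀ + t * Complex.I ∈ d.L '' U) ∧
      d.L x₀ + t₁ * Complex.I ∉ d.L '' U ∧
      ∀ x ∈ P, d.L x ∉ Metric.closedBall (d.L x₀ + t₁ * Complex.I) η := by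
  obtain ⟨x, hx, hxR⟩ : ∃ x ∈ U, R < ‖x‖ := by
    by_contra! h
    exact hU (isBounded_iff_forall_norm_le.2 ⟨R, h⟩)
  set γ : ℝ → ℂ := fun t => d.φ (t * d.h x) with hγ
  have hball : ∀ t ∈ Icc (0 : ℝ) 1, (t : ℂ) * d.h x ∈ Metric.ball (0 : ℂ) 1 := by
    intro t ht
    rw [mem_ball_zero_iff, norm_mul, Complex.norm_real, Real.norm_eq_abs, abs_of_nonneg ht.1]
    exact (mul_le_of_le_one_left (norm_nonneg _) ht.2).trans_lt (d.norm_h_lt hx)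
  have hγc : ContinuousOn γ (Icc 0 1) := d.continuousOn_φ.comp (by fun_prop) hball
  have hγU : MapsTo γ (Icc 0 1) U := fun t ht => d.mapsTo_φ (hball t ht)
  have hγ0 : γ 0 = d.φ 0 := by simp [hγ]
  have hγ1 : γ 1 = x := by simp [hγ, d.φ_h x hx]
  have hScl : IsClosed (Icc (0 : ℝ) 1 ∩ (fun t => ‖γ t‖) ⁻¹' Ici R) :=
    hγc.norm.preimage_isClosed_of_isClosed isClosed_Icc isClosed_Ici
  obtain ⟨t₀, ht₀, ⟨-, ht₀S⟩, hfirst⟩ := IsCompact.exists_first_mem hScl (a := 0) (b := 1)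
    ⟨1, ⟨⟨by simp, by simpa [hγ1] using hxR.le⟩, by simp⟩⟩
  have ht₀S : R ≤ ‖γ t₀‖ := ht₀S
  have hlt : ∀ t ∈ Ico 0 t₀, ‖γ t‖ < R := by
    intro t ht
    by_contra! hc
    exact hfirst t ht ⟨⟨ht.1, ht.2.le.trans ht₀.2⟩, hc⟩
  have ht₀pos : 0 < t₀ := by
    refine ht₀.1.lt_of_ne fun h => ?_
    rw [← h, hγ0] at ht₀S
    linarith
  have hsub : Ico 0 t₀ ⊆ Icc (0 : ℝ) 1 := fun t ht => ⟨ht.1, ht.2.le.trans ht₀.2⟩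
  have hcl : γ t₀ ∈ closure (γ '' Ico 0 t₀) := by
    refine ((hγc t₀ ht₀).mono hsub).mem_closure_image ?_
    rw [closure_Ico ht₀pos.ne]
    exact right_mem_Icc.2 ht₀pos.le
  have hnorm : ‖γ t₀‖ = R := by
    refine le_antisymm ?_ ht₀S
    have : closure (γ '' Ico 0 t₀) ⊆ Metric.closedBall 0 R :=
      closure_minimal (by
        rintro _ ⟨t, ht, rfl⟩
        exact mem_closedBall_zero_iff.2 (hlt t ht).le) Metric.isClosed_closedBall
    exact mem_closedBall_zero_iff.1 (this hcl)
  set x₀ := γ t₀ with hx₀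
  have hx₀U : x₀ ∈ U := hγU ht₀
  have hTcl : IsClosed ((fun t : ℝ => d.L x₀ + t * Complex.I) ⁻¹' (d.L '' U)ᶜ) :=
    d.isOpen_image_L.isClosed_compl.preimage (by fun_prop)
  obtain ⟨t₁, ht₁, ht₁S, hfirst₁⟩ := IsCompact.exists_first_mem hTcl (a := 0) (b := 2 * Real.pi)
    ⟨2 * Real.pi, by
      intro hmem
      have h2 := (d.mem_image_L_iff.1 hmem).2
      have e : d.L x₀ + ((2 * Real.pi : ℝ) : ℂ) * Complex.I = d.L x₀ + 2 * Real.pi * Complex.I := by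
        push_cast; ring
      beta_reduce at h2
      rw [e, Complex.exp_periodic, d.exp_L _ hx₀U, left_eq_add] at h2
      simp [Real.pi_ne_zero] at h2, by simp [Real.pi_pos.le]⟩
  have hin : ∀ t ∈ Ico 0 t₁, d.L x₀ + t * Complex.I ∈ d.L '' U := fun t ht =>
    not_not.1 (hfirst₁ t ht)
  have ht₁pos : 0 < t₁ := by
    refine ht₁.1.lt_of_ne fun h => ?_
    rw [← h] at ht₁S
    exact ht₁S (by simpa using mem_image_of_mem d.L hx₀U)
  have hsub' : Icc 0 t₀ ⊆ Icc (0 : ℝ) 1 := Icc_subset_Icc_right ht₀.2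
  have hK : IsCompact (d.L '' (γ '' Icc 0 t₀)) :=
    (isCompact_Icc.image_of_continuousOn (hγc.mono hsub')).image_of_continuousOn
      (d.continuousOn_L.mono (hγU.mono_left hsub').image_subset)
  have hna : d.L x₀ + t₁ * Complex.I ∈ (d.L '' (γ '' Icc 0 t₀))ᶜ := fun h =>
    ht₁S (image_mono (hγU.mono_left hsub').image_subset h)
  obtain ⟨η, hη, hball'⟩ :=
    Metric.nhds_basis_closedBall.mem_iff.1 (hK.isClosed.isOpen_compl.mem_nhds hna)
  refine ⟨γ '' Ico 0 t₀, x₀, t₁, η, isPreconnected_Ico.image _ (hγc.mono hsub),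
    (hγU.mono_left hsub).image_subset, ⟨0, ⟨le_rfl, ht₀pos⟩, hγ0⟩, hcl, ?_, hx₀U, hnorm, ht₁pos, hη,
    hin, ht₁S, ?_⟩
  · rintro _ ⟨t, ht, rfl⟩
    exact hlt t ht
  · rintro _ ⟨t, ht, rfl⟩ hmem
    exact hball' hmem (mem_image_of_mem _ ⟨t, Ico_subset_Icc_self ht, rfl⟩)

end LogData

namespace LogData

variable {U : Set ℂ} (d : LogData U)

/-- A segment leaving `L '' U` crosses a small cross-cut arc whose logarithmic image stays near the
exit point. -/
theorem exists_arc_of_escape {y₀ : ℂ} {t₁ η : ℝ} (ht₁ : 0 < t₁) (hη : 0 < η)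
    (hin : ∀ t ∈ Ico 0 t₁, y₀ + t * Complex.I ∈ d.L '' U) (hout : y₀ + t₁ * Complex.I ∉ d.L '' U)
    {p : ℂ} (hp : p ∈ U) :
    ∃ (ξ : ℂ) (r : ℝ) (g : ℝ → ℂ) (t : ℝ), ‖ξ‖ = 1 ∧ 0 < r ∧ r < 1 ∧ d.IsArc ξ r g ∧ t ∈ Ico 0 t₁ ∧
      Complex.exp (y₀ + t * Complex.I) ∈ g '' Ioo 0 1 ∧
      (∀ x ∈ g '' Ioo 0 1, d.L x ∈ Metric.closedBall (y₀ + t₁ * Complex.I) η) ∧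
      p ∉ d.φ '' (Metric.ball 0 1 ∩ Metric.ball ξ r) := by
  set σ : ℝ → ℂ := fun t => Complex.exp (y₀ + t * Complex.I) with hσ
  have hσU : ∀ t ∈ Ico 0 t₁, σ t ∈ U := fun t ht => (d.mem_image_L_iff.1 (hin t ht)).1
  have hσL : ∀ t ∈ Ico 0 t₁, d.L (σ t) = y₀ + t * Complex.I := fun t ht =>
    (d.mem_image_L_iff.1 (hin t ht)).2
  have hσc : Continuous σ := by fun_prop
  have hHc : ContinuousOn (fun t => d.h (σ t)) (Ico 0 t₁) :=
    d.continuousOn_h.comp hσc.continuousOn hσU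
  obtain ⟨u, -, hu, hut⟩ := exists_seq_strictMono_tendsto' ht₁
  have hu' : ∀ n, u n ∈ Ico 0 t₁ := fun n => Ioo_subset_Ico_self (hu n)
  obtain ⟨ξ, hξ, ψ, hψ, hlim⟩ := (isCompact_closedBall (0 : ℂ) 1).tendsto_subseq
    (x := fun n => d.h (σ (u n)))
    fun n => mem_closedBall_zero_iff.2 (d.norm_h_lt (hσU _ (hu' n))).le
  have huψ : Tendsto (fun n => u (ψ n)) atTop (𝓝 t₁) := hut.comp hψ.tendsto_atTop
  have hξ1 : ‖ξ‖ = 1 := by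
    refine le_antisymm (mem_closedBall_zero_iff.1 hξ) (le_of_forall_lt fun s hs => ?_)
    obtain ⟨s', hs', hs1⟩ := exists_between hs
    have hg : Tendsto (fun n => y₀ + (u (ψ n) : ℂ) * Complex.I) atTop (𝓝 (y₀ + t₁ * Complex.I)) :=
      (((Complex.continuous_ofReal.tendsto _).comp huψ).mul_const _).const_add _
    have h1 := d.tendsto_norm_h hg hout (Eventually.of_forall fun n => hin _ (hu' _)) hs1
    exact hs'.trans_le (ge_of_tendsto hlim.norm (h1.mono fun n hn => hn.le))
  have hsep : ∀ x ∈ U, 0 < ‖d.h x - ξ‖ := fun x hx => by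
    rw [norm_pos_iff, sub_ne_zero]
    intro h
    have := d.norm_h_lt hx
    rw [h, hξ1] at this
    exact this.false
  set s := max 0 (t₁ - η / 4) with hs
  have hsI : s ∈ Ico 0 t₁ := ⟨le_max_left _ _, max_lt ht₁ (by linarith)⟩
  set M := Real.exp y₀.re with hM
  have hMpos : 0 < M := Real.exp_pos _
  have hσM : ∀ t, ‖σ t‖ = M := fun t => by simp [hσ, hM, Complex.norm_exp]
  set κ := min (1 / 2) (η / 4) with hκ
  have hκpos : 0 < κ := by positivity
  obtain ⟨r, ⟨hr0, hrη⟩, hr1, g, hg, -, -, hgδ⟩ := d.exists_arc hξ1 ∅ (by simp) M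
    (mul_pos hMpos hκpos) (lt_min (hsep _ (hσU s hsI)) (hsep p hp))
  obtain ⟨n, hn1, hn2⟩ := ((hlim.eventually (Metric.ball_mem_nhds ξ hr0)).and
    (huψ.eventually (lt_mem_nhds hsI.2))).exists
  have hn1 : ‖d.h (σ (u (ψ n))) - ξ‖ < r := mem_ball_iff_norm.1 hn1
  have hsub : Icc s (u (ψ n)) ⊆ Ico 0 t₁ := fun t ht =>
    ⟨hsI.1.trans ht.1, ht.2.trans_lt (hu' _).2⟩
  obtain ⟨t, ht, htr⟩ := intermediate_value_Icc' hn2.le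
    ((hHc.mono hsub).sub continuousOn_const).norm
    ⟨hn1.le, (hrη.trans_le (min_le_left _ _)).le⟩
  have htI := hsub ht
  have hte : σ t ∈ g '' Ioo 0 1 := by
    rw [hg.image, d.image_φ_eq inter_subset_left]
    exact ⟨hσU t htI, d.mapsTo_h (hσU t htI), mem_sphere_iff_norm.2 htr⟩
  refine ⟨ξ, r, g, t, hξ1, hr0, hr1, hg, htI, hte, fun x hx => ?_, ?_⟩
  · have hσ0 : σ t ≠ 0 := Complex.exp_ne_zero _
    have hw : ∀ z ∈ g '' Ioo 0 1, ‖z / σ t - 1‖ ≤ κ := by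
      intro z hz
      have h1 := hgδ _ hte z hz (hσM t).le
      rw [div_sub_one hσ0, norm_div, hσM, norm_sub_rev, div_le_iff₀ hMpos, mul_comm]
      exact h1
    have hκ1 : κ ≤ 1 / 2 := min_le_left _ _
    have hκ2 : κ ≤ η / 4 := min_le_right _ _
    have hgp : IsPreconnected (g '' Ioo 0 1) :=
      isPreconnected_Ioo.image _ (hg.continuousOn.mono Ioo_subset_Icc_self)
    have hch := log_change_eq hgp (f := fun z => d.L z - d.L (σ t))
      (g := fun z => Complex.log (z / σ t))
      ((d.continuousOn_L.mono hg.subset).sub continuousOn_const)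
      (ContinuousOn.clog (by fun_prop) fun z hz => by
        have h1 := Complex.mem_slitPlane_of_norm_lt_one (z := z / σ t - 1)
          ((hw z hz).trans_lt (by linarith))
        rwa [add_sub_cancel] at h1)
      (fun z hz => by
        have hz0 : z / σ t ≠ 0 := by
          rintro h0
          have := hw z hz
          rw [h0] at this
          norm_num at this
          linarith
        rw [Complex.exp_log hz0, Complex.exp_sub, d.exp_L _ (hg.subset hz),
          d.exp_L _ (hσU t htI)]) hte hx
    simp only [sub_self, sub_zero, div_self hσ0, Complex.log_one] at hch
    have h2 := Complex.norm_log_one_add_half_le_self ((hw x hx).trans hκ1)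
    rw [add_sub_cancel, ← hch] at h2
    have h3 : ‖d.L (σ t) - (y₀ + t₁ * Complex.I)‖ ≤ η / 4 := by
      have e : d.L (σ t) - (y₀ + t₁ * Complex.I) = ((t - t₁ : ℝ) : ℂ) * Complex.I := by
        rw [hσL t htI]; push_cast; ring
      rw [e, norm_mul, Complex.norm_I, mul_one, Complex.norm_real, Real.norm_eq_abs, abs_le]
      have := (le_max_right 0 (t₁ - η / 4)).trans ht.1
      constructor <;> linarith [htI.2]
    rw [mem_closedBall_iff_norm]
    have e : d.L x - (y₀ + t₁ * Complex.I) =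
        (d.L x - d.L (σ t)) + (d.L (σ t) - (y₀ + t₁ * Complex.I)) := by ring
    rw [e]
    refine (norm_add_le _ _).trans ?_
    linarith [hw x hx]
  · rw [d.image_φ_eq inter_subset_left]
    rintro ⟨-, -, h⟩
    rw [mem_ball_iff_norm] at h
    exact (h.trans (hrη.trans_le (min_le_right _ _))).false

end LogData

namespace LogData

variable {U : Set ℂ} (d : LogData U)

/-- A homeomorphism with large twist near infinity moves the component `B` of the base point off a
barrier `c` into or out of itself. -/
theorem exists_nested {R₁ R₂ : ℝ} (hR : d.SmallVariation R₁) (hR₁₂ : R₁ ≤ R₂) {g G : ℂ ≃ₜ ℂ}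
    (hgU : g '' U = U) (hG : ∀ y, Complex.exp (G y) = g (Complex.exp y))
    (hGL : ∀ x ∈ U, G (d.L x) = d.L (g x))
    {Q : Set ℂ} (hQ : IsPreconnected Q) (hQU : Q ⊆ U) (h0Q : d.φ 0 ∈ Q) (h1Q : g (d.φ 0) ∈ Q)
    (h2Q : g.symm (d.φ 0) ∈ Q) (hQn : ∀ x ∈ Q, ‖x‖ ≤ R₂ ∧ ‖g x‖ ≤ R₂ ∧ ‖g.symm x‖ ≤ R₂)
    (hnorm : ∀ x, R₂ < ‖x‖ → R₁ < ‖g x‖)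
    (htw1 : ∀ x ∈ U, R₂ < ‖x‖ → d.θ x + 60 ≤ d.θ (g x))
    (htw2 : ∀ x ∈ U, R₂ < ‖x‖ → d.θ (g.symm x) + 60 ≤ d.θ x)
    {c : Set ℂ} (hc : IsPathConnected c) (hcc : IsClosed c) (hcR : ∀ y ∈ c, Real.log R₂ < y.re)
    (hcfar : ∃ ρ, ∀ y : ℂ, ρ < y.re → y ∈ c) {x₀ : ℂ} (hx₀ : x₀ ∈ U) (hx₀c : d.L x₀ ∈ c)
    (hx₀B : x₀ ∈ closure (connectedComponentIn {x ∈ U | d.L x ∉ c} (d.φ 0))) :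
    ∃ g' : ℂ ≃ₜ ℂ, (g' = g ∨ g' = g.symm) ∧
      closure (connectedComponentIn {x ∈ U | d.L x ∉ c} (d.φ 0)) ∩ U ⊆
        g' '' connectedComponentIn {x ∈ U | d.L x ∉ c} (d.φ 0) ∧
      ∀ x ∈ U, x ∈ closure (g' '' connectedComponentIn {x ∈ U | d.L x ∉ c} (d.φ 0)) →
        x ∉ g' '' connectedComponentIn {x ∈ U | d.L x ∉ c} (d.φ 0) →
        Real.pi < |d.θ x - d.θ x₀| := by
  have hpi := Real.pi_lt_d2
  have hgm : MapsTo g U U := mapsTo_iff_image_subset.2 hgU.subset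
  have hgsm : MapsTo g.symm U U := by
    intro x hx
    rw [← hgU] at hx
    obtain ⟨z, hz, rfl⟩ := hx
    simpa using hz
  have hR₁0 : 0 < R₁ := (norm_nonneg _).trans_lt hR.1
  have hR₂0 : 0 < R₂ := hR₁0.trans_le hR₁₂
  have hre : ∀ {R : ℝ} {x : ℂ}, 0 < R → x ∈ U → (Real.log R < (d.L x).re ↔ R < ‖x‖) := by
    intro R x hR hx
    conv_rhs => rw [← d.exp_L x hx, Complex.norm_exp]
    exact Real.log_lt_iff_lt_exp hR
  set C₁ := {x ∈ U | d.L x ∈ c} with hC₁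
  set C₂ := g '' C₁ with hC₂
  have hC₁n : ∀ x ∈ C₁, R₂ < ‖x‖ := fun x hx => (hre hR₂0 hx.1).1 (hcR _ hx.2)
  have e1 : {x ∈ U | d.L x ∉ c} = U \ C₁ := by
    ext x
    simp only [hC₁, mem_ofPred_eq, Set.mem_sdiff, not_and]
    exact ⟨fun h => ⟨h.1, fun _ => h.2⟩, fun h => ⟨h.1, h.2 h.1⟩⟩
  have hmem2 : ∀ x ∈ U, (d.L x ∈ G '' c ↔ x ∈ C₂) := by
    intro x hx
    have hz := hgsm hx
    have e : d.L x = G (d.L (g.symm x)) := by rw [hGL _ hz]; simp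
    rw [e, G.injective.mem_set_image]
    constructor
    · exact fun h => ⟨g.symm x, ⟨hz, h⟩, by simp⟩
    · rintro ⟨z, hz', rfl⟩
      simpa using hz'.2
  have e2 : {x ∈ U | d.L x ∉ c ∪ G '' c} = U \ (C₁ ∪ C₂) := by
    ext x
    simp only [mem_ofPred_eq, Set.mem_sdiff, mem_union]
    constructor
    · rintro ⟨hx, h⟩
      exact ⟨hx, fun h' => h (h'.imp (fun h => h.2) (hmem2 x hx).2)⟩
    · rintro ⟨hx, h⟩
      exact ⟨hx, fun h' => h (h'.imp (fun h => ⟨hx, h⟩) (hmem2 x hx).1)⟩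
  have hQ1 : ∀ x ∈ Q, x ∉ C₁ := fun x hx h => by
    have := hC₁n x h; linarith [(hQn x hx).1]
  have hQ2 : ∀ x ∈ Q, x ∉ C₂ := by
    rintro x hx ⟨z, hz, rfl⟩
    have := hC₁n z hz
    have h2 := (hQn _ hx).2.2
    rw [g.symm_apply_apply] at h2
    linarith
  have hQ1' : Q ⊆ U \ C₁ := fun x hx => ⟨hQU hx, hQ1 x hx⟩
  have hQ2' : Q ⊆ U \ C₂ := fun x hx => ⟨hQU hx, hQ2 x hx⟩
  rw [e1] at hx₀B ⊢
  set B := connectedComponentIn (U \ C₁) (d.φ 0) with hB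
  have hBU : B ⊆ U := (connectedComponentIn_subset _ _).trans sdiff_subset
  have hgB : g '' B = connectedComponentIn (U \ C₂) (d.φ 0) := by
    rw [hB, g.image_connectedComponentIn (hQ1' h0Q), image_sdiff g.injective, hgU]
    exact connectedComponentIn_eq (hQ.subset_connectedComponentIn h1Q hQ2' h0Q)
  have hgsB : ∀ S : Set ℂ, IsPreconnected S → S ⊆ U \ (C₁ ∪ C₂) → d.φ 0 ∈ S → g.symm '' S ⊆ B := by
    intro S hS hSU h0
    have h1 : g.symm (d.φ 0) ∈ B := hQ.subset_connectedComponentIn h0Q hQ1' h2Q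
    rw [hB, connectedComponentIn_eq h1]
    refine (hS.image _ g.symm.continuous.continuousOn).subset_connectedComponentIn
      (mem_image_of_mem _ h0) ?_
    rintro _ ⟨z, hz, rfl⟩
    refine ⟨hgsm (hSU hz).1, fun h => (hSU hz).2 (Or.inr ⟨_, h, by simp⟩)⟩
  set B' := connectedComponentIn (U \ (C₁ ∪ C₂)) (d.φ 0) with hB'
  have hB'B : B' ⊆ B := connectedComponentIn_mono _ (sdiff_subset_sdiff_right subset_union_left)
  have hB'pre : IsPreconnected B' := isPreconnected_connectedComponentIn
  have h0U' : d.φ 0 ∈ U \ (C₁ ∪ C₂) :=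
    ⟨d.base_mem, fun h => h.elim (hQ1 _ h0Q) (hQ2 _ h0Q)⟩
  have hgsB' : g.symm '' B' ⊆ B :=
    hgsB B' hB'pre (connectedComponentIn_subset _ _) (mem_connectedComponentIn h0U')
  have hc2c : IsClosed (c ∪ G '' c) := hcc.union (G.isClosed_image.2 hcc)
  have hB'o : IsOpen B' := by
    rw [hB', ← e2]
    refine IsOpen.connectedComponentIn ?_
    exact d.continuousOn_L.isOpen_inter_preimage d.isOpen hc2c.isOpen_compl
  -- contacts of `B` with the barrier have bounded argument
  have hwin : ∀ x ∈ closure B, x ∈ C₁ → |d.θ x - d.θ x₀| < 5 * Real.pi := by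
    intro x hx hx1
    exact d.window hR hc hcc (fun y hy => (Real.log_le_log hR₁0 hR₁₂).trans_lt (hcR y hy)) hx₀ hx1.1
      hx₀c hx1.2 (by rwa [e1]) (by rwa [e1])
  have hcl1 : ∀ x ∈ closure B, x ∈ U → x ∉ B → x ∈ C₁ := by
    intro x hx hxU hxB
    by_contra h
    exact hxB (closure_connectedComponentIn_inter_subset (S := U \ C₁) ⟨hx, hxU, h⟩)
  obtain ⟨ρ, hρ⟩ := hcfar
  have hc2 : IsPathConnected (c ∪ G '' c) := by
    refine hc.union (hc.image G.continuous) ?_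
    obtain ⟨ρ', hρ'⟩ := exists_re_lift_gt (f := g) (F := G) hG ρ
    set y : ℂ := ((max ρ ρ' + 1 : ℝ) : ℂ) with hy
    have hyre : y.re = max ρ ρ' + 1 := Complex.ofReal_re _
    refine ⟨G y, hρ _ (hρ' y ?_), mem_image_of_mem _ (hρ y ?_)⟩ <;> rw [hyre]
    · linarith [le_max_right ρ ρ']
    · linarith [le_max_left ρ ρ']
  have hc2R : ∀ y ∈ c ∪ G '' c, Real.log R₁ < y.re := by
    rintro y (hy | ⟨z, hz, rfl⟩)
    · exact (Real.log_le_log hR₁0 hR₁₂).trans_lt (hcR y hy)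
    · rw [Real.log_lt_iff_lt_exp hR₁0, ← Complex.norm_exp, hG]
      refine hnorm _ ?_
      rw [Complex.norm_exp, ← Real.log_lt_iff_lt_exp hR₂0]
      exact hcR z hz
  have hdich : (∀ x ∈ closure B', x ∉ C₁) ∨ ∀ x ∈ closure B', x ∉ C₂ := by
    by_contra! h
    obtain ⟨⟨x, hx, hx1⟩, x', hx', hx2⟩ := h
    have hx2U : x' ∈ U := by
      obtain ⟨z, hz, rfl⟩ := hx2
      exact hgm hz.1
    have w1 := d.window hR hc2 hc2c hc2R hx1.1 hx2U (Or.inl hx1.2)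
      (Or.inr ((hmem2 _ hx2U).2 hx2)) (by rwa [e2]) (by rwa [e2])
    have w2 := hwin x (closure_mono hB'B hx) hx1
    obtain ⟨z, hz, rfl⟩ := hx2
    have hzB : z ∈ closure B := by
      refine closure_mono hgsB' ?_
      rw [← g.symm.image_closure]
      exact ⟨_, hx', by simp⟩
    have w3 := hwin z hzB hz
    have := htw1 z hz.1 (hC₁n z hz)
    rw [abs_lt] at w1 w2 w3
    linarith [w1.2, w2.1, w2.2, w3.1]
  rcases hdich with h | h
  · refine ⟨g.symm, Or.inr rfl, ?_, ?_⟩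
    · have h1 := closure_connectedComponentIn_sdiff_subset d.base_mem (hQ1 _ h0Q) (hQ2 _ h0Q) hB'o h
      rw [← hgB, ← g.image_closure] at h1
      rintro x ⟨hx, hxU⟩
      exact ⟨g x, h1 ⟨mem_image_of_mem _ hx, hgm hxU⟩, by simp⟩
    · intro x hxU hx hxn
      rw [← g.symm.image_closure] at hx
      obtain ⟨z, hz, rfl⟩ := hx
      have hzB : z ∉ B := fun h => hxn (mem_image_of_mem _ h)
      have hzU : z ∈ U := by simpa using hgm hxU
      have hz1 := hcl1 z hz hzU hzB
      have w := abs_lt.1 (hwin z hz hz1)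
      have := htw2 z hzU (hC₁n z hz1)
      rw [abs_sub_comm]
      refine lt_of_lt_of_le ?_ (le_abs_self _)
      linarith [w.2]
  · refine ⟨g, Or.inl rfl, ?_, ?_⟩
    · rw [hB', union_comm] at hB'o h
      have h1 := closure_connectedComponentIn_sdiff_subset d.base_mem (hQ2 _ h0Q) (hQ1 _ h0Q) hB'o h
      rwa [← hgB] at h1
    · intro x hxU hx hxn
      rw [← g.image_closure] at hx
      obtain ⟨z, hz, rfl⟩ := hx
      have hzB : z ∉ B := fun h => hxn (mem_image_of_mem _ h)
      have hzU : z ∈ U := by simpa using hgsm hxU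
      have hz1 := hcl1 z hz hzU hzB
      have w := abs_lt.1 (hwin z hz hz1)
      have := htw1 z hzU (hC₁n z hz1)
      refine lt_of_lt_of_le ?_ (le_abs_self _)
      linarith [w.1]

end LogData

theorem exists_norm_lt_apply {E : Type*} [NormedAddCommGroup E] [ProperSpace E] (g : E ≃ₜ E)
    (M : ℝ) : ∃ B, ∀ x, B < ‖x‖ → M < ‖g x‖ := by
  obtain ⟨B, hB⟩ := ((isCompact_closedBall (0 : E) M).image
    g.symm.continuous).isBounded.exists_norm_le
  refine ⟨B, fun x hx => ?_⟩
  by_contra! hc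
  have := hB x ⟨g x, mem_closedBall_zero_iff.2 hc, by simp⟩
  linarith

namespace LogData

variable {U : Set ℂ} (d : LogData U)

/-- Every compact subset of `U` lies in a compact connected subset containing the base point. -/
theorem exists_isCompact_isPreconnected {K : Set ℂ} (hK : IsCompact K) (hKU : K ⊆ U) :
    ∃ Q ⊆ U, IsCompact Q ∧ IsPreconnected Q ∧ d.φ 0 ∈ Q ∧ K ⊆ Q := by
  obtain ⟨x, hx, hmax⟩ := (hK.insert (d.φ 0)).exists_isMaxOn (insert_nonempty _ _)
    (f := fun x => ‖d.h x‖)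
    (d.continuousOn_h.norm.mono (insert_subset d.base_mem hKU))
  have hxU : x ∈ U := insert_subset d.base_mem hKU hx
  have hsub : Metric.closedBall (0 : ℂ) ‖d.h x‖ ⊆ Metric.ball 0 1 :=
    Metric.closedBall_subset_ball (d.norm_h_lt hxU)
  have hc := d.continuousOn_φ.mono hsub
  refine ⟨d.φ '' Metric.closedBall 0 ‖d.h x‖, (d.mapsTo_φ.mono_left hsub).image_subset,
    (isCompact_closedBall _ _).image_of_continuousOn hc,
    (convex_closedBall _ _).isPreconnected.image _ hc, ⟨0, by simp, rfl⟩, fun y hy => ?_⟩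
  exact ⟨d.h y, mem_closedBall_zero_iff.2 (hmax (mem_insert_of_mem _ hy)), d.φ_h y (hKU hy)⟩

theorem exists_isCrossSection (hU : ¬Bornology.IsBounded U) {g G : ℂ ≃ₜ ℂ}
    (hgU : g '' U = U) (hG : ∀ y, Complex.exp (G y) = g (Complex.exp y))
    (hGL : ∀ x ∈ U, G (d.L x) = d.L (g x))
    (htw : ∃ R : ℝ, ∀ x ∈ U, R < ‖x‖ → d.θ x + 60 ≤ d.θ (g x))
    {K : Set ℂ} (hK : IsCompact K) (hKU : K ⊆ U) :
    ∃ (E : Set ℂ) (g' : ℂ ≃ₜ ℂ), (g' = g ∨ g' = g.symm) ∧ IsCrossSection U E ∧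
      ∀ k : ℕ, 1 ≤ k → Disjoint (g'^[k] '' E) E ∧ Disjoint (g'^[k] '' E) K := by
  have hgm : MapsTo g U U := mapsTo_iff_image_subset.2 hgU.subset
  have hgsm : MapsTo g.symm U U := by
    intro x hx
    rw [← hgU] at hx
    obtain ⟨z, hz, rfl⟩ := hx
    simpa using hz
  obtain ⟨R₁, hR₁⟩ := d.exists_smallVariation
  obtain ⟨R', htw⟩ := htw
  obtain ⟨Q, hQU, hQc, hQ, h0Q, hKQ⟩ := d.exists_isCompact_isPreconnected
    ((hK.insert (g.symm (d.φ 0))).insert (g (d.φ 0)))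
    (insert_subset (hgm d.base_mem) (insert_subset (hgsm d.base_mem) hKU))
  have h1Q := hKQ (mem_insert _ _)
  have h2Q := hKQ (mem_insert_of_mem _ (mem_insert _ _))
  have hKQ : K ⊆ Q := fun x hx => hKQ (mem_insert_of_mem _ (mem_insert_of_mem _ hx))
  obtain ⟨b₁, hb₁⟩ := hQc.isBounded.exists_norm_le
  obtain ⟨b₂, hb₂⟩ := (hQc.image g.continuous).isBounded.exists_norm_le
  obtain ⟨b₃, hb₃⟩ := (hQc.image g.symm.continuous).isBounded.exists_norm_le
  obtain ⟨b₄, hb₄⟩ := exists_norm_lt_apply g R₁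
  obtain ⟨b₅, hb₅⟩ := exists_norm_lt_apply g.symm R'
  obtain ⟨R₂, hR₂⟩ : ∃ R₂, ∀ b ∈ ({R₁, R', b₁, b₂, b₃, b₄, b₅} : Finset ℝ), b ≤ R₂ :=
    ({R₁, R', b₁, b₂, b₃, b₄, b₅} : Finset ℝ).exists_le
  simp only [Finset.mem_insert, Finset.mem_singleton, forall_eq_or_imp, forall_eq] at hR₂
  obtain ⟨hR₁₂, hR'₂, hb₁₂, hb₂₂, hb₃₂, hb₄₂, hb₅₂⟩ := hR₂
  have hR₁0 : 0 < R₁ := (norm_nonneg _).trans_lt hR₁.1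
  have hR₂0 : 0 < R₂ := hR₁0.trans_le hR₁₂
  have hre : ∀ {R : ℝ} {x : ℂ}, 0 < R → x ∈ U → (Real.log R < (d.L x).re ↔ R < ‖x‖) := by
    intro R x hR hx
    conv_rhs => rw [← d.exp_L x hx, Complex.norm_exp]
    exact Real.log_lt_iff_lt_exp hR
  obtain ⟨P, x₀, t₁, η, hP, hPU, h0P, hx₀P, hPR, hx₀, hx₀R, ht₁, hη, hin, hout, hPη⟩ :=
    d.exists_escape hU (R := R₂ + 1) (by linarith [hR₁.1])
  have hlog : Real.log R₂ < Real.log (R₂ + 1) := Real.log_lt_log hR₂0 (by linarith)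
  have hx₀re : (d.L x₀).re = Real.log (R₂ + 1) := by
    rw [← hx₀R]
    conv_rhs => rw [← d.exp_L x₀ hx₀, Complex.norm_exp, Real.log_exp]
  set a := d.L x₀ + t₁ * Complex.I with ha
  have hare : a.re = Real.log (R₂ + 1) := by simp [ha, hx₀re]
  set η₀ := min η ((Real.log (R₂ + 1) - Real.log R₂) / 2) with hη₀
  have hη₀pos : 0 < η₀ := lt_min hη (by linarith)
  set c := {y : ℂ | Real.log (R₂ + 1) ≤ y.re} ∪ Metric.closedBall a η₀ with hc
  have hcpath : IsPathConnected c := by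
    refine IsPathConnected.union ((convex_halfSpace_re_ge _).isPathConnected ⟨a, hare.ge⟩)
      ((convex_closedBall a η₀).isPathConnected ⟨a, Metric.mem_closedBall_self hη₀pos.le⟩)
      ⟨a, hare.ge, Metric.mem_closedBall_self hη₀pos.le⟩
  have hccl : IsClosed c :=
    (isClosed_le continuous_const Complex.continuous_re).union Metric.isClosed_closedBall
  have hcR : ∀ y ∈ c, Real.log R₂ < y.re := by
    rintro y (hy | hy)
    · exact hlog.trans_le hy
    · have h1 := (Complex.abs_re_le_norm (y - a)).trans (mem_closedBall_iff_norm.1 hy)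
      rw [Complex.sub_re, hare] at h1
      have h2 := (abs_le.1 h1).1
      have h3 : η₀ ≤ _ := min_le_right _ _
      linarith
  have hcn : ∀ x ∈ U, d.L x ∈ c → R₂ < ‖x‖ := fun x hx h => (hre hR₂0 hx).1 (hcR _ h)
  set B := connectedComponentIn {x ∈ U | d.L x ∉ c} (d.φ 0) with hB
  have hBsub : B ⊆ {x ∈ U | d.L x ∉ c} := connectedComponentIn_subset _ _
  have hBpre : IsPreconnected B := isPreconnected_connectedComponentIn
  have hBo : IsOpen B := IsOpen.connectedComponentIn
    (d.continuousOn_L.isOpen_inter_preimage d.isOpen hccl.isOpen_compl)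
  have hQB : Q ⊆ B := by
    refine hQ.subset_connectedComponentIn h0Q fun x hx => ⟨hQU hx, fun h => ?_⟩
    have := hcn x (hQU hx) h
    linarith [hb₁ x hx]
  have hPB : P ⊆ B := by
    refine hP.subset_connectedComponentIn h0P fun x hx => ⟨hPU hx, ?_⟩
    rintro (h | h)
    · have h1 : (d.L x).re < Real.log (R₂ + 1) := by
        rw [Real.lt_log_iff_exp_lt (by linarith), ← Complex.norm_exp, d.exp_L x (hPU hx)]
        exact hPR x hx
      exact absurd h (not_le.2 h1)
    · exact hPη x hx (Metric.closedBall_subset_closedBall (min_le_left _ _) h)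
  have hx₀B : x₀ ∈ closure B := closure_mono hPB hx₀P
  have hx₀c : d.L x₀ ∈ c := Or.inl hx₀re.ge
  obtain ⟨g', hg', hBg, hfar⟩ := d.exists_nested hR₁ hR₁₂ hgU hG hGL hQ hQU h0Q h1Q h2Q
    (fun x hx => ⟨(hb₁ x hx).trans hb₁₂, (hb₂ _ (mem_image_of_mem _ hx)).trans hb₂₂,
      (hb₃ _ (mem_image_of_mem _ hx)).trans hb₃₂⟩)
    (fun x hx => hb₄ x (hb₄₂.trans_lt hx)) (fun x hx hxR => htw x hx (hR'₂.trans_lt hxR))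
    (fun x hx hxR => by
      simpa using htw (g.symm x) (hgsm hx) (hb₅ x (hb₅₂.trans_lt hxR)))
    hcpath hccl hcR ⟨Real.log (R₂ + 1), fun y hy => Or.inl hy.le⟩ hx₀ hx₀c hx₀B
  rw [← hB] at hBg hfar
  have hg'm : MapsTo g' U U := by rcases hg' with rfl | rfl <;> assumption
  have hAm : MapsTo g' (U \ B) (U \ B) := by
    rintro x ⟨hx, hxB⟩
    refine ⟨hg'm hx, fun h => hxB ?_⟩
    exact (g'.injective.mem_set_image).1 (hBg ⟨subset_closure h, hg'm hx⟩)
  have hcA : ∀ x ∈ U, d.L x ∈ c → x ∈ U \ B := fun x hx hxc => ⟨hx, fun h => (hBsub h).2 hxc⟩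
  have hx₀A := hcA x₀ hx₀ hx₀c
  obtain ⟨p, hp, hwand⟩ := exists_wandering_point g' hAm hx₀A
  obtain ⟨ξ, r, γ, t, hξ, hr0, hr1, hγ, ht, hte, hec, hpE⟩ :=
    d.exists_arc_of_escape ht₁ hη₀pos hin hout hp.1
  obtain ⟨hcut, hcomp⟩ := hγ.isCrossCut hξ hr0 hr1
  set e := γ '' Ioo 0 1 with he
  set E := d.φ '' (Metric.ball 0 1 ∩ Metric.ball ξ r) with hE
  have heA : e ⊆ U \ B := fun x hx => hcA x (hγ.subset hx) (Or.inr (hec x hx))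
  have hEo : IsOpen E := d.isOpen_image_φ inter_subset_left (Metric.isOpen_ball.inter
    Metric.isOpen_ball)
  have hEU : E ⊆ U := by
    rintro _ ⟨z, hz, rfl⟩
    exact d.mapsTo_φ hz.1
  have hEcl : ∀ x ∈ U, x ∈ closure E → x ∉ E → x ∈ e := by
    intro x hx hxE hxn
    by_contra h
    exact hxn (hcomp.closure_inter_subset ⟨hxE, hx, h⟩)
  have h0E : d.φ 0 ∉ E := by
    rw [hE, d.image_φ_eq inter_subset_left]
    rintro ⟨-, -, h⟩
    rw [d.h_base, mem_ball_iff_norm, zero_sub, norm_neg, hξ] at h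
    linarith
  have hEA : E ⊆ U \ B := by
    refine fun x hx => ⟨hEU hx, fun hxB => ?_⟩
    obtain ⟨y, hy, hyc, hyn⟩ := hBpre.inter_closure_sdiff_nonempty hEo ⟨x, hxB, hx⟩
      fun h => h0E (h (hQB h0Q))
    exact (heA (hEcl y (hBsub hy).1 hyc hyn)).2 hy
  set σ : ℝ → ℂ := fun s => Complex.exp (d.L x₀ + s * Complex.I) with hσ
  have hIcc : Icc 0 t ⊆ Ico 0 t₁ := fun s hs => ⟨hs.1, hs.2.trans_lt ht.2⟩
  have hσY : ∀ y ∈ σ '' Icc 0 t, y ∈ U ∧ d.L y ∈ c := by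
    rintro _ ⟨s, hs, rfl⟩
    obtain ⟨h1, h2⟩ := d.mem_image_L_iff.1 (hin s (hIcc hs))
    refine ⟨h1, Or.inl ?_⟩
    simp only [hσ, h2]
    simp [hx₀re]
  have hσpre : IsPreconnected (σ '' Icc 0 t) :=
    isPreconnected_Icc.image _ (by fun_prop)
  have hσ0 : x₀ ∈ σ '' Icc 0 t := ⟨0, left_mem_Icc.2 ht.1, by simp [hσ, d.exp_L x₀ hx₀]⟩
  have hσt : σ t ∈ σ '' Icc 0 t := mem_image_of_mem _ (right_mem_Icc.2 ht.1)
  have hepre : IsPreconnected e :=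
    isPreconnected_Ioo.image _ (hγ.continuousOn.mono Ioo_subset_Icc_self)
  have hEepre : IsPreconnected (E ∪ e) := by
    rw [he, hγ.image, hE, ← image_union, ← inter_union_distrib_left, Metric.ball_union_sphere]
    exact ((convex_ball _ _).inter (convex_closedBall _ _)).isPreconnected.image _
      (d.continuousOn_φ.mono inter_subset_left)
  have hYpre : IsPreconnected (σ '' Icc 0 t ∪ e) := hσpre.union _ hσt hte hepre
  have hYc : ∀ y ∈ σ '' Icc 0 t ∪ e, y ∈ U ∧ d.L y ∈ c := by
    rintro y (hy | hy)
    · exact hσY y hy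
    · exact ⟨hγ.subset hy, Or.inr (hec y hy)⟩
  have hEC : E ⊆ connectedComponentIn (U \ B) x₀ := by
    refine subset_union_left.trans (subset_union_right.trans
      (IsPreconnected.subset_connectedComponentIn (hσpre.union _ hσt (Or.inr hte) hEepre)
        (Or.inl hσ0) ?_))
    rintro y (hy | hy | hy)
    · exact hcA y (hσY y hy).1 (hσY y hy).2
    · exact hEA hy
    · exact heA hy
  have heg : Disjoint e (g' '' (U \ B)) := by
    rw [Set.disjoint_left]
    rintro x hx ⟨z, hz, rfl⟩
    obtain ⟨y, hy, hyc, hyn⟩ := hYpre.inter_closure_sdiff_nonempty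
      (g'.isOpenMap _ hBo) ⟨x₀, Or.inl hσ0, hBg ⟨hx₀B, hx₀⟩⟩
      fun h => hz.2 ((g'.injective.mem_set_image).1 (h (Or.inr hx)))
    have h1 := hfar y (hYc y hy).1 hyc hyn
    have h2 := hR₁.2 _ (fun y hy => (hYc y hy).1) hYpre
      (fun y hy => hR₁₂.trans_lt (hcn y (hYc y hy).1 (hYc y hy).2)) y hy x₀ (Or.inl hσ0)
    linarith
  refine ⟨E, g', hg', ⟨e, hcut, hcomp⟩, fun k hk => ⟨hwand E e hEo hEC ?_ heg hpE k hk, ?_⟩⟩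
  · rintro x ⟨hxE, hxA⟩
    exact or_iff_not_imp_left.2 fun h => hEcl x hxA.1 hxE h
  · refine Set.disjoint_left.2 fun x hx hxK => ?_
    obtain ⟨z, hz, rfl⟩ := hx
    exact (hAm.iterate k (hEA hz)).2 (hQB (hKQ hxK))

end LogData

theorem Homeomorph.coe_pow_eq_iterate (f : X ≃ₜ X) (n : ℕ) : ⇑(f ^ n) = f^[n] := by
  induction n with
  | zero => rfl
  | succ n ih => rw [pow_succ, Function.iterate_succ, ← ih]; rfl

theorem Homeomorph.iterate_apply_iterate_symm (f : X ≃ₜ X) (n : ℕ) (x : X) :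
    f^[n] (f.symm^[n] x) = x :=
  Function.LeftInverse.iterate (fun y => f.apply_symm_apply y) n x

theorem iterZ_natCast_mul (f : X ≃ₜ X) (n k : ℕ) (A : Set X) :
    iterZ f ((n : ℤ) * k) A = (f ^ n)^[k] '' A := by
  have h : ⇑(f.toEquiv ^ (n * k)) = (f ^ n)^[k] := by
    rw [Homeomorph.coe_pow_eq_iterate, ← Function.iterate_mul, ← Equiv.Perm.iterate_eq_pow]
    rfl
  rw [iterZ, ← Nat.cast_mul, zpow_natCast, h]

theorem iterZ_natCast_mul_neg (f : X ≃ₜ X) (n k : ℕ) (A : Set X) :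
    iterZ f ((n : ℤ) * -k) A = (f ^ n).symm^[k] '' A := by
  have h : ⇑((f.toEquiv ^ (n * k))⁻¹) = (f ^ n).symm^[k] := by
    funext x
    rw [Equiv.Perm.inv_eq_iff_eq, ← Equiv.Perm.iterate_eq_pow, Function.iterate_mul]
    have := Homeomorph.iterate_apply_iterate_symm (f ^ n) k x
    rw [Homeomorph.coe_pow_eq_iterate f n] at this
    exact this.symm
  rw [iterZ, mul_neg, zpow_neg, ← Nat.cast_mul, zpow_natCast, h]

theorem iterZ_neg_inter_eq_empty {f : X ≃ₜ X} {j : ℤ} {A : Set X} (h : iterZ f j A ∩ A = ∅) :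
    iterZ f (-j) A ∩ A = ∅ := by
  rw [eq_empty_iff_forall_notMem] at h ⊢
  rintro y ⟨⟨a, ha, rfl⟩, hy⟩
  refine h a ⟨⟨_, hy, ?_⟩, ha⟩
  rw [zpow_neg]
  exact Equiv.apply_symm_apply (f.toEquiv ^ j) a

/-- A homeomorphism which is ∂-nonwandering has no cross-section whose images under the iterates
of `f ^ n`, in one time direction, avoid both the cross-section and the compact set `K`. -/
theorem BdNonwandering.exists_isCompact {f : X ≃ₜ X} {U : Set X} (h : BdNonwandering f U) {n : ℕ}
    (hn : 1 ≤ n) : ∃ K, IsCompact K ∧ K ⊆ U ∧ ∀ (g : X ≃ₜ X) (E : Set X),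
      (g = f ^ n ∨ g = (f ^ n).symm) → IsCrossSection U E →
      ¬ ∀ k : ℕ, 1 ≤ k → Disjoint (g^[k] '' E) E ∧ Disjoint (g^[k] '' E) K := by
  obtain ⟨K, hK, hKU, hw⟩ := h n hn
  refine ⟨K, hK, hKU, fun g E hg hE hd => ?_⟩
  rcases hg with rfl | rfl
  · have hW : ∀ k : ℕ, 1 ≤ k → iterZ f ((n : ℤ) * k) E ∩ E = ∅ := fun k hk => by
      rw [iterZ_natCast_mul]; exact (hd k hk).1.inter_eq
    obtain ⟨⟨k, hk, hne⟩, -⟩ := hw E ⟨hE, fun k hk => by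
      obtain ⟨m, rfl | rfl⟩ := k.eq_nat_or_neg
      · exact hW m (by omega)
      · rw [mul_neg]; exact iterZ_neg_inter_eq_empty (hW m (by omega))⟩
    lift k to ℕ using hk.le
    rw [iterZ_natCast_mul] at hne
    exact not_disjoint_iff_nonempty_inter.2 hne (hd k (by omega)).2
  · have hW : ∀ k : ℕ, 1 ≤ k → iterZ f ((n : ℤ) * -k) E ∩ E = ∅ := fun k hk => by
      rw [iterZ_natCast_mul_neg]; exact (hd k hk).1.inter_eq
    obtain ⟨-, ⟨k, hk, hne⟩⟩ := hw E ⟨hE, fun k hk => by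
      obtain ⟨m, rfl | rfl⟩ := k.eq_nat_or_neg
      · rw [← neg_neg ((n : ℤ) * m), ← mul_neg]
        exact iterZ_neg_inter_eq_empty (hW m (by omega))
      · exact hW m (by omega)⟩
    obtain ⟨m, rfl | rfl⟩ := k.eq_nat_or_neg
    · omega
    rw [iterZ_natCast_mul_neg] at hne
    exact not_disjoint_iff_nonempty_inter.2 hne (hd m (by omega)).2

theorem exists_iterate_twist {U : Set ℂ} {θ : ℂ → ℝ} {f : ℂ ≃ₜ ℂ} (hf : MapsTo f U U) {ε R : ℝ}
    (h : ∀ x ∈ U, R < ‖x‖ → θ x + ε ≤ θ (f x)) (n : ℕ) :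
    ∃ B, ∀ x ∈ U, B < ‖x‖ → θ x + n * ε ≤ θ (f^[n] x) := by
  induction n with
  | zero => exact ⟨0, fun x _ _ => by simp⟩
  | succ n ih =>
    obtain ⟨B, hB⟩ := ih
    obtain ⟨C, hC⟩ := exists_norm_lt_apply f B
    refine ⟨max R C, fun x hx hxn => ?_⟩
    have h1 := h x hx ((le_max_left _ _).trans_lt hxn)
    have h2 := hB (f x) (hf hx) (hC x ((le_max_right _ _).trans_lt hxn))
    rw [Function.iterate_succ_apply]
    push_cast
    linarith

theorem LogData.not_bdNonwandering {U : Set ℂ} (d : LogData U) (hU : ¬Bornology.IsBounded U)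
    {f : ℂ ≃ₜ ℂ} (hf0 : f 0 = 0) (hor : IsOrientationPreserving f) (hfU : f '' U = U)
    (hdisp : ∀ D γ, IsNullChain U D γ → ∃ m, Disjoint (f '' D m) (D m)) :
    ¬BdNonwandering f U := by
  intro hbnw
  have hf : MapsTo f U U := fun x hx => hfU ▸ mem_image_of_mem f hx
  obtain ⟨F, hF, hFL⟩ := d.exists_lift hfU hf0
  obtain ⟨H, hH, hH0, hH1, hHi⟩ := hor
  obtain ⟨ℓ, hℓ, hℓe⟩ := exists_log_div hH hH0 hH1 (fun t => (hHi t).injective) hf0 hF d.k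
  obtain ⟨ε, hε, R, htw⟩ := d.exists_twist hfU hF hFL hℓ hℓe
    (d.exists_unit_sep hfU fun r γ ξ h => hdisp _ γ h)
  obtain ⟨n, hn⟩ := exists_nat_gt (60 / ε)
  have hn60 : 60 < n * ε := (div_lt_iff₀ hε).1 hn
  have hn1 : 1 ≤ n := by
    rcases Nat.eq_zero_or_pos n with rfl | h
    · norm_num at hn60
    · exact h
  obtain ⟨K, hK, hKU, hno⟩ := hbnw.exists_isCompact hn1
  have hfn : MapsTo (f ^ n : ℂ ≃ₜ ℂ) U U := by
    rw [Homeomorph.coe_pow_eq_iterate]; exact hf.iterate n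
  have hnU : (f ^ n : ℂ ≃ₜ ℂ) '' U = U := by
    rw [Homeomorph.coe_pow_eq_iterate, image_iterate_eq]
    exact Function.iterate_fixed hfU n
  have hnF : ∀ y, Complex.exp ((F ^ n : ℂ ≃ₜ ℂ) y) = (f ^ n : ℂ ≃ₜ ℂ) (Complex.exp y) := by
    simp only [Homeomorph.coe_pow_eq_iterate]
    exact fun y => (Function.Semiconj.iterate_right (f := Complex.exp) hF n) y
  have hnL : ∀ x ∈ U, (F ^ n : ℂ ≃ₜ ℂ) (d.L x) = d.L ((f ^ n : ℂ ≃ₜ ℂ) x) := by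
    simp only [Homeomorph.coe_pow_eq_iterate]
    clear hnF hnU hfn hno hKU hn1 hn60 hn
    induction n with
    | zero => simp
    | succ n ih =>
      intro x hx
      rw [Function.iterate_succ_apply, Function.iterate_succ_apply, hFL x hx, ih _ (hf hx)]
  rcases htw with htw | htw
  · obtain ⟨B, hB⟩ := exists_iterate_twist hf htw n
    obtain ⟨E, g, hg, hE, hd⟩ := d.exists_isCrossSection hU hnU hnF hnL
      ⟨B, fun x hx hxB => by
        rw [Homeomorph.coe_pow_eq_iterate]; linarith [hB x hx hxB]⟩ hK hKU
    exact hno g E hg hE hd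
  · obtain ⟨B, hB⟩ := exists_iterate_twist (θ := fun x => -d.θ x) (ε := ε) (R := R) hf
      (fun x hx hxR => by linarith [htw x hx hxR]) n
    obtain ⟨C, hC⟩ := exists_norm_lt_apply (f ^ n : ℂ ≃ₜ ℂ).symm B
    have hsU : (f ^ n : ℂ ≃ₜ ℂ).symm '' U = U := by
      conv_lhs => rw [← hnU]
      rw [image_image]; simp
    have hfs : MapsTo (f ^ n : ℂ ≃ₜ ℂ).symm U U := fun x hx => hsU ▸ mem_image_of_mem _ hx
    obtain ⟨E, g, hg, hE, hd⟩ := d.exists_isCrossSection hU (g := (f ^ n : ℂ ≃ₜ ℂ).symm)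
      (G := (F ^ n : ℂ ≃ₜ ℂ).symm) hsU
      (fun y => by
        rw [Homeomorph.eq_symm_apply, ← hnF, Homeomorph.apply_symm_apply])
      (fun x hx => by
        rw [Homeomorph.symm_apply_eq, hnL _ (hfs hx), Homeomorph.apply_symm_apply])
      ⟨C, fun x hx hxC => by
        have := hB _ (hfs hx) (hC x hxC)
        rw [← Homeomorph.coe_pow_eq_iterate, Homeomorph.apply_symm_apply] at this
        linarith⟩ hK hKU
    exact hno g E (by rw [Homeomorph.symm_symm] at hg; exact hg.symm) hE hd

theorem IsOrientationPreserving.conj {Y Z : Type*} [TopologicalSpace Y] [TopologicalSpace Z]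
    {f : Y ≃ₜ Y} (h : IsOrientationPreserving f) (e : Y ≃ₜ Z) :
    IsOrientationPreserving ((e.symm.trans f).trans e) := by
  obtain ⟨H, hH, hH0, hH1, hHi⟩ := h
  refine ⟨fun p => e (H (p.1, e.symm p.2)), by fun_prop, fun x => by simp [hH0],
    fun x => by simp [hH1], fun t => ?_⟩
  exact e.isHomeomorph.comp ((hHi t).comp e.symm.isHomeomorph)

/-- If moreover `U` is unbounded, then `f` has no fixed point in `ℝ² ∖ U`:
every fixed point of `f` lies in `U`. -/
theorem fixed_points_in_U_of_unbounded
    (f : (ℝ × ℝ) ≃ₜ (ℝ × ℝ)) (hor : IsOrientationPreserving f)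
    (U : Set (ℝ × ℝ)) (hUopen : IsOpen U) (hUinv : ⇑f '' U = U)
    (hUsc : SimplyConnectedSpace ↥U) (hUproper : U ≠ Set.univ)
    (hbnw : BdNonwandering f U)
    (hrot : ∃ F : PrimeEndComp U ≃ₜ PrimeEndComp U, IsPEExtension f U F ∧
      ∀ p : PrimeEnd U, F (peEnd U p) ≠ peEnd U p)
    (hUunbd : ¬Bornology.IsBounded U) :
    ∀ z : ℝ × ℝ, f z = z → z ∈ U := by
  intro z hz
  by_contra hzU
  obtain ⟨F, hF, hFp⟩ := hrot
  set e : (ℝ × ℝ) ≃ₜ ℂ := (Homeomorph.subRight z).trans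
    Complex.equivRealProdCLM.symm.toHomeomorph with he
  have hez : e z = 0 := by simp [he]
  have hez' : e.symm 0 = z := by rw [e.symm_apply_eq, hez]
  have hs : e.symm '' (e '' U) = U := by rw [image_image]; simp
  obtain ⟨d⟩ := LogData.exists (U := e '' U) (e.isOpenMap U hUopen)
    ((e.image U).symm.toHomotopyEquiv.simplyConnectedSpace) (by
      rintro ⟨x, hx, hx0⟩
      rw [← hez] at hx0
      exact hzU (e.injective hx0 ▸ hx))
  refine d.not_bdNonwandering (f := (e.symm.trans f).trans e) (fun hb => hUunbd ?_)
    (by simp [hez', hz, hez]) (hor.conj e) ?_ (fun D γ hn => ?_) (hbnw.conj e)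
  · rw [← hs]
    have hc := (hb.isCompact_closure.image e.symm.continuous).isBounded
    exact hc.subset (image_mono subset_closure)
  · rw [image_image]
    conv_rhs => rw [← hUinv]
    rw [image_image]
    simp
  · have hn' := hn.image e.symm
    rw [hs] at hn'
    obtain ⟨m, hm⟩ := hn'.exists_displaced hUopen hUinv hF hFp
    refine ⟨m, ?_⟩
    have := (disjoint_image_iff e.injective).2 hm
    rw [image_image, image_image, image_image] at this
    simp only [e.apply_symm_apply, image_id'] at this
    exact this

end
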